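/- Let p, q ≥ 1 with gcd(p,q) = 1, and let f_p, f_q ∈ ℂ[x,y,z] be homogeneous polynomials of degrees p and q respectively satisfying: (i) neither f_p nor f_q is a k-th power of another polynomial for any k ≥ 2; (ii) f_p and f_q have no nonconstant common factor; (iii) there is a finite set A₀ ⊆ ℙ¹ such that for every [a:b] ∈ ℙ¹ \ A₀ the fiber {x ∈ ℙ² \ (V(f_p) ∩ V(f_q)) : b·f_p^q(x) = a·f_q^p(x)} of the pencil F = [f_p^q : f_q^p] is connected; (iv) for all nonzero a, b ∈ ℂ, the polynomial b·f_p^q − a·f_q^p is not a k-th power of another polynomial for any k ≥ 2. Assume moreover that f_p is irreducible and that π₁(ℙ² \ V(f_p)) ≅ ℤ_p. Then there exists a finite set A ⊆ ℙ¹ such that for every r ≥ 0 and every choice of r+1 distinct points [a₀:b₀],…,[a_r:b_r] ∈ ℙ¹ \ A, setting C = ⋃_{i=0}^{r} V(b_i·f_p^q − a_i·f_q^p), one has π₁(ℙ² \ (C ∪ V(f_p))) ≅ 𝔽_{r+1} * ℤ_p. -/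

import Mathlib

open MvPolynomial

noncomputable section

/-- The complex projective plane, as the projectivization of `ℂ³`. -/
abbrev P2 : Type := Projectivization ℂ (Fin 3 → ℂ)

/-- The complex projective line, as the projectivization of `ℂ²`. -/
abbrev P1 : Type := Projectivization ℂ (Fin 2 → ℂ)

instance : TopologicalSpace P2 :=
  inferInstanceAs (TopologicalSpace (Quotient (projectivizationSetoid ℂ (Fin 3 → ℂ))))

instance : TopologicalSpace P1 :=
  inferInstanceAs (TopologicalSpace (Quotient (projectivizationSetoid ℂ (Fin 2 → ℂ))))

/-- The zero locus in `ℙ²` of a homogeneous polynomial `g ∈ ℂ[x,y,z]`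
(for homogeneous `g` the vanishing of `g` at the chosen representative `x.rep`
is independent of the choice of representative). -/
def V (g : MvPolynomial (Fin 3) ℂ) : Set P2 :=
  {x | eval x.rep g = 0}

/-- The point `[a:b] ∈ ℙ¹`. -/
def pt (a b : ℂ) (hab : ![a, b] ≠ 0) : P1 := Projectivization.mk ℂ ![a, b] hab

open scoped TensorProduct
namespace Oka

theorem exists_derivation_ne_zero {K : Type} [Field K] [Algebra ℂ K] (x : K)
    (hx : ∀ D : Derivation ℂ K K, D x = 0) : IsAlgebraic ℂ x := by
  by_contra htr
  have htr : Transcendental ℂ x := htr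
  have hind : AlgebraicIndepOn ℂ id ({x} : Set K) := by
    have : AlgebraicIndependent ℂ (fun i : ({x} : Set K) => (i : K)) := by
      rw [algebraicIndependent_unique_type_iff]
      exact htr
    exact this
  obtain ⟨s, hs, hsb⟩ := exists_isTranscendenceBasis_superset (R := ℂ) hind
  have hxs : x ∈ s := hs rfl
  have halg := hsb.isAlgebraic
  let A := MvPolynomial s ℂ
  let f : A →ₐ[ℂ] K := aeval (fun i : s => (i : K))
  have hf : Function.Injective f := hsb.1
  letI : Algebra A K := f.toRingHom.toAlgebra
  haveI : IsScalarTower ℂ A K := IsScalarTower.of_algebraMap_eq' (f.comp_algebraMap.symm)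
  have hinj : Function.Injective (algebraMap A K) := hf
  haveI : FaithfulSMul A K := (faithfulSMul_iff_algebraMap_injective A K).2 hinj
  let L := FractionRing A
  letI : Algebra L K := FractionRing.liftAlgebra A K
  haveI : IsScalarTower A L K := FractionRing.isScalarTower_liftAlgebra A K
  have algA : Algebra.IsAlgebraic A K := by
    constructor
    intro y
    have := halg.1 y
    obtain ⟨P, hP0, hP⟩ := this
    let e : A ≃ₐ[ℂ] Algebra.adjoin ℂ (Set.range (fun i : s => (i : K))) := hsb.1.aevalEquiv
    refine ⟨P.map (e.symm : _ →+* A), ?_, ?_⟩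
    · exact (Polynomial.map_ne_zero_iff e.symm.injective).2 hP0
    · rw [Polynomial.aeval_def, Polynomial.eval₂_map]
      rw [Polynomial.aeval_def] at hP
      convert hP using 2
      ext z
      obtain ⟨w, rfl⟩ := e.surjective z
      simp only [RingHom.comp_apply]
      have : (e.symm : _ →+* A) (e w) = w := e.symm_apply_apply w
      rw [this]
      rfl
  haveI : Algebra.IsAlgebraic L K := by
    exact (IsFractionRing.comap_isAlgebraic_iff (A := A) (K := L) (C := K)).1 algA
  haveI : CharZero L := charZero_of_injective_algebraMap (IsFractionRing.injective A L)
  haveI : Algebra.FormallyEtale L K := Algebra.FormallyEtale.of_isSeparable L K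
  haveI : Algebra.FormallyEtale A L := Algebra.FormallyEtale.of_isLocalization (nonZeroDivisors A)
  haveI : Algebra.FormallyEtale A K := Algebra.FormallyEtale.comp A L K
  classical
  let d : Derivation ℂ A K := MvPolynomial.mkDerivation ℂ (Pi.single ⟨x, hxs⟩ 1)
  let ℓ : Ω[A⁄ℂ] →ₗ[A] K := d.liftKaehlerDifferential
  let m : TensorProduct A K Ω[A⁄ℂ] →ₗ[K] K := TensorProduct.AlgebraTensorModule.lift
    ((LinearMap.toSpanSingleton K (Ω[A⁄ℂ] →ₗ[A] K) ℓ))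
  let e := KaehlerDifferential.tensorKaehlerEquivOfFormallyEtale ℂ A K
  let D : Derivation ℂ K K := (m.comp e.symm.toLinearMap).compDer (KaehlerDifferential.D ℂ K)
  have hD := hx D
  have hxX : x = algebraMap A K (X ⟨x, hxs⟩) := by
    exact (aeval_X (R := ℂ) (fun i : s => (i : K)) ⟨x, hxs⟩).symm
  have : D x = 1 := by
    change m (e.symm (KaehlerDifferential.D ℂ K x)) = 1
    rw [hxX, KaehlerDifferential.tensorKaehlerEquivOfFormallyEtale_symm_D_algebraMap]
    have h1 : d (X ⟨x, hxs⟩) = 1 := by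
      refine (MvPolynomial.mkDerivation_X _ _ _).trans ?_
      simp
    have h2 : m (1 ⊗ₜ[A] KaehlerDifferential.D ℂ A (X ⟨x, hxs⟩)) =
        d.liftKaehlerDifferential (KaehlerDifferential.D ℂ A (X ⟨x, hxs⟩)) := by
      simp [m, ℓ]
    exact h2.trans ((Derivation.liftKaehlerDifferential_comp_D _ _).trans h1)
  rw [this] at hD
  exact one_ne_zero hD

end Oka

namespace Oka

theorem crit_const (N M : MvPolynomial (Fin 3) ℂ) (𝔭 : Ideal (MvPolynomial (Fin 3) ℂ))
    [𝔭.IsPrime] (hE : ∀ k, M * pderiv k N - N * pderiv k M ∈ 𝔭) (hM : M ∉ 𝔭) :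
    ∃ c : ℂ, N - C c * M ∈ 𝔭 := by
  let A := MvPolynomial (Fin 3) ℂ
  let K := FractionRing (A ⧸ 𝔭)
  let g : A →ₐ[ℂ] K := (IsScalarTower.toAlgHom ℂ (A ⧸ 𝔭) K).comp (Ideal.Quotient.mkₐ ℂ 𝔭)
  have hg : ∀ f : A, g f = 0 ↔ f ∈ 𝔭 := by
    intro f
    change algebraMap (A ⧸ 𝔭) K (Ideal.Quotient.mk 𝔭 f) = 0 ↔ _
    rw [map_eq_zero_iff _ (IsFractionRing.injective (A ⧸ 𝔭) K), Ideal.Quotient.eq_zero_iff_mem]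
  have hgM : g M ≠ 0 := fun h => hM ((hg M).1 h)
  have key : ∀ (D : Derivation ℂ K K) (f : A), D (g f) = ∑ k, g (pderiv k f) * D (g (X k)) := by
    intro D f
    induction f using MvPolynomial.induction_on with
    | C a =>
      have : g (C a) = algebraMap ℂ K a := g.commutes a
      rw [this]; simp
    | add f1 f2 h1 h2 => simp [h1, h2, add_mul, Finset.sum_add_distrib]
    | mul_X f j h =>
      rw [map_mul, Derivation.leibniz, h]
      simp only [Derivation.leibniz, pderiv_X, smul_eq_mul, map_add, map_mul, add_mul,
        Finset.sum_add_distrib, Finset.mul_sum]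
      congr 1
      · rw [Finset.sum_eq_single j]
        · simp
        · intro b _ hb; simp [Pi.single_apply, Ne.symm hb]
        · simp
      · rw [Finset.mul_sum]
        exact Finset.sum_congr rfl fun k _ => (mul_assoc _ _ _).symm
  have hD : ∀ D : Derivation ℂ K K, D (g N / g M) = 0 := by
    intro D
    have h1 : D (g N) * g M = g N * D (g M) := by
      rw [key D N, key D M, Finset.sum_mul, Finset.mul_sum]
      refine Finset.sum_congr rfl fun k _ => ?_
      have := (hg _).2 (hE k)
      rw [map_sub, map_mul, map_mul, sub_eq_zero] at this
      linear_combination D (g (X k)) * this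
    have h2 : D (g N) = g M * D (g N / g M) + (g N / g M) * D (g M) := by
      conv_lhs => rw [show g N = g M * (g N / g M) from (mul_div_cancel₀ (g N) hgM).symm]
      rw [Derivation.leibniz]; simp
    have h3 : g M * g M * D (g N / g M) = 0 := by
      have h4 : g N / g M * g M = g N := div_mul_cancel₀ (g N) hgM
      linear_combination h1 - g M * h2 - D (g M) * h4
    simpa [hgM] using h3
  have halg := exists_derivation_ne_zero _ hD
  obtain ⟨c, hc⟩ : ∃ c : ℂ, algebraMap ℂ K c = g N / g M := by
    have hi := halg.isIntegral
    have h5 := (minpoly.irreducible hi)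
    have h6 := IsAlgClosed.degree_eq_one_of_irreducible ℂ h5
    exact minpoly.mem_range_of_degree_eq_one ℂ _ h6
  refine ⟨c, (hg _).1 ?_⟩
  have : g (C c) = algebraMap ℂ K c := g.commutes c
  rw [map_sub, map_mul, this, hc]
  rw [div_mul_cancel₀ (g N) hgM, sub_self]

theorem crit_finite (N M : MvPolynomial (Fin 3) ℂ) :
    {c : ℂ | ∃ v, eval v M ≠ 0 ∧ eval v N = c * eval v M ∧
      ∀ k, eval v (M * pderiv k N - N * pderiv k M) = 0}.Finite := by
  classical
  let I : Ideal (MvPolynomial (Fin 3) ℂ) :=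
    Ideal.span (Set.range fun k => M * pderiv k N - N * pderiv k M)
  have hfin : I.minimalPrimes.Finite := Ideal.finite_minimalPrimes_of_isNoetherianRing _ I
  let cf : Ideal (MvPolynomial (Fin 3) ℂ) → ℂ := fun 𝔭 =>
    if h : ∃ c : ℂ, N - C c * M ∈ 𝔭 then h.choose else 0
  refine (hfin.image cf).subset ?_
  rintro c ⟨v, hM, hN, hE⟩
  let 𝔪 : Ideal (MvPolynomial (Fin 3) ℂ) := RingHom.ker (eval v)
  haveI : 𝔪.IsPrime := RingHom.ker_isPrime _
  have hI : I ≤ 𝔪 := by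
    rw [Ideal.span_le]
    rintro _ ⟨k, rfl⟩
    exact hE k
  obtain ⟨𝔭, h𝔭, hle⟩ := Ideal.exists_minimalPrimes_le hI
  haveI : 𝔭.IsPrime := h𝔭.1.1
  have hM' : M ∉ 𝔭 := fun h => hM (hle h)
  have hex := crit_const N M 𝔭 (fun k => h𝔭.1.2 (Ideal.subset_span ⟨k, rfl⟩)) hM'
  refine ⟨𝔭, h𝔭, ?_⟩
  have hcf : cf 𝔭 = hex.choose := dif_pos hex
  have h2 : eval v (N - C hex.choose * M) = 0 := hle hex.choose_spec
  rw [hcf]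
  simp only [map_sub, map_mul, eval_C, hN] at h2
  have h3 : (c - hex.choose) * eval v M = 0 := by linear_combination h2
  rcases mul_eq_zero.1 h3 with h | h
  · exact (sub_eq_zero.1 h).symm
  · exact absurd h hM
end Oka

namespace Oka

theorem linear_relation {R : Type} [CommRing R] [IsDomain R] (P : Polynomial R) (hP : P ≠ 0)
    (f : ℕ → Polynomial R) : ∃ a : Fin (P.natDegree + 1) → R, a ≠ 0 ∧
      P ∣ ∑ i, Polynomial.C (a i) * f i := by
  classical
  let K := FractionRing R
  let φ : Polynomial R →+* Polynomial K := Polynomial.mapRingHom (algebraMap R K)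
  have hinj : Function.Injective (algebraMap R K) := IsFractionRing.injective R K
  have hPK : φ P ≠ 0 := by
    simpa [φ] using (Polynomial.map_ne_zero_iff hinj).2 hP
  have hdeg : (φ P).natDegree = P.natDegree := Polynomial.natDegree_map_eq_of_injective hinj P
  let pb := AdjoinRoot.powerBasis hPK
  haveI : Module.Finite K (AdjoinRoot (φ P)) := pb.finite
  have hfr : Module.finrank K (AdjoinRoot (φ P)) = P.natDegree := by
    rw [pb.finrank, AdjoinRoot.powerBasis_dim, hdeg]
  let w : Fin (P.natDegree + 1) → AdjoinRoot (φ P) := fun i => AdjoinRoot.mk (φ P) (φ (f i))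
  have hdep : ¬ LinearIndependent K w := by
    intro h
    have := h.fintype_card_le_finrank
    rw [hfr] at this
    simp at this
  obtain ⟨g, hg, i0, hi0⟩ := Fintype.not_linearIndependent_iff.1 hdep
  obtain ⟨b, hb⟩ := IsLocalization.exist_integer_multiples_of_finite (nonZeroDivisors R) g
  choose a ha using hb
  have hb0 : algebraMap R K b ≠ 0 := by
    simpa using (map_ne_zero_iff _ hinj).2 (nonZeroDivisors.ne_zero b.2)
  have ha' : ∀ i, algebraMap R K (a i) = algebraMap R K b * g i := by
    intro i
    rw [ha i, Algebra.smul_def]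
  have hdvd : φ P ∣ φ (∑ i, Polynomial.C (a i) * f i) := by
    rw [← AdjoinRoot.mk_eq_zero, map_sum, map_sum]
    have : ∀ i, AdjoinRoot.mk (φ P) (φ (Polynomial.C (a i) * f i)) =
        algebraMap R K b • (g i • w i) := by
      intro i
      have h1 : φ (Polynomial.C (a i)) = Polynomial.C (algebraMap R K b * g i) := by
        simp [φ, ha']
      rw [map_mul, map_mul, h1, smul_smul, Algebra.smul_def]
      rfl
    rw [Finset.sum_congr rfl fun i _ => this i, ← Finset.smul_sum, hg, smul_zero]
  obtain ⟨h, hh⟩ := hdvd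
  obtain ⟨b2, hb2⟩ := IsLocalization.integerNormalization_map_to_map (nonZeroDivisors R) h
  have hb20 : (b2 : R) ≠ 0 := nonZeroDivisors.ne_zero b2.2
  refine ⟨fun i => b2 * a i, ?_, IsLocalization.integerNormalization (nonZeroDivisors R) h, ?_⟩
  · intro h0
    have h1 : (b2 : R) * a i0 = 0 := congrFun h0 i0
    have h2 : a i0 = 0 := (mul_eq_zero.1 h1).resolve_left hb20
    have h3 := ha' i0
    rw [h2, map_zero] at h3
    exact (mul_ne_zero hb0 hi0) h3.symm
  · apply Polynomial.map_injective _ hinj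
    rw [Polynomial.map_mul, hb2]
    change φ _ = φ P * _
    have : φ (∑ i, Polynomial.C ((b2 : R) * a i) * f i) =
        Polynomial.C (algebraMap R K b2) * φ (∑ i, Polynomial.C (a i) * f i) := by
      have : (∑ i, Polynomial.C ((b2 : R) * a i) * f i) =
        Polynomial.C (b2 : R) * (∑ i, Polynomial.C (a i) * f i) := by
        simp [Finset.mul_sum, mul_assoc]
      rw [this, map_mul]; simp [φ]
    rw [this, hh, Algebra.smul_def]
    change _ = φ P * (Polynomial.C (algebraMap R K b2) * h)
    ring

/-- elimination: a prime polynomial and a polynomial not divisible by it generate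
a nonzero constant. -/
theorem elimination {R : Type} [CommRing R] [IsDomain R] (P Q : Polynomial R) (hP : Prime P)
    (hQ : ¬ P ∣ Q) : ∃ a : R, a ≠ 0 ∧ ∃ u v : Polynomial R, Polynomial.C a = P * u + Q * v := by
  obtain ⟨a, ha, hdvd⟩ := linear_relation P hP.ne_zero (fun i => Q ^ i)
  have main : ∀ (n : ℕ) (a : Fin n → R), a ≠ 0 → P ∣ ∑ i : Fin n, Polynomial.C (a i) * Q ^ (i : ℕ) →
      ∃ a : R, a ≠ 0 ∧ ∃ u v : Polynomial R, Polynomial.C a = P * u + Q * v := by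
    intro n
    induction n with
    | zero => intro a ha; exact absurd (Subsingleton.elim _ _) ha
    | succ n ih =>
      intro a ha hd
      rw [Fin.sum_univ_succ] at hd
      simp only [Fin.val_zero, pow_zero, mul_one, Fin.val_succ, pow_succ] at hd
      have e : ∑ i : Fin n, Polynomial.C (a i.succ) * (Q ^ (i : ℕ) * Q) =
          Q * ∑ i : Fin n, Polynomial.C (a i.succ) * Q ^ (i : ℕ) := by
        rw [Finset.mul_sum]; exact Finset.sum_congr rfl fun i _ => by ring
      rw [e] at hd
      by_cases h0 : a 0 = 0
      · rw [h0, Polynomial.C_0, zero_add] at hd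
        refine ih (fun i => a i.succ) ?_ ((hP.dvd_or_dvd hd).resolve_left hQ)
        intro h
        apply ha
        funext i
        refine Fin.cases h0 (fun j => congrFun h j) i
      · obtain ⟨u, hu⟩ := hd
        exact ⟨a 0, h0, u, -∑ i : Fin n, Polynomial.C (a i.succ) * Q ^ (i : ℕ), by
          linear_combination hu⟩
  exact main _ a ha hdvd
end Oka

namespace Oka

theorem eval_smul_hom {f : MvPolynomial (Fin 3) ℂ} {n : ℕ} (hf : f.IsHomogeneous n) (l : ℂ)
    (v : Fin 3 → ℂ) : eval (l • v) f = l ^ n * eval v f := by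
  rw [eval_eq', eval_eq', Finset.mul_sum]
  refine Finset.sum_congr rfl fun d hd => ?_
  have hdeg : ∑ i, d i = n := by
    have := hf (mem_support_iff.1 hd)
    rw [← this, Finsupp.weight_apply, Finsupp.sum_fintype _ _ (by simp)]
    simp
  simp only [Pi.smul_apply, smul_eq_mul, mul_pow, Finset.prod_mul_distrib, Finset.prod_pow_eq_pow_sum,
    hdeg]
  ring

theorem exists_eval_ne_zero {σ : Type} {f : MvPolynomial σ ℂ} (hf : f ≠ 0) :
    ∃ v, eval v f ≠ 0 := by
  by_contra! h
  exact hf (MvPolynomial.funext fun v => by simpa using h v)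

theorem base_ratio_finite (fp fq : MvPolynomial (Fin 3) ℂ) (p q : ℕ) (hfp : fp.IsHomogeneous p)
    (hfq : fq.IsHomogeneous q) (hirr : Irreducible fp) (hnd : ¬ fp ∣ fq) (j k : Fin 3)
    (hjk : j ≠ k) : ∃ S : Set ℂ, S.Finite ∧ ∀ v : Fin 3 → ℂ, eval v fp = 0 → eval v fq = 0 →
      v j = 1 → v k ∈ S := by
  obtain ⟨e, hej, hek⟩ : ∃ e : Equiv.Perm (Fin 3), e 1 = j ∧ e 2 = k := by
    revert j k; decide
  let Ψ : MvPolynomial (Fin 3) ℂ ≃ₐ[ℂ] Polynomial (MvPolynomial (Fin 2) ℂ) :=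
    (renameEquiv ℂ e.symm).trans (finSuccEquiv ℂ 2)
  have hpr : Prime (Ψ fp) := (MulEquiv.prime_iff Ψ.toMulEquiv).2 hirr.prime
  have hnd' : ¬ Ψ fp ∣ Ψ fq := fun h => hnd ((map_dvd_iff Ψ.toMulEquiv).1 h)
  obtain ⟨a, ha, u, w, huw⟩ := elimination _ _ hpr hnd'
  have hev : ∀ (f : MvPolynomial (Fin 3) ℂ) (v : Fin 3 → ℂ),
      Polynomial.eval (v (e 0)) (Polynomial.map (eval ![v j, v k]) (Ψ f)) = eval v f := by
    intro f v
    have h := eval_eq_eval_mv_eval' (![v j, v k]) (v (e 0)) (rename e.symm f)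
    have h2 : Fin.cons (v (e 0)) ![v j, v k] ∘ e.symm = v := by
      funext i
      obtain ⟨i, rfl⟩ := e.surjective i
      simp only [Function.comp, Equiv.symm_apply_apply]
      fin_cases i
      · rfl
      · simp [← hej]
      · simp [← hek]
    rw [eval_rename, h2] at h
    exact h.symm
  have hz : ∀ v : Fin 3 → ℂ, eval v fp = 0 → eval v fq = 0 → eval ![v j, v k] a = 0 := by
    intro v h1 h2
    have h3 := congrArg (fun f => Polynomial.eval (v (e 0)) (Polynomial.map (eval ![v j, v k]) f)) huw
    simp only [Polynomial.map_add, Polynomial.map_mul, Polynomial.eval_add, Polynomial.eval_mul,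
      hev, h1, h2, zero_mul, add_zero, Polynomial.map_C, Polynomial.eval_C] at h3
    exact h3
  obtain ⟨st, hst⟩ := exists_eval_ne_zero (mul_ne_zero (X_ne_zero (R := ℂ) (0 : Fin 2)) ha)
  rw [map_mul, eval_X] at hst
  have hs0 : st 0 ≠ 0 := left_ne_zero_of_mul hst
  have ha0 : eval st a ≠ 0 := right_ne_zero_of_mul hst
  let b : Polynomial ℂ := aeval ![Polynomial.C (st 0), Polynomial.C (st 0) * Polynomial.X] a
  have hb : ∀ τ, b.eval τ = eval ![st 0, st 0 * τ] a := by
    intro τ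
    have : (Polynomial.evalRingHom τ).comp (aeval ![Polynomial.C (st 0), Polynomial.C (st 0) * Polynomial.X] : MvPolynomial (Fin 2) ℂ →ₐ[ℂ] Polynomial ℂ).toRingHom = (eval ![st 0, st 0 * τ] : MvPolynomial (Fin 2) ℂ →+* ℂ) := by
      apply MvPolynomial.ringHom_ext
      · intro r; simp
      · intro i; fin_cases i <;> simp
    exact congrArg (fun g => g a) this
  have hb0 : b ≠ 0 := by
    intro h
    have := hb (st 1 / st 0)
    rw [h, Polynomial.eval_zero, mul_div_cancel₀ _ hs0] at this
    apply ha0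
    rw [this]
    congr 2
    funext i; fin_cases i <;> rfl
  refine ⟨{τ | b.IsRoot τ}, Polynomial.finite_setOf_isRoot hb0, ?_⟩
  intro v h1 h2 hj
  have := hz (st 0 • v) (by rw [eval_smul_hom hfp, h1, mul_zero])
    (by rw [eval_smul_hom hfq, h2, mul_zero])
  simp only [Pi.smul_apply, smul_eq_mul, hj, mul_one] at this
  change b.eval (v k) = 0
  rw [hb, this]

def BaseT (fp fq : MvPolynomial (Fin 3) ℂ) : Set (Fin 3 → ℂ) :=
  {v | eval v fp = 0 ∧ eval v fq = 0 ∧ ∃ i, v i = 1 ∧ ∀ j < i, v j = 0}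

theorem BaseT_finite (fp fq : MvPolynomial (Fin 3) ℂ) (p q : ℕ) (hfp : fp.IsHomogeneous p)
    (hfq : fq.IsHomogeneous q) (hirr : Irreducible fp) (hnd : ¬ fp ∣ fq) :
    (BaseT fp fq).Finite := by
  choose! S hS hS2 using base_ratio_finite fp fq p q hfp hfq hirr hnd
  have : BaseT fp fq ⊆ ⋃ i : Fin 3, Set.univ.pi fun k => if i = k then {1} else S i k := by
    rintro v ⟨h1, h2, i, hi, -⟩
    refine Set.mem_iUnion.2 ⟨i, fun k _ => ?_⟩
    by_cases h : i = k
    · subst h; simp [hi]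
    · simp only [h, if_false]; exact hS2 i k h v h1 h2 hi
  refine Set.Finite.subset (Set.finite_iUnion fun i => Set.Finite.pi fun k => ?_) this
  by_cases h : i = k
  · simp [h]
  · simp only [h, if_false]; exact hS i k h

theorem BaseT_ne_zero {fp fq : MvPolynomial (Fin 3) ℂ} {v} (hv : v ∈ BaseT fp fq) : v ≠ 0 := by
  rintro rfl
  obtain ⟨-, -, i, hi, -⟩ := hv
  simp at hi

theorem BaseT_exists {fp fq : MvPolynomial (Fin 3) ℂ} {p q : ℕ} (hfp : fp.IsHomogeneous p)
    (hfq : fq.IsHomogeneous q) {v : Fin 3 → ℂ} (hv : v ≠ 0) (h1 : eval v fp = 0)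
    (h2 : eval v fq = 0) : ∃ w ∈ BaseT fp fq, ∃ l : ℂ, l ≠ 0 ∧ v = l • w := by
  have hex : ∃ i, v i ≠ 0 := Function.ne_iff.1 hv
  classical
  let i := Fin.find (fun i => v i ≠ 0) hex
  have hi : v i ≠ 0 := Fin.find_spec hex
  refine ⟨(v i)⁻¹ • v, ⟨by rw [eval_smul_hom hfp, h1, mul_zero],
    by rw [eval_smul_hom hfq, h2, mul_zero], i, by simp [hi], fun j hj => ?_⟩, v i, hi, ?_⟩
  · have := Fin.find_min hex hj
    simp only [not_not] at this
    simp [this]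
  · rw [smul_smul, mul_inv_cancel₀ hi, one_smul]

theorem BaseT_unique {fp fq : MvPolynomial (Fin 3) ℂ} {v w : Fin 3 → ℂ} (hv : v ∈ BaseT fp fq)
    (hw : w ∈ BaseT fp fq) {l : ℂ} (hl : l ≠ 0) (h : v = l • w) : v = w := by
  obtain ⟨-, -, i, hi, hi'⟩ := hv
  obtain ⟨-, -, j, hj, hj'⟩ := hw
  have e : ∀ k, v k = l * w k := fun k => congrFun h k
  rcases lt_trichotomy i j with hij | hij | hij
  · have := e i; rw [hj' i hij, hi] at this; simp at this
  · subst hij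
    have := e i; rw [hi, hj, mul_one] at this
    rw [h, ← this, one_smul]
  · have := e j; rw [hi' j hij, hj] at this; simp at this; exact absurd this.symm hl
end Oka

namespace Oka

/-- The basic data. -/
structure Dat where
  p : ℕ
  q : ℕ
  hp : 1 ≤ p
  hq : 1 ≤ q
  hpq : Nat.Coprime p q
  fp : MvPolynomial (Fin 3) ℂ
  fq : MvPolynomial (Fin 3) ℂ
  hfp : fp.IsHomogeneous p
  hfq : fq.IsHomogeneous q
  hfq0 : fq ≠ 0
  hirr : Irreducible fp
  hcf : ∀ h : MvPolynomial (Fin 3) ℂ, h ∣ fp → h ∣ fq → h.totalDegree = 0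

variable (D : Dat)

namespace Dat

abbrev P (v : Fin 3 → ℂ) : ℂ := eval v D.fp
abbrev Q (v : Fin 3 → ℂ) : ℂ := eval v D.fq
/-- the rational function -/
def φ (v : Fin 3 → ℂ) : ℂ := D.Q v ^ D.p / D.P v ^ D.q

theorem hfp0 : D.fp ≠ 0 := D.hirr.ne_zero

theorem hnd : ¬ D.fp ∣ D.fq := by
  intro h
  have h1 := D.hcf D.fp dvd_rfl h
  rw [D.hfp.totalDegree D.hfp0] at h1
  have := D.hp
  omega

theorem exists_pderiv : ∃ k, pderiv k D.fp ≠ 0 := by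
  by_contra! h
  have h1 := D.hfp.sum_X_mul_pderiv
  simp only [h, mul_zero, Finset.sum_const_zero] at h1
  have h2 : (D.p : MvPolynomial (Fin 3) ℂ) * D.fp = 0 := by rw [h1]; simp
  rcases mul_eq_zero.1 h2 with h3 | h3
  · have := D.hp
    norm_cast at h3; omega
  · exact D.hfp0 h3

theorem not_dvd_pderiv (k : Fin 3) (h : D.fp ∣ pderiv k D.fp) : pderiv k D.fp = 0 := by
  by_contra h0
  obtain ⟨g, hg⟩ := h
  have hg0 : g ≠ 0 := by rintro rfl; simp [hg] at h0
  have h1 := congrArg totalDegree hg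
  rw [totalDegree_mul_of_isDomain D.hfp0 hg0, D.hfp.totalDegree D.hfp0,
    (D.hfp.pderiv (i := k)).totalDegree h0] at h1
  have := D.hp
  omega

/-- Numerators of the partial derivatives of `φ`. -/
def E (k : Fin 3) : MvPolynomial (Fin 3) ℂ :=
  C (D.p : ℂ) * D.fp * pderiv k D.fq - C (D.q : ℂ) * D.fq * pderiv k D.fp

theorem exists_E : ∃ k, D.E k ≠ 0 := by
  obtain ⟨k, hk⟩ := D.exists_pderiv
  refine ⟨k, fun h => hk (D.not_dvd_pderiv k ?_)⟩
  have h1 : D.fp ∣ D.fq * pderiv k D.fp := by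
    have hq : (D.q : ℂ) ≠ 0 := by have := D.hq; norm_cast; omega
    refine ⟨C ((D.q : ℂ)⁻¹ * D.p) * pderiv k D.fq, ?_⟩
    have h2 : C (D.q : ℂ)⁻¹ * C (D.q : ℂ) = (1 : MvPolynomial (Fin 3) ℂ) := by
      rw [← C_mul, inv_mul_cancel₀ hq, C_1]
    unfold E at h
    rw [C_mul]
    linear_combination (- C (D.q : ℂ)⁻¹) * h - (D.fq * pderiv k D.fp) * h2
  exact (D.hirr.prime.dvd_or_dvd h1).resolve_left D.hnd

theorem deriv_rel (k : Fin 3) : D.fp ^ D.q * pderiv k (D.fq ^ D.p) - D.fq ^ D.p * pderiv k (D.fp ^ D.q)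
    = D.fp ^ (D.q - 1) * D.fq ^ (D.p - 1) * D.E k := by
  obtain ⟨p', hp'⟩ : ∃ p', D.p = p' + 1 := ⟨D.p - 1, by have := D.hp; omega⟩
  obtain ⟨q', hq'⟩ : ∃ q', D.q = q' + 1 := ⟨D.q - 1, by have := D.hq; omega⟩
  unfold E
  rw [hp', hq']
  simp only [Derivation.leibniz_pow, add_tsub_cancel_right, smul_eq_mul, nsmul_eq_mul]
  simp only [Nat.cast_add, Nat.cast_one, C_add, C_1, map_natCast]
  ring

theorem critFinite : {c : ℂ | ∃ v, D.P v ≠ 0 ∧ D.φ v = c ∧ ∀ k, eval v (D.E k) = 0}.Finite := by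
  refine (crit_finite (D.fq ^ D.p) (D.fp ^ D.q)).subset ?_
  rintro c ⟨v, h1, h2, h3⟩
  refine ⟨v, by simpa using pow_ne_zero D.q h1, ?_, fun k => ?_⟩
  · rw [← h2, φ]; simp only [map_pow]
    rw [div_mul_cancel₀ _ (pow_ne_zero _ h1)]
  · rw [deriv_rel, map_mul, h3 k, mul_zero]

theorem P_smul (l : ℂ) (v) : D.P (l • v) = l ^ D.p * D.P v := eval_smul_hom D.hfp l v
theorem Q_smul (l : ℂ) (v) : D.Q (l • v) = l ^ D.q * D.Q v := eval_smul_hom D.hfq l v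
theorem φ_smul {l : ℂ} (hl : l ≠ 0) (v) : D.φ (l • v) = D.φ v := by
  simp only [φ, P_smul, Q_smul]
  rw [mul_pow, mul_pow, ← pow_mul, ← pow_mul, mul_comm D.p D.q, mul_div_mul_left _ _ (pow_ne_zero _ hl)]

theorem continuous_P : Continuous D.P := MvPolynomial.continuous_eval _
theorem continuous_Q : Continuous D.Q := MvPolynomial.continuous_eval _

theorem φ_eq_iff {v} (h : D.P v ≠ 0) (c : ℂ) : D.φ v = c ↔ D.Q v ^ D.p = c * D.P v ^ D.q := by
  rw [φ, div_eq_iff (pow_ne_zero _ h)]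

theorem continuousOn_φ : ContinuousOn D.φ {v | D.P v ≠ 0} := by
  unfold φ
  exact ((D.continuous_Q.pow _).continuousOn).div ((D.continuous_P.pow _).continuousOn)
    fun v hv => pow_ne_zero _ hv

end Dat

theorem hasStrictFDerivAt_eval (f : MvPolynomial (Fin 3) ℂ) (v : Fin 3 → ℂ) :
    HasStrictFDerivAt (fun v => eval v f)
      (∑ k, eval v (pderiv k f) • (ContinuousLinearMap.proj k : (Fin 3 → ℂ) →L[ℂ] ℂ)) v := by
  induction f using MvPolynomial.induction_on with
  | C a => 
    refine (hasStrictFDerivAt_const (𝕜 := ℂ) a v).congr_fderiv ?_ |>.congr_of_eventuallyEq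
      (.of_forall fun w => by simp)
    ext w
    simp
  | add f g hf hg => 
    refine (hf.add hg).congr_fderiv ?_ |>.congr_of_eventuallyEq (.of_forall fun w => by simp)
    simp only [map_add]
    rw [← Finset.sum_add_distrib]
    exact Finset.sum_congr rfl fun k _ => (add_smul _ _ _).symm
  | mul_X f j hf =>
    have h1 : HasStrictFDerivAt (fun v : Fin 3 → ℂ => v j)
      (ContinuousLinearMap.proj j : (Fin 3 → ℂ) →L[ℂ] ℂ) v := 
      (ContinuousLinearMap.proj (R := ℂ) (φ := fun _ : Fin 3 => ℂ) j).hasStrictFDerivAt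
    have h2 := hf.mul h1
    simp only [map_mul, eval_X]
    refine h2.congr_fderiv ?_
    ext w
    simp [Derivation.leibniz, pderiv_X, Finset.sum_apply, add_mul, Finset.sum_add_distrib,
      Finset.mul_sum, Pi.single_apply, apply_ite (eval v)]
    refine Finset.sum_congr rfl fun k _ => by ring

end Oka

namespace Oka
namespace Dat
variable (D : Dat)

theorem exists_chart {vb : Fin 3 → ℂ} (hvb : vb ∈ BaseT D.fp D.fq) :
    ∃ e o : Fin 3 → ℂ, (Matrix.of ![vb, e, o]).det ≠ 0 ∧ D.P (vb + o) ≠ 0 ∧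
      ∑ k, o k * eval (vb + e) (D.E k) ≠ 0 := by
  classical
  obtain ⟨k0, hk0⟩ := D.exists_E
  obtain ⟨w, hw⟩ := exists_eval_ne_zero hk0
  obtain ⟨hP, hQ, -⟩ := id hvb
  have hind : LinearIndependent ℂ ![vb, w] := by
    rw [LinearIndependent.pair_iff' (BaseT_ne_zero hvb)]
    intro a ha
    apply hw
    have h1 : D.P w = 0 := by rw [← ha, P_smul]; simp [P, hP]
    have h2 : D.Q w = 0 := by rw [← ha, Q_smul]; simp [Q, hQ]
    unfold E
    simp [h1, h2]
  have hcr : crossProduct vb w ≠ 0 := crossProduct_ne_zero_iff_linearIndependent.2 hind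
  let f2 : MvPolynomial (Fin 3) ℂ := ∑ k, C (eval w (D.E k)) * (X k - C (vb k))
  let f3 : MvPolynomial (Fin 3) ℂ := ∑ k, C (crossProduct vb w k) * X k
  have hf2 : f2 ≠ 0 := by
    intro h
    have := congrArg (eval (vb + Pi.single k0 1)) h
    simp [f2, Pi.single_apply] at this
    exact hw this
  have hf3 : f3 ≠ 0 := by
    intro h
    obtain ⟨k1, hk1⟩ := Function.ne_iff.1 hcr
    have := congrArg (eval (Pi.single k1 1)) h
    simp only [f3, map_sum, map_mul, eval_C, eval_X, Pi.single_apply, mul_ite, mul_one, mul_zero,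
      Finset.sum_ite_eq', Finset.mem_univ, if_true, map_zero] at this
    exact hk1 this
  obtain ⟨o', ho'⟩ := exists_eval_ne_zero (mul_ne_zero (mul_ne_zero D.hfp0 hf2) hf3)
  rw [map_mul, map_mul] at ho'
  have h1 := left_ne_zero_of_mul (left_ne_zero_of_mul ho')
  have h2 := right_ne_zero_of_mul (left_ne_zero_of_mul ho')
  have h3 := right_ne_zero_of_mul ho'
  refine ⟨w - vb, o' - vb, ?_, by simpa using h1, ?_⟩
  · convert h3 using 1
    rw [Matrix.det_fin_three]
    simp [f3, Fin.sum_univ_three, crossProduct]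
    ring
  · convert h2 using 1
    simp [f2, mul_comm]

/-- point of the chart -/
def pnt (vb e o : Fin 3 → ℂ) (t z : ℂ) : Fin 3 → ℂ := vb + t • e + z • o

/-- the polynomial in the chart -/
def chartPoly (vb e o : Fin 3 → ℂ) (f : MvPolynomial (Fin 3) ℂ) : Polynomial (Polynomial ℂ) :=
  aeval (fun i => Polynomial.C (Polynomial.C (vb i) + Polynomial.X * Polynomial.C (e i)) +
    Polynomial.X * Polynomial.C (Polynomial.C (o i))) f

theorem chart_eval (vb e o : Fin 3 → ℂ) (f : MvPolynomial (Fin 3) ℂ) (t z : ℂ) :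
    ((chartPoly vb e o f).map (Polynomial.evalRingHom t)).eval z = eval (pnt vb e o t z) f := by
  have : ((Polynomial.evalRingHom z).comp (Polynomial.mapRingHom (Polynomial.evalRingHom t))).comp
      (aeval (fun i => Polynomial.C (Polynomial.C (vb i) + Polynomial.X * Polynomial.C (e i)) +
    Polynomial.X * Polynomial.C (Polynomial.C (o i))) :
      MvPolynomial (Fin 3) ℂ →ₐ[ℂ] Polynomial (Polynomial ℂ)).toRingHom =
      (eval (pnt vb e o t z) : MvPolynomial (Fin 3) ℂ →+* ℂ) := by
    apply MvPolynomial.ringHom_ext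
    · intro r
      simp [Polynomial.algebraMap_apply]
    · intro i; simp [pnt]; ring
  exact congrArg (fun g => g f) this

theorem divide_family {n : ℕ} (a : Fin n → Polynomial ℂ) (i0 : Fin n) (h : a i0 ≠ 0) :
    ∃ (m : ℕ) (a' : Fin n → Polynomial ℂ), (∀ i, a i = Polynomial.X ^ m * a' i) ∧
      ∃ i, (a' i).eval 0 ≠ 0 := by
  induction hd : (a i0).natDegree generalizing a with
  | zero =>
    refine ⟨0, a, by simp, i0, ?_⟩
    rw [Polynomial.eq_C_of_natDegree_eq_zero hd] at h ⊢
    simpa using h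
  | succ d ih =>
    by_cases hz : ∃ i, (a i).eval 0 ≠ 0
    · exact ⟨0, a, by simp, hz⟩
    · push Not at hz
      have : ∀ i, ∃ b, a i = Polynomial.X * b := fun i => by
        have := (Polynomial.X_dvd_iff (f := a i)).2 (by rw [Polynomial.coeff_zero_eq_eval_zero]; exact hz i)
        exact this
      choose b hb using this
      have hb0 : b i0 ≠ 0 := by
        intro h0; apply h; rw [hb, h0, mul_zero]
      have hdeg : (b i0).natDegree = d := by
        have := hb i0
        rw [this, Polynomial.natDegree_X_mul hb0] at hd
        omega
      obtain ⟨m, a', ha', hi⟩ := ih b hb0 hdeg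
      refine ⟨m + 1, a', fun i => ?_, hi⟩
      rw [hb, ha', pow_succ]; ring

open Filter Topology

theorem chart_rel {vb e o : Fin 3 → ℂ} (hE : ∑ k, o k * eval (vb + e) (D.E k) ≠ 0) :
    ∃ B : Set ℂ, B.Finite ∧ ∀ c0 ∉ B, ∃ ε > 0, ∀ t z c : ℂ, 0 < ‖t‖ → ‖t‖ < ε → ‖c - c0‖ < ε →
      D.P (pnt vb e o t z) ≠ 0 → D.φ (pnt vb e o t z) = c →
      ∑ k, o k * eval (pnt vb e o t z) (D.E k) ≠ 0 := by
  let Eo : MvPolynomial (Fin 3) ℂ := ∑ k, C (o k) * D.E k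
  have hEo : ∀ v, eval v Eo = ∑ k, o k * eval v (D.E k) := fun v => by simp [Eo]
  let J := chartPoly vb e o Eo
  have hJ : J ≠ 0 := by
    intro h
    have := chart_eval vb e o Eo 1 0
    rw [show chartPoly vb e o Eo = 0 from h, hEo] at this
    simp [pnt] at this
    exact hE this.symm
  let N := chartPoly vb e o (D.fq ^ D.p)
  let M := chartPoly vb e o (D.fp ^ D.q)
  obtain ⟨a, ha, hdvd⟩ := linear_relation J hJ (fun i => N ^ i * M ^ (J.natDegree - i))
  obtain ⟨i0, hi0⟩ := Function.ne_iff.1 ha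
  obtain ⟨m, a', ha', i1, hi1⟩ := divide_family a i0 hi0
  let R0 : Polynomial ℂ := ∑ i, Polynomial.C ((a' i).eval 0) * Polynomial.X ^ (i : ℕ)
  have hR0 : R0 ≠ 0 := by
    intro h
    apply hi1
    have := congrArg (fun f => Polynomial.coeff f i1) h
    simp only [R0, Polynomial.finset_sum_coeff, Polynomial.coeff_C_mul, Polynomial.coeff_X_pow,
      Polynomial.coeff_zero] at this
    rw [Finset.sum_eq_single i1] at this
    · simpa using this
    · intro b _ hb
      have : (i1 : ℕ) ≠ b := fun h => hb (Fin.ext h.symm)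
      simp [this]
    · simp
  refine ⟨{c | R0.IsRoot c}, Polynomial.finite_setOf_isRoot hR0, ?_⟩
  intro c0 hc0
  let F : ℂ × ℂ → ℂ := fun x => ∑ i, (a' i).eval x.1 * x.2 ^ (i : ℕ)
  have hF : Continuous F := by
    refine continuous_finsetSum _ fun i _ => ?_
    exact ((a' i).continuous.comp continuous_fst).mul (continuous_snd.pow _)
  have hF0 : F (0, c0) ≠ 0 := by
    have : F (0, c0) = R0.eval c0 := by
      simp [F, R0, Polynomial.eval_finset_sum]
    rw [this]; exact hc0
  have hev : ∀ᶠ x in 𝓝 ((0 : ℂ), c0), F x ≠ 0 := hF.continuousAt.eventually_ne hF0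
  obtain ⟨ε, hε, hball⟩ := Metric.eventually_nhds_iff_ball.1 hev
  refine ⟨ε, hε, ?_⟩
  intro t z c ht0 ht hc hP hφ hzero
  have hmem : (t, c) ∈ Metric.ball ((0 : ℂ), c0) ε := by
    rw [← ball_prod_same]
    exact ⟨by simpa using ht, by simpa [dist_eq_norm] using hc⟩
  apply hball _ hmem
  obtain ⟨u, hu⟩ := hdvd
  have h1 := congrArg (fun f => (f.map (Polynomial.evalRingHom t)).eval z) hu
  simp only [Polynomial.map_mul, Polynomial.eval_mul, J, chart_eval, hEo, hzero, zero_mul,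
    Polynomial.map_sum, Polynomial.eval_finset_sum, Polynomial.map_C, Polynomial.eval_C,
    Polynomial.map_pow, Polynomial.eval_pow, N, M, ha'] at h1
  set d := (chartPoly vb e o Eo).natDegree with hd
  have hMne : eval (pnt vb e o t z) (D.fp ^ D.q) ≠ 0 := by simpa using pow_ne_zero D.q hP
  have hN : eval (pnt vb e o t z) (D.fq ^ D.p) = c * eval (pnt vb e o t z) (D.fp ^ D.q) := by
    simpa using (D.φ_eq_iff hP c).1 hφ
  rw [hN] at h1
  have h2 : (t ^ m * (eval (pnt vb e o t z) (D.fp ^ D.q)) ^ d) * F (t, c) = 0 := by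
    rw [← h1]
    simp only [F, Finset.mul_sum]
    refine Finset.sum_congr rfl fun i _ => ?_
    have hid : (i : ℕ) ≤ d := Nat.lt_succ_iff.1 i.2
    rw [← pow_sub_mul_pow _ hid]
    simp
    ring
  have h3 : t ≠ 0 := norm_pos_iff.1 ht0
  exact (mul_eq_zero.1 h2).resolve_left (mul_ne_zero (pow_ne_zero _ h3) (pow_ne_zero _ hMne))

theorem chart_zero {vb e o : Fin 3 → ℂ} (ho : D.P (vb + o) ≠ 0) :
    ∃ B : Set ℂ, B.Finite ∧ ∀ c0 ∉ B, ∃ ε > 0, ∀ z c : ℂ, 0 < ‖z‖ → ‖z‖ < ε → ‖c - c0‖ < ε →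
      D.Q (pnt vb e o 0 z) ^ D.p ≠ c * D.P (pnt vb e o 0 z) ^ D.q := by
  let A : Polynomial ℂ := (chartPoly vb e o (D.fq ^ D.p)).map (Polynomial.evalRingHom 0)
  let B : Polynomial ℂ := (chartPoly vb e o (D.fp ^ D.q)).map (Polynomial.evalRingHom 0)
  have hA : ∀ z, A.eval z = D.Q (pnt vb e o 0 z) ^ D.p := fun z => by simp [A, chart_eval]
  have hB : ∀ z, B.eval z = D.P (pnt vb e o 0 z) ^ D.q := fun z => by simp [B, chart_eval]
  have hB0 : B ≠ 0 := by
    intro h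
    have := hB 1
    rw [h] at this
    simp only [Polynomial.eval_zero, pnt, zero_smul, add_zero, one_smul] at this
    exact pow_ne_zero _ ho this.symm
  obtain ⟨m, ab, hab, hne⟩ := divide_family ![A, B] 1 hB0
  have hne' : (ab 0).eval 0 ≠ 0 ∨ (ab 1).eval 0 ≠ 0 := by
    obtain ⟨i, hi⟩ := hne
    fin_cases i
    · exact Or.inl hi
    · exact Or.inr hi
  refine ⟨{c | (ab 0).eval 0 = c * (ab 1).eval 0}, ?_, ?_⟩
  · by_cases h : (ab 1).eval 0 = 0
    · have : {c : ℂ | (ab 0).eval 0 = c * (ab 1).eval 0} = ∅ := by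
        ext c; simp [h]; simpa [h] using hne'
      rw [this]; exact Set.finite_empty
    · refine (Set.finite_singleton ((ab 0).eval 0 / (ab 1).eval 0)).subset ?_
      intro c hc
      have hc : (ab 0).eval 0 = c * (ab 1).eval 0 := hc
      simp [hc, h]
  · intro c0 hc0
    let F : ℂ × ℂ → ℂ := fun x => (ab 0).eval x.1 - x.2 * (ab 1).eval x.1
    have hF : Continuous F :=
      ((ab 0).continuous.comp continuous_fst).sub
        (continuous_snd.mul ((ab 1).continuous.comp continuous_fst))
    have hF0 : F (0, c0) ≠ 0 := fun h => hc0 (sub_eq_zero.1 h)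
    have hev : ∀ᶠ x in 𝓝 ((0 : ℂ), c0), F x ≠ 0 := hF.continuousAt.eventually_ne hF0
    obtain ⟨ε, hε, hball⟩ := Metric.eventually_nhds_iff_ball.1 hev
    refine ⟨ε, hε, fun z c hz0 hz hc heq => ?_⟩
    have hmem : (z, c) ∈ Metric.ball ((0 : ℂ), c0) ε := by
      rw [← ball_prod_same]
      exact ⟨by simpa using hz, by simpa [dist_eq_norm] using hc⟩
    apply hball _ hmem
    rw [← hA, ← hB] at heq
    have e1 : A = Polynomial.X ^ m * ab 0 := hab 0
    have e2 : B = Polynomial.X ^ m * ab 1 := hab 1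
    rw [e1, e2] at heq
    simp only [Polynomial.eval_mul, Polynomial.eval_pow, Polynomial.eval_X] at heq
    have h3 : z ^ m ≠ 0 := pow_ne_zero _ (norm_pos_iff.1 hz0)
    apply mul_left_cancel₀ h3
    simp only [F]
    linear_combination heq

end Dat
end Oka

namespace Oka
open Filter Topology

/-- A chart around a base point. -/
structure Chart (D : Dat) where
  vb : Fin 3 → ℂ
  e : Fin 3 → ℂ
  o : Fin 3 → ℂ
  hvb : vb ∈ BaseT D.fp D.fq
  hdet : (Matrix.of ![vb, e, o]).det ≠ 0
  hPo : D.P (vb + o) ≠ 0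
  hE : ∑ k, o k * eval (vb + e) (D.E k) ≠ 0

namespace Chart
variable {D : Dat} (K : Chart D)

theorem exists_of {vb} (hvb : vb ∈ BaseT D.fp D.fq) : ∃ K : Chart D, K.vb = vb := by
  obtain ⟨e, o, h1, h2, h3⟩ := D.exists_chart hvb
  exact ⟨⟨vb, e, o, hvb, h1, h2, h3⟩, rfl⟩

/-- coordinates -/
def co (v : Fin 3 → ℂ) : Fin 3 → ℂ := Matrix.vecMul v (Matrix.of ![K.vb, K.e, K.o])⁻¹

theorem co_add (v w) : K.co (v + w) = K.co v + K.co w := Matrix.add_vecMul _ _ _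
theorem co_smul (l : ℂ) (v) : K.co (l • v) = l • K.co v := Matrix.smul_vecMul _ _ _
theorem continuous_co : Continuous K.co := by
  unfold co
  exact continuous_id.matrix_vecMul continuous_const

theorem co_spec (v) : v = K.co v 0 • K.vb + K.co v 1 • K.e + K.co v 2 • K.o := by
  have h : Matrix.vecMul (K.co v) (Matrix.of ![K.vb, K.e, K.o]) = v := by
    unfold co
    rw [Matrix.vecMul_vecMul, Matrix.nonsing_inv_mul _ (isUnit_iff_ne_zero.2 K.hdet),
      Matrix.vecMul_one]
  conv_lhs => rw [← h]
  ext i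
  simp [Matrix.vecMul, dotProduct, Fin.sum_univ_three]

theorem co_mk (a b c : ℂ) : K.co (a • K.vb + b • K.e + c • K.o) = ![a, b, c] := by
  have h : Matrix.vecMul ![a, b, c] (Matrix.of ![K.vb, K.e, K.o]) =
      a • K.vb + b • K.e + c • K.o := by
    ext i
    simp [Matrix.vecMul, dotProduct, Fin.sum_univ_three]
  rw [← h]
  unfold co
  rw [Matrix.vecMul_vecMul, Matrix.mul_nonsing_inv _ (isUnit_iff_ne_zero.2 K.hdet),
      Matrix.vecMul_one]

/-- point of chart -/
def pn (t z : ℂ) : Fin 3 → ℂ := Dat.pnt K.vb K.e K.o t z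

theorem continuous_pn : Continuous (fun x : ℂ × ℂ => K.pn x.1 x.2) := by
  unfold pn Dat.pnt; fun_prop

theorem co_pn (t z : ℂ) : K.co (K.pn t z) = ![1, t, z] := by
  have := K.co_mk 1 t z
  rwa [one_smul] at this

def tc (v : Fin 3 → ℂ) : ℂ := K.co v 1 / K.co v 0
def zc (v : Fin 3 → ℂ) : ℂ := K.co v 2 / K.co v 0

theorem pn_tz {v} (h : K.co v 0 ≠ 0) : v = K.co v 0 • K.pn (K.tc v) (K.zc v) := by
  conv_lhs => rw [K.co_spec v]
  simp only [pn, Dat.pnt, tc, zc, smul_add, smul_smul]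
  rw [mul_div_cancel₀ _ h, mul_div_cancel₀ _ h]

theorem tc_smul {l : ℂ} (hl : l ≠ 0) (v) : K.tc (l • v) = K.tc v := by
  simp only [tc, co_smul, Pi.smul_apply, smul_eq_mul]
  rw [mul_div_mul_left _ _ hl]
theorem zc_smul {l : ℂ} (hl : l ≠ 0) (v) : K.zc (l • v) = K.zc v := by
  simp only [zc, co_smul, Pi.smul_apply, smul_eq_mul]
  rw [mul_div_mul_left _ _ hl]
theorem tc_pn (t z) : K.tc (K.pn t z) = t := by simp [tc, co_pn]
theorem zc_pn (t z) : K.zc (K.pn t z) = z := by simp [zc, co_pn]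

/-- sum of `E` in direction `o` -/
def Eo (v : Fin 3 → ℂ) : ℂ := ∑ k, K.o k * eval v (D.E k)

structure Good (c0 : ℂ) (r ε : ℝ) : Prop where
  h1 : ∀ t z, 0 < ‖t‖ → ‖t‖ < ε → D.P (K.pn t z) ≠ 0 → ‖D.φ (K.pn t z) - c0‖ < ε →
    K.Eo (K.pn t z) ≠ 0
  h2 : ∀ t z c, ‖t‖ < ε → ‖z‖ = r → ‖c - c0‖ < ε →
    D.Q (K.pn t z) ^ D.p ≠ c * D.P (K.pn t z) ^ D.q
  h2' : ∀ z c, 0 < ‖z‖ → ‖z‖ ≤ r → ‖c - c0‖ < ε →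
    D.Q (K.pn 0 z) ^ D.p ≠ c * D.P (K.pn 0 z) ^ D.q
  h3 : ∀ t z, 0 < ‖t‖ → ‖t‖ < ε → D.P (K.pn t z) = 0 → D.Q (K.pn t z) ≠ 0

theorem h3_aux : ∀ᶠ ε : ℝ in 𝓝[>] 0, 
   ∀ t z, 0 < ‖t‖ → ‖t‖ < ε → D.P (K.pn t z) = 0 → D.Q (K.pn t z) ≠ 0 := by
  have hfin := BaseT_finite D.fp D.fq D.p D.q D.hfp D.hfq D.hirr D.hnd
  have h : ∀ᶠ ε : ℝ in 𝓝[>] 0, ∀ w ∈ BaseT D.fp D.fq, K.tc w ≠ 0 → ε < ‖K.tc w‖ := by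
    rw [Filter.eventually_all_finite hfin]
    intro w _
    by_cases hw : K.tc w = 0
    · simp [hw]
    · have : ∀ᶠ ε : ℝ in 𝓝 0, ε < ‖K.tc w‖ := eventually_lt_nhds (norm_pos_iff.2 hw)
      filter_upwards [nhdsWithin_le_nhds this] with x hx _ using hx
  filter_upwards [h] with ε hε t z ht0 ht hP hQ
  have hne : K.pn t z ≠ 0 := by
    intro h0
    have := K.co_pn t z
    rw [h0] at this
    have := congrFun this 0
    simp [co] at this
  obtain ⟨w, hw, l, hl, he⟩ := BaseT_exists D.hfp D.hfq hne hP hQ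
  have : t = K.tc w := by rw [← K.tc_pn t z, he, K.tc_smul hl]
  subst this
  exact lt_asymm ht (hε w hw (norm_pos_iff.1 ht0))

theorem good : ∃ B : Set ℂ, B.Finite ∧ ∀ c0 ∉ B, ∀ᶠ r : ℝ in 𝓝[>] 0, ∀ᶠ ε : ℝ in 𝓝[>] 0,
    K.Good c0 r ε := by
  obtain ⟨B1, hB1, H1⟩ := D.chart_rel K.hE
  obtain ⟨B2, hB2, H2⟩ := D.chart_zero K.hPo (e := K.e)
  refine ⟨B1 ∪ B2, hB1.union hB2, fun c0 hc0 => ?_⟩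
  obtain ⟨ε1, hε1, H1⟩ := H1 c0 fun h => hc0 (Or.inl h)
  obtain ⟨ε2, hε2, H2⟩ := H2 c0 fun h => hc0 (Or.inr h)
  filter_upwards [nhdsWithin_le_nhds (eventually_lt_nhds hε2), self_mem_nhdsWithin] with r hr hr0
  have hr0 : 0 < r := hr0
  have hcpt : IsCompact (Metric.sphere (0 : ℂ) r) := isCompact_sphere _ _
  have hev : ∀ᶠ x in 𝓝 ((0 : ℂ), c0), ∀ z ∈ Metric.sphere (0 : ℂ) r,
      D.Q (K.pn x.1 z) ^ D.p ≠ x.2 * D.P (K.pn x.1 z) ^ D.q := by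
    apply hcpt.eventually_forall_of_forall_eventually
    intro z hz
    have hz : ‖z‖ = r := by simpa using hz
    have hc : Continuous fun x : (ℂ × ℂ) × ℂ =>
        D.Q (K.pn x.1.1 x.2) ^ D.p - x.1.2 * D.P (K.pn x.1.1 x.2) ^ D.q := by
      have h1 : Continuous fun x : (ℂ × ℂ) × ℂ => K.pn x.1.1 x.2 :=
        K.continuous_pn.comp ((continuous_fst.comp continuous_fst).prodMk continuous_snd)
      exact ((D.continuous_Q.comp h1).pow _).sub
        ((continuous_snd.comp continuous_fst).mul ((D.continuous_P.comp h1).pow _))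
    have := hc.continuousAt.eventually_ne (x := (((0 : ℂ), c0), z)) (y := 0)
      (sub_ne_zero.2 (H2 z c0 (by linarith) (by linarith) (by simpa using hε2)))
    filter_upwards [this] with x hx using sub_ne_zero.1 hx
  obtain ⟨ε3, hε3, H3⟩ := Metric.eventually_nhds_iff_ball.1 hev
  filter_upwards [nhdsWithin_le_nhds (eventually_lt_nhds hε1),
    nhdsWithin_le_nhds (eventually_lt_nhds hε2), nhdsWithin_le_nhds (eventually_lt_nhds hε3),
    K.h3_aux] with ε h1 h2 h3 h4
  refine ⟨fun t z ht0 ht hP hφ => H1 t z _ ht0 (ht.trans h1) (hφ.trans h1) hP rfl, ?_, ?_, h4⟩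
  · intro t z c ht hz hc
    refine H3 (t, c) ?_ z (by simpa using hz)
    rw [← ball_prod_same]
    exact ⟨by simpa using ht.trans h3, by simpa [dist_eq_norm] using hc.trans h3⟩
  · intro z c hz0 hz hc
    exact H2 z c hz0 (hz.trans_lt hr) (hc.trans h2)

/-- Neighbourhood cone -/
def Wn (δ r : ℝ) : Set (Fin 3 → ℂ) := {v | K.co v 0 ≠ 0 ∧ ‖K.tc v‖ < δ ∧ ‖K.zc v‖ < r}

theorem continuous_co' (i : Fin 3) : Continuous fun v => K.co v i :=
  (continuous_apply i).comp K.continuous_co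

theorem continuousOn_tc : ContinuousOn K.tc {v | K.co v 0 ≠ 0} := by
  unfold tc
  exact (K.continuous_co' 1).continuousOn.div (K.continuous_co' 0).continuousOn fun _ h => h
theorem continuousOn_zc : ContinuousOn K.zc {v | K.co v 0 ≠ 0} := by
  unfold zc
  exact (K.continuous_co' 2).continuousOn.div (K.continuous_co' 0).continuousOn fun _ h => h

theorem isOpen_co0 : IsOpen {v | K.co v 0 ≠ 0} :=
  isOpen_ne_fun (K.continuous_co' 0) continuous_const

theorem isOpen_Wn (δ r : ℝ) : IsOpen (K.Wn δ r) := by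
  have h1 := K.continuousOn_tc.norm.isOpen_inter_preimage K.isOpen_co0 (isOpen_Iio (a := δ))
  have h2 := K.continuousOn_zc.norm.isOpen_inter_preimage K.isOpen_co0 (isOpen_Iio (a := r))
  have : K.Wn δ r = ({v | K.co v 0 ≠ 0} ∩ (fun v => ‖K.tc v‖) ⁻¹' Set.Iio δ) ∩
      ({v | K.co v 0 ≠ 0} ∩ (fun v => ‖K.zc v‖) ⁻¹' Set.Iio r) := by
    ext v
    exact ⟨fun h => ⟨⟨h.1, h.2.1⟩, h.1, h.2.2⟩, fun h => ⟨h.1.1, h.1.2, h.2.2⟩⟩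
  rw [this]
  exact h1.inter h2

theorem Wn_smul {l : ℂ} (hl : l ≠ 0) {v δ r} : l • v ∈ K.Wn δ r ↔ v ∈ K.Wn δ r := by
  simp [Wn, K.tc_smul hl, K.zc_smul hl, co_smul, hl]

theorem disj (K K' : Chart D) (h : K.vb ≠ K'.vb) : ∀ᶠ r : ℝ in 𝓝[>] 0,
    Disjoint (K.Wn r r) (K'.Wn r r) := by
  have hcr : crossProduct K.vb K'.vb ≠ 0 := by
    rw [crossProduct_ne_zero_iff_linearIndependent,
      LinearIndependent.pair_iff' (BaseT_ne_zero K.hvb)]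
    intro a ha
    have ha0 : a ≠ 0 := by
      rintro rfl
      exact BaseT_ne_zero K'.hvb (by rw [← ha, zero_smul])
    exact h (BaseT_unique K'.hvb K.hvb ha0 ha.symm).symm
  have hc : Continuous fun x : (ℂ × ℂ) × (ℂ × ℂ) =>
      crossProduct (K.pn x.1.1 x.1.2) (K'.pn x.2.1 x.2.2) := by
    have h1 := K.continuous_pn.comp (continuous_fst (X := ℂ × ℂ) (Y := ℂ × ℂ))
    have h2 := K'.continuous_pn.comp (continuous_snd (X := ℂ × ℂ) (Y := ℂ × ℂ))
    have h1' := fun i => (continuous_apply i).comp h1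
    have h2' := fun i => (continuous_apply i).comp h2
    refine continuous_pi fun i => ?_
    fin_cases i <;> simp [crossProduct] <;>
    exact ((h1' _).mul (h2' _)).sub ((h1' _).mul (h2' _))
  have hev := hc.continuousAt.eventually_ne (x := ((0, 0), (0, 0))) (y := 0)
    (by simpa [pn, Dat.pnt] using hcr)
  obtain ⟨ε, hε, H⟩ := Metric.eventually_nhds_iff_ball.1 hev
  filter_upwards [nhdsWithin_le_nhds (eventually_lt_nhds hε)] with r hr
  rw [Set.disjoint_left]
  rintro v ⟨h0, h1, h2⟩ ⟨h0', h1', h2'⟩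
  apply H ((K.tc v, K.zc v), (K'.tc v, K'.zc v))
  · rw [← ball_prod_same, ← ball_prod_same]
    refine ⟨⟨?_, ?_⟩, ⟨?_, ?_⟩⟩ <;> simp <;> linarith
  · have e1 := K.pn_tz h0
    have e2 := K'.pn_tz h0'
    have h3 : crossProduct v v = 0 := cross_self v
    have h3 : crossProduct (K.co v 0 • K.pn (K.tc v) (K.zc v))
      (K'.co v 0 • K'.pn (K'.tc v) (K'.zc v)) = 0 := by rw [← e1, ← e2]; exact h3
    rw [map_smul, map_smul, LinearMap.smul_apply, smul_smul] at h3
    exact (smul_eq_zero.1 h3).resolve_left (mul_ne_zero h0' h0)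
    

end Chart
end Oka

namespace Oka
open Filter Topology
namespace Dat
variable (D : Dat)

/-- partial derivatives of `φ` -/
def dφ (k : Fin 3) (v : Fin 3 → ℂ) : ℂ :=
  D.P v ^ (D.q - 1) * D.Q v ^ (D.p - 1) * eval v (D.E k) / (D.P v ^ D.q) ^ 2

theorem hasStrictFDerivAt_φ {v} (hv : D.P v ≠ 0) :
    HasStrictFDerivAt D.φ
      (∑ k, D.dφ k v • (ContinuousLinearMap.proj k : (Fin 3 → ℂ) →L[ℂ] ℂ)) v := by
  have hM := hasStrictFDerivAt_eval (D.fp ^ D.q) v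
  have hN := hasStrictFDerivAt_eval (D.fq ^ D.p) v
  have hM0 : eval v (D.fp ^ D.q) ≠ 0 := by simpa using pow_ne_zero D.q hv
  have hI := (hasStrictDerivAt_inv hM0).comp_hasStrictFDerivAt v hM
  have h := hN.mul hI
  refine (h.congr_fderiv ?_).congr_of_eventuallyEq (.of_forall fun w => by simp [φ, div_eq_mul_inv])
  ext w
  simp only [ContinuousLinearMap.add_apply, ContinuousLinearMap.smul_apply,
    ContinuousLinearMap.sum_apply, ContinuousLinearMap.proj_apply, smul_eq_mul, Finset.mul_sum,
    ← Finset.sum_add_distrib, Function.comp]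
  refine Finset.sum_congr rfl fun k _ => ?_
  have hrel := congrArg (eval v) (D.deriv_rel k)
  simp only [map_sub, map_mul] at hrel
  have : D.dφ k v = (eval v (D.fp ^ D.q) * eval v (pderiv k (D.fq ^ D.p)) -
      eval v (D.fq ^ D.p) * eval v (pderiv k (D.fp ^ D.q))) / eval v (D.fp ^ D.q) ^ 2 := by
    rw [hrel, dφ]; simp
  rw [this]
  generalize eval v (D.fp ^ D.q) = a at *
  generalize eval v (D.fq ^ D.p) = b at *
  field_simp
  ring

theorem dφ_ne {v k} (hP : D.P v ≠ 0) (hφ : D.φ v ≠ 0) (hE : eval v (D.E k) ≠ 0) :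
    D.dφ k v ≠ 0 := by
  have hQ : D.Q v ≠ 0 := by
    intro h; apply hφ; rw [φ, h, zero_pow (by have := D.hp; omega), zero_div]
  unfold dφ
  exact div_ne_zero (mul_ne_zero (mul_ne_zero (pow_ne_zero _ hP) (pow_ne_zero _ hQ)) hE)
    (pow_ne_zero _ (pow_ne_zero _ hP))
end Dat

namespace Chart
variable {D : Dat} (K : Chart D)

/-- The map `(t,z) ↦ (φ,t)`. -/
def pr (x : ℂ × ℂ) : ℂ × ℂ := (D.φ (K.pn x.1 x.2), x.1)

theorem pr_strict (x : ℂ × ℂ) (hP : D.P (K.pn x.1 x.2) ≠ 0) (hφ : D.φ (K.pn x.1 x.2) ≠ 0)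
    (hE : K.Eo (K.pn x.1 x.2) ≠ 0) :
    ∃ L : (ℂ × ℂ) ≃L[ℂ] (ℂ × ℂ), HasStrictFDerivAt K.pr (L : (ℂ × ℂ) →L[ℂ] (ℂ × ℂ)) x := by
  set v := K.pn x.1 x.2 with hv
  have h1 := D.hasStrictFDerivAt_φ hP
  have h2 : HasStrictFDerivAt (fun x : ℂ × ℂ => K.pn x.1 x.2)
      ((ContinuousLinearMap.fst ℂ ℂ ℂ).smulRight K.e + (ContinuousLinearMap.snd ℂ ℂ ℂ).smulRight K.o) x := by
    have := ((ContinuousLinearMap.fst ℂ ℂ ℂ).smulRight K.e +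
      (ContinuousLinearMap.snd ℂ ℂ ℂ).smulRight K.o).hasStrictFDerivAt (x := x) |>.const_add K.vb
    refine this.congr_of_eventuallyEq (.of_forall fun y => ?_)
    simp [pn, Dat.pnt, add_assoc]
  have h3 := h1.comp x h2
  have h4 := h3.prodMk (hasStrictFDerivAt_fst (𝕜 := ℂ) (p := x))
  set a : ℂ := ∑ k, D.dφ k v * K.e k with ha
  set b : ℂ := ∑ k, D.dφ k v * K.o k with hb
  have hQ : D.Q v ≠ 0 := by
    intro h; apply hφ; rw [Dat.φ, h, zero_pow (by have := D.hp; omega), zero_div]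
  have hb0 : b ≠ 0 := by
    have : b = D.P v ^ (D.q - 1) * D.Q v ^ (D.p - 1) * K.Eo v / (D.P v ^ D.q) ^ 2 := by
      rw [hb, Eo, Finset.mul_sum, Finset.sum_div]
      refine Finset.sum_congr rfl fun k _ => ?_
      rw [Dat.dφ]; ring
    rw [this]
    exact div_ne_zero (mul_ne_zero (mul_ne_zero (pow_ne_zero _ hP) (pow_ne_zero _ hQ)) hE)
      (pow_ne_zero _ (pow_ne_zero _ hP))
  let F := ContinuousLinearMap.fst ℂ ℂ ℂ
  let S := ContinuousLinearMap.snd ℂ ℂ ℂ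
  let L1 : (ℂ × ℂ) →L[ℂ] (ℂ × ℂ) := (a • F + b • S).prod F
  let L2 : (ℂ × ℂ) →L[ℂ] (ℂ × ℂ) := S.prod (b⁻¹ • F - (b⁻¹ * a) • S)
  refine ⟨ContinuousLinearEquiv.equivOfInverse L1 L2 ?_ ?_, ?_⟩
  · rintro ⟨s, w⟩
    simp [L1, L2, F, S]
    field_simp
    ring
  · rintro ⟨s, w⟩
    simp [L1, L2, F, S]
    field_simp
    ring
  · refine h4.congr_fderiv ?_
    apply ContinuousLinearMap.ext
    rintro ⟨s, w⟩
    show (_, _) = L1 (s, w)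
    simp [L1, F, S, a, b, Finset.sum_mul, ← Finset.sum_add_distrib]
    refine Finset.sum_congr rfl fun k _ => ?_
    ring

/-- total space -/
def Tot (c0 : ℂ) (r ε : ℝ) : Set (ℂ × ℂ) := {x | 0 < ‖x.1‖ ∧ ‖x.1‖ < ε ∧ ‖x.2‖ < r ∧
  D.P (K.pn x.1 x.2) ≠ 0 ∧ ‖D.φ (K.pn x.1 x.2) - c0‖ < ε}
/-- base space -/
def Bas (c0 : ℂ) (ε : ℝ) : Set (ℂ × ℂ) := {x | ‖x.1 - c0‖ < ε ∧ 0 < ‖x.2‖ ∧ ‖x.2‖ < ε}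

theorem continuousOn_pr : ContinuousOn K.pr {x | D.P (K.pn x.1 x.2) ≠ 0} := by
  unfold pr
  refine ContinuousOn.prodMk ?_ continuous_fst.continuousOn
  exact D.continuousOn_φ.comp K.continuous_pn.continuousOn fun x hx => hx

theorem isOpen_Bas (c0 : ℂ) (ε : ℝ) : IsOpen (Bas c0 ε) := by
  have h1 : IsOpen {x : ℂ × ℂ | ‖x.1 - c0‖ < ε} := isOpen_lt (by fun_prop) (by fun_prop)
  have h2 : IsOpen {x : ℂ × ℂ | 0 < ‖x.2‖} := isOpen_lt (by fun_prop) (by fun_prop)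
  have h3 : IsOpen {x : ℂ × ℂ | ‖x.2‖ < ε} := isOpen_lt (by fun_prop) (by fun_prop)
  exact h1.inter (h2.inter h3)

theorem isOpen_Tot (c0 : ℂ) (r ε : ℝ) : IsOpen (K.Tot c0 r ε) := by
  have h0 : IsOpen {x : ℂ × ℂ | D.P (K.pn x.1 x.2) ≠ 0} :=
    isOpen_ne_fun (D.continuous_P.comp K.continuous_pn) continuous_const
  have h1 := K.continuousOn_pr.isOpen_inter_preimage h0 (isOpen_Bas c0 ε)
  have h2 : IsOpen {x : ℂ × ℂ | ‖x.2‖ < r} := isOpen_lt (by fun_prop) (by fun_prop)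
  have : K.Tot c0 r ε = ({x : ℂ × ℂ | D.P (K.pn x.1 x.2) ≠ 0} ∩ K.pr ⁻¹' Bas c0 ε) ∩
     {x : ℂ × ℂ | ‖x.2‖ < r} := by
    ext x
    simp only [Tot, Bas, pr, Set.mem_inter_iff, Set.mem_preimage, Set.mem_setOf_eq]
    tauto
  rw [this]; exact h1.inter h2

theorem pr_mem {c0 : ℂ} {r ε : ℝ} {x} (hx : x ∈ K.Tot c0 r ε) : K.pr x ∈ Bas c0 ε :=
  ⟨hx.2.2.2.2, hx.1, hx.2.1⟩

/-- the restricted map -/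
def prR (c0 : ℂ) (r ε : ℝ) (x : K.Tot c0 r ε) : Bas c0 ε := ⟨K.pr x.1, K.pr_mem x.2⟩

theorem continuous_prR (c0 : ℂ) (r ε : ℝ) : Continuous (K.prR c0 r ε) := by
  refine Continuous.subtype_mk ?_ _
  exact (K.continuousOn_pr.mono fun x hx => hx.2.2.2.1).comp_continuous continuous_subtype_val
    fun x => x.2

variable {K} {c0 : ℂ} {r ε : ℝ}

theorem Good.localHomeo (hG : K.Good c0 r ε) (hε0 : ε ≤ ‖c0‖) :
    IsLocalHomeomorph (K.prR c0 r ε) := by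
  have hval : IsLocalHomeomorph (Subtype.val : Bas c0 ε → ℂ × ℂ) :=
    (isOpen_Bas c0 ε).isOpenEmbedding_subtypeVal.isLocalHomeomorph
  have hval' : IsLocalHomeomorph (Subtype.val : K.Tot c0 r ε → ℂ × ℂ) :=
    (K.isOpen_Tot c0 r ε).isOpenEmbedding_subtypeVal.isLocalHomeomorph
  have hpr : IsLocalHomeomorphOn K.pr (K.Tot c0 r ε) := by
    refine IsLocalHomeomorphOn.mk _ _ fun x hx => ?_
    obtain ⟨h1, h2, h3, h4, h5⟩ := hx
    obtain ⟨L, hL⟩ := K.pr_strict x h4 (by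
      intro h
      rw [h, zero_sub, norm_neg] at h5
      linarith) (hG.h1 _ _ h1 h2 h4 h5)
    refine ⟨hL.toOpenPartialHomeomorph _, hL.mem_toOpenPartialHomeomorph_source, ?_⟩
    intro y hy
    rfl
  have hcomp : IsLocalHomeomorph (Subtype.val ∘ K.prR c0 r ε) := by
    rw [isLocalHomeomorph_iff_isLocalHomeomorphOn_univ] at hval' ⊢
    exact hpr.comp hval' fun x _ => x.2
  exact IsLocalHomeomorph.of_comp hcomp hval (K.continuous_prR c0 r ε)

theorem Good.finite_fibre (hG : K.Good c0 r ε) (hr : 0 < r) (y : Bas c0 ε) :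
    (K.prR c0 r ε ⁻¹' {y}).Finite := by
  obtain ⟨⟨c, t⟩, hc, ht0, ht⟩ := y
  let R : Polynomial ℂ := ((Dat.chartPoly K.vb K.e K.o (D.fq ^ D.p)).map (Polynomial.evalRingHom t)) -
    Polynomial.C c * ((Dat.chartPoly K.vb K.e K.o (D.fp ^ D.q)).map (Polynomial.evalRingHom t))
  have hR : ∀ z, R.eval z = D.Q (K.pn t z) ^ D.p - c * D.P (K.pn t z) ^ D.q := fun z => by
    simp [R, Dat.chart_eval, pn]
  have hR0 : R ≠ 0 := by
    intro h
    have := hR (r : ℂ)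
    rw [h] at this
    simp only [Polynomial.eval_zero] at this
    exact hG.h2 t r c ht (by simp [abs_of_pos hr]) hc (sub_eq_zero.1 this.symm)
  have hfin := Polynomial.finite_setOf_isRoot hR0
  refine Set.Finite.of_finite_image (f := fun x => x.1.2) (hfin.subset ?_) ?_
  · rintro _ ⟨x, hx, rfl⟩
    have hx : K.prR c0 r ε x = _ := hx
    have h1 : K.pr x.1 = (c, t) := congrArg Subtype.val hx
    have h2 : x.1.1 = t := congrArg Prod.snd h1
    have h3 : D.φ (K.pn x.1.1 x.1.2) = c := congrArg Prod.fst h1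
    have hP := x.2.2.2.2.1
    rw [D.φ_eq_iff hP, h2] at h3
    show R.eval _ = 0
    rw [hR, h3, sub_self]
  · rintro x hx x' hx' he
    have h1 : K.pr x.1 = (c, t) := congrArg Subtype.val hx
    have h2 : x.1.1 = t := congrArg Prod.snd h1
    have h1' : K.pr x'.1 = (c, t) := congrArg Subtype.val hx'
    have h2' : x'.1.1 = t := congrArg Prod.snd h1'
    exact Subtype.ext (Prod.ext (h2.trans h2'.symm) he)

theorem Good.closedMap (hG : K.Good c0 r ε) : IsClosedMap (K.prR c0 r ε) := by
  intro S hS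
  refine IsSeqClosed.isClosed ?_
  intro y y0 hy hlim
  choose x hxS hx using hy
  have h1 : ∀ n, (x n).1.2 ∈ Metric.closedBall (0 : ℂ) r := fun n => by
    simpa using (x n).2.2.2.1.le
  obtain ⟨z, hz, ψ, hψ, hzl⟩ := (isCompact_closedBall (0 : ℂ) r).tendsto_subseq h1
  have hl : Tendsto (fun n => (y (ψ n)).1) atTop (𝓝 y0.1) :=
    (continuous_subtype_val.tendsto _).comp (hlim.comp hψ.tendsto_atTop)
  have hyx : ∀ n, (y n).1 = (D.φ (K.pn (x n).1.1 (x n).1.2), (x n).1.1) := fun n => by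
    rw [← hx n]; rfl
  have ht : Tendsto (fun n => (x (ψ n)).1.1) atTop (𝓝 y0.1.2) := by
    have := (continuous_snd.tendsto _).comp hl
    refine this.congr fun n => ?_
    simp [hyx]
  have hc : Tendsto (fun n => D.φ (K.pn (x (ψ n)).1.1 (x (ψ n)).1.2)) atTop (𝓝 y0.1.1) := by
    have := (continuous_fst.tendsto _).comp hl
    refine this.congr fun n => ?_
    simp [hyx]
  have hpn : Tendsto (fun n => K.pn (x (ψ n)).1.1 (x (ψ n)).1.2) atTop (𝓝 (K.pn y0.1.2 z)) :=
    (K.continuous_pn.tendsto (y0.1.2, z)).comp (ht.prodMk_nhds hzl)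
  have hPl := (D.continuous_P.tendsto _).comp hpn
  have hQl := (D.continuous_Q.tendsto _).comp hpn
  have heq : D.Q (K.pn y0.1.2 z) ^ D.p = y0.1.1 * D.P (K.pn y0.1.2 z) ^ D.q := by
    refine tendsto_nhds_unique (hQl.pow D.p) ((hc.mul (hPl.pow D.q)).congr fun n => ?_)
    exact ((D.φ_eq_iff (x (ψ n)).2.2.2.2.1 _).1 rfl).symm
  obtain ⟨hc0, ht0, htε⟩ := y0.2
  have hzr : ‖z‖ < r := by
    refine lt_of_le_of_ne (by simpa using hz) fun h => hG.h2 _ z _ htε h hc0 heq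
  have hP : D.P (K.pn y0.1.2 z) ≠ 0 := by
    intro h
    apply hG.h3 _ z ht0 htε h
    rw [h, zero_pow (by have := D.hq; omega), mul_zero] at heq
    exact pow_eq_zero_iff (by have := D.hp; omega) |>.1 heq
  have hφ : D.φ (K.pn y0.1.2 z) = y0.1.1 := (D.φ_eq_iff hP _).2 heq
  let x0 : K.Tot c0 r ε := ⟨(y0.1.2, z), ht0, htε, hzr, hP, by rw [hφ]; exact hc0⟩
  have hx0 : Tendsto (fun n => x (ψ n)) atTop (𝓝 x0) := by
    rw [tendsto_subtype_rng]
    exact ht.prodMk_nhds hzl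
  refine ⟨x0, hS.mem_of_tendsto hx0 (.of_forall fun n => hxS _), ?_⟩
  exact Subtype.ext (Prod.ext hφ rfl)

theorem Good.covering (hG : K.Good c0 r ε) (hr : 0 < r) (hε0 : ε ≤ ‖c0‖) :
    IsCoveringMap (K.prR c0 r ε) := by
  rw [isCoveringMap_iff_isCoveringMapOn_univ]
  refine IsClosedMap.isCoveringMapOn_of_isLocalHomeomorphOn hG.closedMap
    (fun y _ => hG.finite_fibre hr y) ?_
  exact (hG.localHomeo hε0).isLocalHomeomorphOn

end Chart
end Oka

namespace Oka
open Filter Topology unitInterval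

/-- domain of moves -/
def Dat.Om (D : Dat) (c0 : ℂ) (ε : ℝ) : Set (ℂ × (Fin 3 → ℂ)) :=
  {x | ‖x.1 - c0‖ < ε ∧ D.P x.2 ≠ 0 ∧ ‖D.φ x.2 - c0‖ < ε}

theorem conv_ball {c0 a b : ℂ} {ε τ : ℝ} (ha : ‖a - c0‖ < ε) (hb : ‖b - c0‖ < ε) (h0 : 0 ≤ τ) (h1 : τ ≤ 1) :
    ‖a + τ * (b - a) - c0‖ < ε := by
  have := (convex_ball c0 ε).add_smul_sub_mem (x := a) (y := b) (by simpa [dist_eq_norm] using ha)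
    (by simpa [dist_eq_norm] using hb) (t := τ) ⟨h0, h1⟩
  simpa [dist_eq_norm] using this

/-- cutoff -/
def chi (ε s : ℝ) : ℝ := max 0 (min 1 (3 - 4 * s / ε))
theorem chi_nonneg (ε s) : 0 ≤ chi ε s := le_max_left _ _
theorem chi_le (ε s) : chi ε s ≤ 1 := max_le zero_le_one (min_le_left _ _)
theorem chi_one {ε s : ℝ} (hε : 0 < ε) (h : s < ε / 2) : chi ε s = 1 := by
  have : 1 ≤ 3 - 4 * s / ε := by
    have : 4 * s / ε ≤ 2 := by rw [div_le_iff₀ hε]; linarith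
    linarith
  simp [chi, this]
theorem chi_zero {ε s : ℝ} (hε : 0 < ε) (h : 3 / 4 * ε < s) : chi ε s = 0 := by
  have : 3 - 4 * s / ε ≤ 0 := by
    have : 3 ≤ 4 * s / ε := by rw [le_div_iff₀ hε]; linarith
    linarith
  simp [chi, this]
theorem continuous_chi (ε) : Continuous (chi ε) := by unfold chi; fun_prop

namespace Chart
variable {D : Dat} {K : Chart D} {c0 : ℂ} {r ε : ℝ}

theorem exists_mv (hG : K.Good c0 r ε) (hr : 0 < r) (hε0 : ε ≤ ‖c0‖) :
    ∃ mv : C(Metric.ball c0 ε × K.Tot c0 r ε, K.Tot c0 r ε), 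
      (∀ x, (mv x).1.1 = x.2.1.1) ∧
      (∀ x, D.φ (K.pn (mv x).1.1 (mv x).1.2) = D.φ (K.pn x.2.1.1 x.2.1.2) + 
        chi ε ‖x.2.1.1‖ * (x.1.1 - D.φ (K.pn x.2.1.1 x.2.1.2))) ∧
      (∀ x, (chi ε ‖x.2.1.1‖ : ℂ) * (x.1.1 - D.φ (K.pn x.2.1.1 x.2.1.2)) = 0 → mv x = x.2) := by
  have hcov := hG.covering hr hε0
  let H : C(I × (Metric.ball c0 ε × K.Tot c0 r ε), Bas c0 ε) := 
    { toFun := fun y => ⟨((K.pr y.2.2.1).1 + (y.1 : ℝ) * chi ε ‖y.2.2.1.1‖ * (y.2.1.1 - (K.pr y.2.2.1).1), 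
        y.2.2.1.1), by
          have hb : ‖y.2.1.1 - c0‖ < ε := mem_ball_iff_norm.1 y.2.1.2
          refine ⟨?_, y.2.2.2.1, y.2.2.2.2.1⟩
          have := conv_ball (K.pr_mem y.2.2.2).1 hb (mul_nonneg y.1.2.1 (chi_nonneg ε ‖y.2.2.1.1‖))
            (mul_le_one₀ y.1.2.2 (chi_nonneg _ _) (chi_le ε ‖y.2.2.1.1‖))
          simpa using this⟩
      continuous_toFun := by
        refine Continuous.subtype_mk ?_ _
        have h1 : Continuous fun y : I × (Metric.ball c0 ε × K.Tot c0 r ε) => K.pr y.2.2.1 := 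
          continuous_subtype_val.comp ((K.continuous_prR c0 r ε).comp (continuous_snd.comp continuous_snd))
        have h2 : Continuous fun y : I × (Metric.ball c0 ε × K.Tot c0 r ε) => chi ε ‖y.2.2.1.1‖ :=
          (continuous_chi ε).comp (by fun_prop)
        have h3 : Continuous fun y : I × (Metric.ball c0 ε × K.Tot c0 r ε) => y.2.1.1 := by fun_prop
        have h4 : Continuous fun y : I × (Metric.ball c0 ε × K.Tot c0 r ε) => ((y.1 : ℝ) : ℂ) := by fun_prop
        refine Continuous.prodMk ?_ (by fun_prop)
        exact h1.fst.add ((h4.mul (Complex.continuous_ofReal.comp h2)).mul (h3.sub h1.fst)) }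
  let f : C(Metric.ball c0 ε × K.Tot c0 r ε, K.Tot c0 r ε) := ⟨fun a => a.2, continuous_snd⟩
  have H0 : ∀ a, H (0, a) = K.prR c0 r ε (f a) := fun a => by
    apply Subtype.ext
    show (_, _) = K.pr a.2.1
    simp [pr]
  let L := hcov.liftHomotopy H f H0
  have hL : ∀ s a, K.pr (L (s, a)).1 = (H (s, a)).1 := fun s a =>
    congrArg Subtype.val (congrFun (hcov.liftHomotopy_lifts H f H0) (s, a))
  refine ⟨L.comp ⟨fun a => (1, a), by fun_prop⟩, fun x => ?_, fun x => ?_, fun x hx => ?_⟩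
  · exact congrArg Prod.snd (hL 1 x)
  · refine (congrArg Prod.fst (hL 1 x)).trans ?_
    simp [H, pr]
  · have e : L (1, x) = L (0, x) := by
      have := hcov.const_of_comp (g := fun s : I => L (s, x)) (by fun_prop) (fun s s' => ?_) 1 0
      · exact this
      · have : ∀ s, H (s, x) = H (0, x) := fun s => by
          apply Subtype.ext
          show (_, _) = (_, _)
          rw [mul_assoc, mul_assoc]
          rw [show (chi ε ‖x.2.1.1‖ : ℂ) * (x.1.1 - (K.pr x.2.1).1) = 0 from hx]
          simp
        have h2 : ∀ s, K.prR c0 r ε (L (s, x)) = H (s, x) := fun s => Subtype.ext (hL s x)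
        show K.prR c0 r ε (L (s, x)) = K.prR c0 r ε (L (s', x))
        rw [h2, h2, this s, this s']
    show L (1, x) = x.2
    rw [e]
    exact hcov.liftHomotopy_zero H f H0 x

theorem Wn_pn {a t z : ℂ} {δ : ℝ} (ha : a ≠ 0) : a • K.pn t z ∈ K.Wn δ r ↔ ‖t‖ < δ ∧ ‖z‖ < r := by
  rw [K.Wn_smul ha, Wn, Set.mem_setOf_eq, co_pn, tc_pn, zc_pn]
  simp

theorem tot_of (hG : K.Good c0 r ε) {v} (hv : v ∈ K.Wn ε r) (hP : D.P v ≠ 0)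
    (hφ : ‖D.φ v - c0‖ < ε) : (K.tc v, K.zc v) ∈ K.Tot c0 r ε := by
  have he := K.pn_tz hv.1
  have hP' : D.P (K.pn (K.tc v) (K.zc v)) ≠ 0 := by
    intro h; apply hP; rw [he, D.P_smul, h, mul_zero]
  have hφ' : D.φ (K.pn (K.tc v) (K.zc v)) = D.φ v := by
    conv_rhs => rw [he, D.φ_smul hv.1]
  refine ⟨?_, hv.2.1, hv.2.2, hP', by rw [hφ']; exact hφ⟩
  rw [norm_pos_iff]
  intro (h0 : K.tc v = 0)
  rw [h0] at hP' hφ'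
  by_cases hz : K.zc v = 0
  · apply hP'
    rw [hz]
    simpa [pn, Dat.pnt] using K.hvb.1
  · refine hG.h2' (K.zc v) _ (norm_pos_iff.2 hz) hv.2.2.le hφ ?_
    exact (D.φ_eq_iff hP' _).1 hφ'

/-- The base move. -/
theorem exists_baseMove (hG : K.Good c0 r ε) (hr : 0 < r) (hε : 0 < ε) (hε0 : ε ≤ ‖c0‖) :
    ∃ β : ℂ → (Fin 3 → ℂ) → (Fin 3 → ℂ), 
      ContinuousOn (fun x : ℂ × (Fin 3 → ℂ) => β x.1 x.2) (D.Om c0 ε) ∧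
      ∀ c v, (c, v) ∈ D.Om c0 ε → (c, β c v) ∈ D.Om c0 ε ∧ (D.φ v = c → β c v = v) ∧
        (∀ ε', ‖c - c0‖ < ε' → ‖D.φ v - c0‖ < ε' → ‖D.φ (β c v) - c0‖ < ε') ∧
        (v ∉ K.Wn ε r → β c v = v) ∧ (v ∈ K.Wn ε r → β c v ∈ K.Wn ε r) ∧
        (β c v ∈ K.Wn (ε/2) r → D.φ (β c v) = c) := by
  classical
  obtain ⟨mv, h1, h2, h3⟩ := exists_mv hG hr hε0
  let Om' : Set (ℂ × (Fin 3 → ℂ)) := D.Om c0 ε ∩ {x | x.2 ∈ K.Wn ε r}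
  let inp : Om' → Metric.ball c0 ε × K.Tot c0 r ε := fun x =>
    (⟨x.1.1, by simpa [dist_eq_norm] using x.2.1.1⟩,
      ⟨(K.tc x.1.2, K.zc x.1.2), tot_of hG x.2.2 x.2.1.2.1 x.2.1.2.2⟩)
  have hinp : Continuous inp := by
    have ht : Continuous fun x : Om' => K.tc x.1.2 :=
      K.continuousOn_tc.comp_continuous (by fun_prop) fun x => x.2.2.1
    have hz : Continuous fun x : Om' => K.zc x.1.2 :=
      K.continuousOn_zc.comp_continuous (by fun_prop) fun x => x.2.2.1
    exact (Continuous.subtype_mk (by fun_prop) _).prodMk (Continuous.subtype_mk (ht.prodMk hz) _)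
  let F : Om' → (Fin 3 → ℂ) := fun x => K.co x.1.2 0 • K.pn (mv (inp x)).1.1 (mv (inp x)).1.2
  have hF : Continuous F := by
    refine Continuous.smul ((K.continuous_co' 0).comp (by fun_prop)) ?_
    exact K.continuous_pn.comp (continuous_subtype_val.comp (mv.continuous.comp hinp))
  let β : ℂ → (Fin 3 → ℂ) → (Fin 3 → ℂ) := fun c v =>
    if h : (c, v) ∈ Om' then F ⟨(c, v), h⟩ else v
  have hβ : ∀ c v (h : (c, v) ∈ Om'), β c v = F ⟨(c, v), h⟩ := fun c v h => dif_pos h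
  have hβn : ∀ c v (h : v ∉ K.Wn ε r), β c v = v := fun c v h => dif_neg fun h' => h h'.2
  have hφ : ∀ x : Om', D.φ (K.pn (K.tc x.1.2) (K.zc x.1.2)) = D.φ x.1.2 := fun x => by
    conv_rhs => rw [K.pn_tz x.2.2.1, D.φ_smul x.2.2.1]
  have hstat : ∀ x : Om', (chi ε ‖K.tc x.1.2‖ : ℂ) * (x.1.1 - D.φ x.1.2) = 0 → F x = x.1.2 := fun x hx => by
    have := h3 (inp x) (by simpa [inp, hφ] using hx)
    simp only [F, this]
    exact (K.pn_tz x.2.2.1).symm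
  have hFφ : ∀ x : Om', D.φ (F x) = D.φ x.1.2 + chi ε ‖K.tc x.1.2‖ * (x.1.1 - D.φ x.1.2) := fun x => by
    simp only [F]
    rw [D.φ_smul x.2.2.1, h2]
    simp only [inp, hφ]
  refine ⟨β, ?_, ?_⟩
  · intro x hx
    let Z : Set (Fin 3 → ℂ) := {v | ‖K.co v 1‖ ≤ 3 / 4 * ε * ‖K.co v 0‖ ∧ ‖K.co v 2‖ ≤ r * ‖K.co v 0‖}
    have hZ : IsClosed Z := 
      (isClosed_le (K.continuous_co' 1).norm (continuous_const.mul (K.continuous_co' 0).norm)).inter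
      (isClosed_le (K.continuous_co' 2).norm (continuous_const.mul (K.continuous_co' 0).norm))
    by_cases hxZ : x.2 ∈ Z
    · have hco : K.co x.2 0 ≠ 0 := by
        intro h0
        obtain ⟨z1, z2⟩ := hxZ
        rw [h0, norm_zero, mul_zero, norm_le_zero_iff] at z1 z2
        apply hx.2.1
        rw [K.co_spec x.2, h0, z1, z2]
        have := D.P_smul 0 0
        simp only [zero_smul, add_zero]
        rw [zero_smul] at this
        rw [this, zero_pow (by have := D.hp; omega), zero_mul]
      have hn : 0 < ‖K.co x.2 0‖ := norm_pos_iff.2 hco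
      have ht : ‖K.tc x.2‖ < ε := by
        rw [tc, norm_div, div_lt_iff₀ hn]
        refine hxZ.1.trans_lt ?_
        have := mul_pos hε hn
        linarith
      have hz : ‖K.zc x.2‖ < r := by
        refine lt_of_le_of_ne ?_ ?_
        · rw [zc, norm_div, div_le_iff₀ hn]; exact hxZ.2
        · intro hzr
          apply hG.h2 _ _ _ ht hzr hx.2.2
          have he := K.pn_tz hco
          have hP' : D.P (K.pn (K.tc x.2) (K.zc x.2)) ≠ 0 := by
            intro h; apply hx.2.1; rw [he, D.P_smul, h, mul_zero]
          rw [← D.φ_eq_iff hP']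
          conv_rhs => rw [he, D.φ_smul hco]
      have hx' : x ∈ Om' := ⟨hx, hco, ht, hz⟩
      have hc : ContinuousOn (fun x : ℂ × (Fin 3 → ℂ) => β x.1 x.2) Om' := by
        rw [continuousOn_iff_continuous_restrict]
        refine hF.congr fun y => (hβ _ _ y.2).symm
      refine (hc x hx').mono_of_mem_nhdsWithin ?_
      refine inter_mem_nhdsWithin _ ?_
      exact continuous_snd.continuousAt.preimage_mem_nhds ((K.isOpen_Wn ε r).mem_nhds hx'.2)
    · have hid : ContinuousWithinAt (fun x : ℂ × (Fin 3 → ℂ) => x.2) (D.Om c0 ε) x :=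
        continuous_snd.continuousWithinAt
      have key : ∀ y : ℂ × (Fin 3 → ℂ), y.2 ∉ Z → β y.1 y.2 = y.2 := by
        intro y hy
        by_cases h : (y.1, y.2) ∈ Om'
        · rw [hβ _ _ h]
          apply hstat ⟨_, h⟩
          rw [chi_zero hε, Complex.ofReal_zero, zero_mul]
          by_contra hle
          push Not at hle
          have hn : 0 < ‖K.co y.2 0‖ := norm_pos_iff.2 h.2.1
          have hz := h.2.2.2
          simp only [tc, zc, norm_div] at hle hz
          rw [div_le_iff₀ hn] at hle
          rw [div_lt_iff₀ hn] at hz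
          exact hy ⟨hle, hz.le⟩
        · exact dif_neg h
      refine hid.congr_of_eventuallyEq ?_ (key x hxZ)
      have : ∀ᶠ y in 𝓝 x, y.2 ∉ Z := continuous_snd.continuousAt.eventually (hZ.isOpen_compl.mem_nhds hxZ)
      filter_upwards [nhdsWithin_le_nhds this] with y hy using key y hy
  · intro c v hcv
    by_cases hv : v ∈ K.Wn ε r
    · have hm : (c, v) ∈ Om' := ⟨hcv, hv⟩
      have hb := hβ c v hm
      have hmem := (mv (inp ⟨_, hm⟩)).2
      have ha : K.co v 0 ≠ 0 := hv.1
      rw [hb]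
      refine ⟨⟨hcv.1, ?_, ?_⟩, fun h => ?_, fun ε' h1 h2 => ?_, fun h => absurd hv h, fun _ => ?_, fun h => ?_⟩
      · show D.P (_ • _) ≠ 0
        rw [D.P_smul]
        exact mul_ne_zero (pow_ne_zero _ ha) hmem.2.2.2.1
      · show ‖D.φ (_ • _) - c0‖ < ε
        rw [D.φ_smul ha]
        exact hmem.2.2.2.2
      · exact hstat ⟨_, hm⟩ (by simp [h])
      · rw [hFφ]; exact conv_ball h2 h1 (chi_nonneg _ _) (chi_le _ _)
      · exact (Wn_pn ha).2 ⟨hmem.2.1, hmem.2.2.1⟩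
      · have := ((Wn_pn (δ := ε/2) ha).1 h).1
        rw [h1] at this
        have this : ‖K.tc v‖ < ε / 2 := this
        rw [hFφ, chi_one hε this]
        simp
    · have hb := hβn c v hv
      rw [hb]
      refine ⟨hcv, fun _ => rfl, fun _ _ h => h, fun _ => rfl, fun h => h, fun h => ?_⟩
      exfalso
      apply hv
      exact ⟨h.1, by have := h.2.1; linarith, h.2.2⟩

/-- Combined base moves. -/
theorem exists_baseMoves (l : List (Chart D)) (hG : ∀ K ∈ l, K.Good c0 r ε) (hr : 0 < r) (hε : 0 < ε)
    (hε0 : ε ≤ ‖c0‖) (hd : l.Pairwise fun K K' => Disjoint (K.Wn ε r) (K'.Wn ε r)) :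
    ∃ β : ℂ → (Fin 3 → ℂ) → (Fin 3 → ℂ), 
      ContinuousOn (fun x : ℂ × (Fin 3 → ℂ) => β x.1 x.2) (D.Om c0 ε) ∧
      ∀ c v, (c, v) ∈ D.Om c0 ε → (c, β c v) ∈ D.Om c0 ε ∧ (D.φ v = c → β c v = v) ∧
        (∀ ε', ‖c - c0‖ < ε' → ‖D.φ v - c0‖ < ε' → ‖D.φ (β c v) - c0‖ < ε') ∧
        ∀ K ∈ l, (β c v ∈ K.Wn (ε/2) r → D.φ (β c v) = c) := by
  induction l with
  | nil => 
    exact ⟨fun c v => v, continuous_snd.continuousOn, fun c v h => ⟨h, fun _ => rfl, fun _ _ h => h, by simp⟩⟩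
  | cons K l ih => 
    rw [List.pairwise_cons] at hd
    obtain ⟨β, hc, hβ⟩ := ih (fun K' h => hG K' (List.mem_cons_of_mem _ h)) hd.2
    obtain ⟨γ, hc', hγ⟩ := exists_baseMove (hG K List.mem_cons_self) hr hε hε0
    refine ⟨fun c v => γ c (β c v), ?_, ?_⟩
    · exact hc'.comp (continuous_fst.continuousOn.prodMk hc) fun x hx => (hβ x.1 x.2 hx).1
    · intro c v hcv
      obtain ⟨b1, b2, b4, b3⟩ := hβ c v hcv
      obtain ⟨g1, g2, g6, g3, g4, g5⟩ := hγ c _ b1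
      refine ⟨g1, fun h => ?_, fun ε' h1 h2 => g6 ε' h1 (b4 ε' h1 h2), fun K' hK' => ?_⟩
      · have e := b2 h
        show γ c (β c v) = v
        rw [g2 (by rw [e]; exact h), e]
      · rcases List.mem_cons.1 hK' with rfl | hK'
        · exact g5
        · intro hm
          have hnot : β c v ∉ K.Wn ε r := fun h => by
            refine Set.disjoint_left.1 (hd.1 K' hK') (g4 h) ⟨hm.1, ?_, hm.2.2⟩
            have := hm.2.1; linarith
          simp only [g3 hnot] at hm ⊢
          exact b3 K' hK' hm

end Chart
end Oka

namespace Oka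
open Filter Topology unitInterval

theorem solve_one {g g' : ℂ → ℂ} {ρ : ℝ} (hρ : 0 < ρ)
    (hg : ∀ u ∈ Metric.closedBall (0 : ℂ) ρ, HasDerivAt g (g' u) u)
    (hg' : ∀ u ∈ Metric.closedBall (0 : ℂ) ρ, ‖g' u - 1‖ ≤ 1 / 2) :
    (∀ u1 ∈ Metric.closedBall (0 : ℂ) ρ, ∀ u2 ∈ Metric.closedBall (0 : ℂ) ρ,
      ‖u1 - u2‖ ≤ 2 * ‖g u1 - g u2‖) ∧
    ∀ c, ‖c - g 0‖ ≤ ρ / 2 → ∃ u ∈ Metric.closedBall (0 : ℂ) ρ, g u = c := by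
  have key : ∀ u1 ∈ Metric.closedBall (0 : ℂ) ρ, ∀ u2 ∈ Metric.closedBall (0 : ℂ) ρ,
      ‖(g u1 - u1) - (g u2 - u2)‖ ≤ 1 / 2 * ‖u1 - u2‖ := by
    intro u1 h1 u2 h2
    exact Convex.norm_image_sub_le_of_norm_hasDerivWithin_le (f := fun u => g u - u)
      (f' := fun u => g' u - 1)
      (fun u hu => ((hg u hu).sub (hasDerivAt_id u)).hasDerivWithinAt) hg'
      (convex_closedBall (0 : ℂ) ρ) h2 h1
  refine ⟨fun u1 h1 u2 h2 => ?_, fun c hc => ?_⟩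
  · have h := key u1 h1 u2 h2
    have : u1 - u2 = (g u1 - g u2) - ((g u1 - u1) - (g u2 - u2)) := by ring
    have h3 : ‖u1 - u2‖ ≤ ‖g u1 - g u2‖ + ‖(g u1 - u1) - (g u2 - u2)‖ := by
      conv_lhs => rw [this]
      exact norm_sub_le _ _
    linarith
  · let e := ContinuousLinearEquiv.refl ℂ ℂ
    have hal : ApproximatesLinearOn g (e : ℂ →L[ℂ] ℂ) (Metric.closedBall (0 : ℂ) ρ) (1 / 2) := by
      intro x hx y hy
      have h := key x hx y hy
      have e1 : g x - g y - (e : ℂ →L[ℂ] ℂ) (x - y) = (g x - x) - (g y - y) := by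
        show g x - g y - (x - y) = _
        ring
      rw [e1]
      refine h.trans (le_of_eq ?_)
      norm_num
    have := hal.surjOn_closedBall_of_nonlinearRightInverse e.toNonlinearRightInverse hρ.le subset_rfl
    refine this ?_
    have h1 : (e.toNonlinearRightInverse.nnnorm : ℝ) = 1 := by
      simp [e, ContinuousLinearEquiv.toNonlinearRightInverse]
    rw [mem_closedBall_iff_norm, h1]
    refine hc.trans (le_of_eq ?_)
    push_cast; ring

namespace Dat
variable (D : Dat)

theorem continuousOn_dφ (k) : ContinuousOn (D.dφ k) {v | D.P v ≠ 0} := by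
  unfold dφ
  refine ContinuousOn.div (Continuous.continuousOn ?_) (Continuous.continuousOn ?_) ?_
  · exact ((D.continuous_P.pow _).mul (D.continuous_Q.pow _)).mul (MvPolynomial.continuous_eval _)
  · exact (D.continuous_P.pow _).pow _
  · intro v hv; exact pow_ne_zero _ (pow_ne_zero _ hv)

theorem isOpen_P : IsOpen {v | D.P v ≠ 0} := isOpen_ne_fun D.continuous_P continuous_const

/-- squared norm of gradient -/
def gr (v : Fin 3 → ℂ) : ℂ := ∑ k, D.dφ k v * (starRingEnd ℂ) (D.dφ k v)
/-- the direction -/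
def nn (v : Fin 3 → ℂ) : Fin 3 → ℂ := fun k => (starRingEnd ℂ) (D.dφ k v) / D.gr v

theorem gr_ne {v k} (h : D.dφ k v ≠ 0) : D.gr v ≠ 0 := by
  have : D.gr v = ((∑ k, ‖D.dφ k v‖ ^ 2 : ℝ) : ℂ) := by
    simp [gr, Complex.mul_conj']
  rw [this]
  norm_cast
  apply ne_of_gt
  have hk : 0 < ‖D.dφ k v‖ ^ 2 := pow_pos (norm_pos_iff.2 h) 2
  exact Finset.sum_pos' (fun i _ => sq_nonneg _) ⟨k, Finset.mem_univ _, hk⟩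

theorem continuousOn_gr : ContinuousOn D.gr {v | D.P v ≠ 0} := by
  unfold gr
  exact continuousOn_finsetSum _ fun k _ => (D.continuousOn_dφ k).mul
    (Complex.continuous_conj.comp_continuousOn (D.continuousOn_dφ k))

theorem continuousOn_nn : ContinuousOn D.nn {v | D.P v ≠ 0 ∧ D.gr v ≠ 0} := by
  unfold nn
  refine continuousOn_pi.2 fun k => ?_
  exact (Complex.continuous_conj.comp_continuousOn ((D.continuousOn_dφ k).mono fun v h => h.1)).div
    (D.continuousOn_gr.mono fun v h => h.1) fun v h => h.2

/-- Move on a compact set. -/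
theorem compact_solve {S : Set (Fin 3 → ℂ)} (hS : IsCompact S) (hP : ∀ v ∈ S, D.P v ≠ 0)
    (hg : ∀ v ∈ S, D.gr v ≠ 0) :
    ∃ ρ > 0, ∃ κ : ℂ → (Fin 3 → ℂ) → (Fin 3 → ℂ),
      ContinuousOn (fun x : ℂ × (Fin 3 → ℂ) => κ x.1 x.2) {x | x.2 ∈ S ∧ ‖x.1 - D.φ x.2‖ ≤ ρ} ∧
      ∀ c, ∀ v ∈ S, ‖c - D.φ v‖ ≤ ρ → D.P (κ c v) ≠ 0 ∧ D.φ (κ c v) = c ∧ (c = D.φ v → κ c v = v) := by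
  classical
  have hcn : ContinuousOn D.nn S := D.continuousOn_nn.mono fun v hv => ⟨hP v hv, hg v hv⟩
  let Fm : S × ℂ → (Fin 3 → ℂ) := fun x => x.1.1 + x.2 • D.nn x.1.1
  have hFm : Continuous Fm := by
    have : Continuous fun x : S => D.nn x.1 := continuousOn_iff_continuous_restrict.1 hcn
    have h2 : Continuous fun x : S × ℂ => D.nn x.1.1 := this.comp continuous_fst
    exact (continuous_subtype_val.comp continuous_fst).add (continuous_snd.smul h2)
  let G : S × ℂ → ℂ := fun x => ∑ k, D.dφ k (Fm x) * D.nn x.1.1 k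
  have hG0 : ∀ v : S, G (v, 0) = 1 := fun v => by
    simp only [G, Fm, zero_smul, add_zero, nn]
    rw [← div_self (hg v.1 v.2)]
    conv_rhs => rw [gr, Finset.sum_div]
    exact Finset.sum_congr rfl fun k _ => by rw [gr]; ring
  haveI : CompactSpace S := isCompact_iff_compactSpace.1 hS
  have hev : ∀ᶠ u in 𝓝 (0 : ℂ), ∀ v ∈ (Set.univ : Set S), D.P (Fm (v, u)) ≠ 0 ∧ ‖G (v, u) - 1‖ < 1 / 2 := by
    apply isCompact_univ.eventually_forall_of_forall_eventually
    intro v _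
    have hFv : D.P (Fm (v, 0)) ≠ 0 := by simpa [Fm] using hP v.1 v.2
    have hsw : Continuous fun x : ℂ × S => (x.2, x.1) := by fun_prop
    have hGc : ContinuousAt (fun x : ℂ × S => G (x.2, x.1)) (0, v) := by
      have hF1 : ContinuousAt (fun x : ℂ × S => Fm (x.2, x.1)) (0, v) := (hFm.comp hsw).continuousAt
      have hn : Continuous fun x : ℂ × S => D.nn x.2.1 :=
        (continuousOn_iff_continuous_restrict.1 hcn).comp continuous_snd
      refine tendsto_finsetSum _ fun k _ => ?_
      refine Tendsto.mul ?_ (((continuous_apply k).comp hn).continuousAt)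
      exact ContinuousAt.comp (f := fun x : ℂ × S => Fm (x.2, x.1)) (x := (0, v))
        ((D.continuousOn_dφ k).continuousAt (D.isOpen_P.mem_nhds hFv)) hF1
    have e1 : ∀ᶠ x : ℂ × S in 𝓝 (0, v), D.P (Fm (x.2, x.1)) ≠ 0 :=
      ((D.continuous_P.comp (hFm.comp hsw)).continuousAt.eventually_ne hFv)
    have e2 : ∀ᶠ x : ℂ × S in 𝓝 (0, v), ‖G (x.2, x.1) - 1‖ < 1 / 2 := by
      have := (hGc.sub (continuousAt_const (y := (1 : ℂ)))).norm
      refine this.eventually_lt continuousAt_const ?_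
      simp [hG0]
    filter_upwards [e1, e2] with x h1 h2 using ⟨h1, h2⟩
  obtain ⟨ρ0, hρ0, hball⟩ := Metric.eventually_nhds_iff_ball.1 hev
  let ρ := ρ0 / 2
  have hρ : 0 < ρ := half_pos hρ0
  have hb : ∀ u ∈ Metric.closedBall (0 : ℂ) ρ, ∀ v : S, D.P (Fm (v, u)) ≠ 0 ∧ ‖G (v, u) - 1‖ < 1 / 2 :=
    fun u hu v => hball u (Metric.closedBall_subset_ball (half_lt_self hρ0) hu) v trivial
  have hsol : ∀ v : S, _ := fun v => solve_one (g := fun u => D.φ (Fm (v, u))) (g' := fun u => G (v, u)) hρ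
    (fun u hu => by
      have h1 := (D.hasStrictFDerivAt_φ (hb u hu v).1).hasFDerivAt
      have h2 : HasDerivAt (fun u => Fm (v, u)) (D.nn v.1) u := by
        have := ((hasDerivAt_id u).smul_const (D.nn v.1)).const_add v.1
        rw [one_smul] at this
        exact this
      have := h1.comp_hasDerivAt u h2
      refine this.congr_deriv ?_
      simp [G])
    (fun u hu => (hb u hu v).2.le)
  have hφ0 : ∀ v : S, D.φ (Fm (v, 0)) = D.φ v.1 := fun v => by simp [Fm]
  let u : ℂ → (Fin 3 → ℂ) → ℂ := fun c v =>
    if h : ∃ w : ℂ, ∃ hv : v ∈ S, w ∈ Metric.closedBall (0 : ℂ) ρ ∧ D.φ (Fm (⟨v, hv⟩, w)) = c then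
      h.choose else 0
  have hu : ∀ c v (hv : v ∈ S), ‖c - D.φ v‖ ≤ ρ / 2 → u c v ∈ Metric.closedBall (0 : ℂ) ρ ∧
      D.φ (Fm (⟨v, hv⟩, u c v)) = c := fun c v hv hc => by
    obtain ⟨w, hw, hw'⟩ := (hsol ⟨v, hv⟩).2 c (by rw [hφ0]; exact hc)
    have h : ∃ w : ℂ, ∃ hv : v ∈ S, w ∈ Metric.closedBall (0 : ℂ) ρ ∧ D.φ (Fm (⟨v, hv⟩, w)) = c :=
      ⟨w, hv, hw, hw'⟩
    have : u c v = h.choose := dif_pos h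
    rw [this]
    exact h.choose_spec.choose_spec
  have huniq : ∀ c v (hv : v ∈ S), ‖c - D.φ v‖ ≤ ρ / 2 → ∀ w ∈ Metric.closedBall (0 : ℂ) ρ,
      ‖u c v - w‖ ≤ 2 * ‖c - D.φ (Fm (⟨v, hv⟩, w))‖ := fun c v hv hc w hw => by
    have := (hsol ⟨v, hv⟩).1 _ (hu c v hv hc).1 w hw
    rwa [(hu c v hv hc).2] at this
  refine ⟨ρ / 2, half_pos hρ, fun c v => v + u c v • D.nn v, ?_, ?_⟩
  · have hcu : ContinuousOn (fun x : ℂ × (Fin 3 → ℂ) => u x.1 x.2) {x | x.2 ∈ S ∧ ‖x.1 - D.φ x.2‖ ≤ ρ / 2} := by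
      rintro ⟨c, v⟩ ⟨hv, hc⟩
      have hv : v ∈ S := hv
      have hc : ‖c - D.φ v‖ ≤ ρ / 2 := hc
      obtain ⟨hw, hwφ⟩ := hu c v hv hc
      set w := u c v with hwdef
      rw [ContinuousWithinAt, tendsto_iff_norm_sub_tendsto_zero]
      have hlim : Tendsto (fun x : ℂ × (Fin 3 → ℂ) => 2 * ‖x.1 - D.φ (x.2 + w • D.nn x.2)‖)
          (𝓝[{x | x.2 ∈ S ∧ ‖x.1 - D.φ x.2‖ ≤ ρ / 2}] (c, v)) (𝓝 0) := by
        have h1 : ContinuousWithinAt (fun x : ℂ × (Fin 3 → ℂ) => x.2 + w • D.nn x.2)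
            {x | x.2 ∈ S ∧ ‖x.1 - D.φ x.2‖ ≤ ρ / 2} (c, v) := by
          have h0 : ContinuousWithinAt (fun x : ℂ × (Fin 3 → ℂ) => D.nn x.2)
            {x | x.2 ∈ S ∧ ‖x.1 - D.φ x.2‖ ≤ ρ / 2} (c, v) :=
            ContinuousWithinAt.comp (f := Prod.snd) (x := (c, v)) (hcn v hv)
              continuous_snd.continuousWithinAt fun x hx => hx.1
          exact continuous_snd.continuousWithinAt.add (h0.const_smul w)
        have hPw : D.P (v + w • D.nn v) ≠ 0 := (hb w hw ⟨v, hv⟩).1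
        have h2 : ContinuousWithinAt (fun x : ℂ × (Fin 3 → ℂ) => D.φ (x.2 + w • D.nn x.2))
            {x | x.2 ∈ S ∧ ‖x.1 - D.φ x.2‖ ≤ ρ / 2} (c, v) :=
          ContinuousAt.comp_continuousWithinAt (f := fun x : ℂ × (Fin 3 → ℂ) => x.2 + w • D.nn x.2)
            (x := (c, v)) (g := D.φ)
            (D.continuousOn_φ.continuousAt (D.isOpen_P.mem_nhds hPw)) h1
        have h3 := (continuous_fst.continuousWithinAt.sub h2).norm.tendsto.const_mul 2
        have h4 : D.φ (v + w • D.nn v) = c := hwφ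
        have h5 : 2 * ‖(c, v).1 - D.φ ((c, v).2 + w • D.nn (c, v).2)‖ = 0 := by
          show 2 * ‖c - D.φ (v + w • D.nn v)‖ = 0
          rw [h4]; simp
        rw [← h5]
        exact h3
      refine squeeze_zero' (.of_forall fun _ => norm_nonneg _) ?_ hlim
      filter_upwards [self_mem_nhdsWithin] with x hx
      exact huniq x.1 x.2 hx.1 hx.2 w hw
    refine continuous_snd.continuousOn.add (hcu.smul ?_)
    exact hcn.comp continuous_snd.continuousOn fun x hx => hx.1
  · intro c v hv hc
    obtain ⟨h1, h2⟩ := hu c v hv hc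
    refine ⟨(hb _ h1 ⟨v, hv⟩).1, h2, fun h => ?_⟩
    have := huniq c v hv hc 0 (by simp [hρ.le])
    rw [hφ0, ← h, sub_self, norm_zero, mul_zero, sub_zero, norm_le_zero_iff] at this
    simp [this]

end Dat
end Oka

namespace Oka
open Filter Topology unitInterval

namespace Dat
variable (D : Dat)

theorem transport_aux {c0 : ℂ} {r ε ε1 : ℝ} (l : List (Chart D)) (hG : ∀ K ∈ l, K.Good c0 r ε) (hr : 0 < r)
    (hε : 0 < ε) (hε0 : ε ≤ ‖c0‖) (hd : l.Pairwise fun K K' => Disjoint (K.Wn ε r) (K'.Wn ε r))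
    (hl : ∀ v ≠ 0, D.P v = 0 → D.Q v = 0 → ∃ K ∈ l, v ∈ K.Wn (ε / 2) r)
    (hε1 : 0 < ε1) (hε1' : ε1 < ε)
    (hcr : ∀ v, D.P v ≠ 0 → ‖D.φ v - c0‖ ≤ ε1 → ∃ k, eval v (D.E k) ≠ 0) :
    ∃ ε2 > 0, ∃ Φ : ℂ → (Fin 3 → ℂ) → (Fin 3 → ℂ),
      ContinuousOn (fun x : ℂ × (Fin 3 → ℂ) => Φ x.1 x.2) (D.Om c0 ε2) ∧
      ∀ c v, (c, v) ∈ D.Om c0 ε2 → D.P (Φ c v) ≠ 0 ∧ D.φ (Φ c v) = c ∧ (D.φ v = c → Φ c v = v) := by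
  classical
  obtain ⟨β, hβc, hβ⟩ := Chart.exists_baseMoves l hG hr hε hε0 hd
  let S : Set (Fin 3 → ℂ) := {v | ‖v‖ = 1 ∧ (∀ K ∈ l, v ∉ K.Wn (ε / 2) r) ∧
    ∃ c ∈ Metric.closedBall c0 ε1, D.Q v ^ D.p = c * D.P v ^ D.q}
  have hSc : IsCompact S := by
    have e : S = Metric.sphere (0 : Fin 3 → ℂ) 1 ∩ ((⋂ K ∈ l, (K.Wn (ε / 2) r)ᶜ) ∩
      (Prod.snd '' {x : ℂ × (Fin 3 → ℂ) | x.1 ∈ Metric.closedBall c0 ε1 ∧ D.Q x.2 ^ D.p = x.1 * D.P x.2 ^ D.q})) := by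
      ext v
      simp [S]
    rw [e]
    refine (isCompact_sphere _ _).inter_right (IsClosed.inter ?_ ?_)
    · exact isClosed_biInter fun K _ => (K.isOpen_Wn _ _).isClosed_compl
    · have hcl : IsClosed {x : ↥(Metric.closedBall c0 ε1) × (Fin 3 → ℂ) |
          D.Q x.2 ^ D.p = x.1.1 * D.P x.2 ^ D.q} := by
        refine isClosed_eq ((D.continuous_Q.comp continuous_snd).pow _) ?_
        exact (continuous_subtype_val.comp continuous_fst).mul ((D.continuous_P.comp continuous_snd).pow _)
      haveI : CompactSpace ↥(Metric.closedBall c0 ε1) :=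
        isCompact_iff_compactSpace.1 (isCompact_closedBall c0 ε1)
      have := isClosedMap_snd_of_compactSpace (X := ↥(Metric.closedBall c0 ε1)) _ hcl
      refine IsClosed.mono (?_ : IsClosed[Pi.topologicalSpace] _) le_rfl
      have e' : Prod.snd '' {x : ℂ × (Fin 3 → ℂ) | x.1 ∈ Metric.closedBall c0 ε1 ∧ D.Q x.2 ^ D.p = x.1 * D.P x.2 ^ D.q}
        = Prod.snd '' {x : ↥(Metric.closedBall c0 ε1) × (Fin 3 → ℂ) | D.Q x.2 ^ D.p = x.1.1 * D.P x.2 ^ D.q} := by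
        apply Set.Subset.antisymm
        · rintro _ ⟨⟨c, v⟩, ⟨h1, h2⟩, rfl⟩
          exact ⟨(⟨c, h1⟩, v), h2, rfl⟩
        · rintro _ ⟨⟨c, v⟩, h2, rfl⟩
          exact ⟨(c.1, v), ⟨c.2, h2⟩, rfl⟩
      rw [e']
      exact this
  have hSP : ∀ v ∈ S, D.P v ≠ 0 := by
    rintro v ⟨h1, h2, c, hc, h3⟩ h
    have hq := D.hq
    have hp := D.hp
    rw [h, zero_pow (by omega), mul_zero] at h3
    have h4 := pow_eq_zero_iff (n := D.p) (by omega) |>.1 h3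
    obtain ⟨K, hK, hv⟩ := hl v (by rintro rfl; simp at h1) h h4
    exact h2 K hK hv
  have hSφ : ∀ v ∈ S, ‖D.φ v - c0‖ ≤ ε1 := by
    intro v hv
    have hP := hSP v hv
    obtain ⟨h1, h2, c, hc, h3⟩ := hv
    rw [(D.φ_eq_iff hP c).2 h3]
    exact mem_closedBall_iff_norm.1 hc
  have hφ0 : ∀ v, ‖D.φ v - c0‖ < ε → D.φ v ≠ 0 := by
    intro v hv h
    rw [h, zero_sub, norm_neg] at hv
    linarith
  have hSg : ∀ v ∈ S, D.gr v ≠ 0 := by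
    intro v hv
    obtain ⟨k, hk⟩ := hcr v (hSP v hv) (hSφ v hv)
    exact D.gr_ne (D.dφ_ne (hSP v hv) (hφ0 v ((hSφ v hv).trans_lt hε1')) hk)
  obtain ⟨ρ, hρ, κ, hκc, hκ⟩ := D.compact_solve hSc hSP hSg
  let ε2 := min ε1 (ρ / 2)
  have h21 : ε2 ≤ ε1 := min_le_left _ _
  have h2ρ : ε2 ≤ ρ / 2 := min_le_right _ _
  have hOm : D.Om c0 ε2 ⊆ D.Om c0 ε := by
    rintro x ⟨h1, h2, h3⟩
    exact ⟨by linarith, h2, by linarith⟩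
  let U : Set (Fin 3 → ℂ) := ⋃ K ∈ l, K.Wn (ε / 2) r
  have hU : IsOpen U := isOpen_biUnion fun K _ => K.isOpen_Wn _ _
  let κ1 : ℂ → (Fin 3 → ℂ) → (Fin 3 → ℂ) := fun c w => (‖w‖ : ℂ) • κ c ((‖w‖ : ℂ)⁻¹ • w)
  have hw0 : ∀ w, D.P w ≠ 0 → w ≠ 0 := by
    rintro w hw rfl
    apply hw
    have := D.P_smul 0 (0 : Fin 3 → ℂ)
    have hp := D.hp
    rwa [zero_smul, zero_pow (by omega), zero_mul] at this
  have hnS : ∀ w, D.P w ≠ 0 → ‖D.φ w - c0‖ ≤ ε1 → w ∉ U → ((‖w‖ : ℂ)⁻¹ • w) ∈ S := by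
    intro w hP hφ hwU
    have hw := hw0 w hP
    have hn : (‖w‖ : ℂ) ≠ 0 := by exact_mod_cast (norm_pos_iff.2 hw).ne'
    refine ⟨?_, ?_, D.φ w, mem_closedBall_iff_norm.2 hφ, ?_⟩
    · rw [norm_smul]; simp [hw]
    · intro K hK h
      rw [K.Wn_smul (inv_ne_zero hn)] at h
      exact hwU (Set.mem_biUnion hK h)
    · rw [← D.φ_eq_iff]
      · exact D.φ_smul (inv_ne_zero hn) w
      · rw [D.P_smul]; exact mul_ne_zero (pow_ne_zero _ (inv_ne_zero hn)) hP
  have hβ2 : ∀ c v, (c, v) ∈ D.Om c0 ε2 → D.P (β c v) ≠ 0 ∧ ‖D.φ (β c v) - c0‖ < ε2 := fun c v h => by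
    have h' := hβ c v (hOm h)
    exact ⟨h'.1.2.1, h'.2.2.1 ε2 h.1 h.2.2⟩
  have hκ1 : ∀ c w, ‖c - c0‖ < ε2 → D.P w ≠ 0 → ‖D.φ w - c0‖ < ε2 → w ∉ U →
      D.P (κ1 c w) ≠ 0 ∧ D.φ (κ1 c w) = c ∧ (c = D.φ w → κ1 c w = w) := by
    intro c w hc hP hφ hwU
    have hw := hw0 w hP
    have hn : (‖w‖ : ℂ) ≠ 0 := by exact_mod_cast (norm_pos_iff.2 hw).ne'
    have hcφ : ‖c - D.φ w‖ ≤ ρ := by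
      have : c - D.φ w = (c - c0) - (D.φ w - c0) := by ring
      rw [this]
      exact (norm_sub_le _ _).trans (by linarith)
    have hφ' : D.φ ((‖w‖ : ℂ)⁻¹ • w) = D.φ w := D.φ_smul (inv_ne_zero hn) w
    obtain ⟨a1, a2, a3⟩ := hκ c _ (hnS w hP (by linarith) hwU) (by rw [hφ']; exact hcφ)
    refine ⟨?_, ?_, fun h => ?_⟩
    · show D.P ((‖w‖ : ℂ) • _) ≠ 0
      rw [D.P_smul]
      exact mul_ne_zero (pow_ne_zero _ hn) a1
    · show D.φ ((‖w‖ : ℂ) • _) = c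
      rw [D.φ_smul hn, a2]
    · show (‖w‖ : ℂ) • _ = w
      rw [a3 (by rw [hφ']; exact h), smul_smul, mul_inv_cancel₀ hn, one_smul]
  refine ⟨ε2, lt_min hε1 (half_pos hρ), fun c v => if β c v ∈ U then β c v else κ1 c (β c v), ?_, ?_⟩
  · rw [continuousOn_iff_continuous_restrict]
    have hβc' : Continuous fun x : D.Om c0 ε2 => β x.1.1 x.1.2 :=
      continuousOn_iff_continuous_restrict.1 (hβc.mono hOm)
    let A : Set (D.Om c0 ε2) := {x | β x.1.1 x.1.2 ∉ U}
    let B : Set (D.Om c0 ε2) := {x | D.φ (β x.1.1 x.1.2) = x.1.1}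
    have hA : IsClosed A := (hU.preimage hβc').isClosed_compl
    have hφc : Continuous fun x : D.Om c0 ε2 => D.φ (β x.1.1 x.1.2) :=
      D.continuousOn_φ.comp_continuous hβc' fun x => (hβ2 _ _ x.2).1
    have hB : IsClosed B := isClosed_eq hφc (continuous_fst.comp continuous_subtype_val)
    have hAB : A ∪ B = Set.univ := by
      ext x
      simp only [Set.mem_union, Set.mem_univ, iff_true, A, B, Set.mem_setOf_eq]
      by_cases h : β x.1.1 x.1.2 ∈ U
      · right
        obtain ⟨K, hK, h'⟩ := Set.mem_iUnion₂.1 h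
        exact (hβ _ _ (hOm x.2)).2.2.2 K hK h'
      · exact Or.inl h
    rw [← continuousOn_univ, ← hAB]
    refine ContinuousOn.union_of_isClosed ?_ ?_ hA hB
    · have : ContinuousOn (fun x : D.Om c0 ε2 => κ1 x.1.1 (β x.1.1 x.1.2)) A := by
        have hnc : ContinuousOn (fun x : D.Om c0 ε2 => (‖β x.1.1 x.1.2‖ : ℂ)) A :=
          (Complex.continuous_ofReal.comp hβc'.norm).continuousOn
        refine hnc.smul ?_
        refine hκc.comp (f := fun x : D.Om c0 ε2 => (x.1.1, (‖β x.1.1 x.1.2‖ : ℂ)⁻¹ • β x.1.1 x.1.2)) ?_ ?_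
        · refine (continuous_fst.comp continuous_subtype_val).continuousOn.prodMk ?_
          refine (hnc.inv₀ ?_).smul hβc'.continuousOn
          intro x _
          exact_mod_cast (norm_pos_iff.2 (hw0 _ (hβ2 _ _ x.2).1)).ne'
        · intro x hx
          obtain ⟨b1, b2⟩ := hβ2 _ _ x.2
          refine ⟨hnS _ b1 (by linarith) hx, ?_⟩
          have hn : (‖β x.1.1 x.1.2‖ : ℂ) ≠ 0 := by exact_mod_cast (norm_pos_iff.2 (hw0 _ b1)).ne'
          show ‖x.1.1 - D.φ ((‖β x.1.1 x.1.2‖ : ℂ)⁻¹ • β x.1.1 x.1.2)‖ ≤ ρ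
          rw [D.φ_smul (inv_ne_zero hn)]
          have : x.1.1 - D.φ (β x.1.1 x.1.2) = (x.1.1 - c0) - (D.φ (β x.1.1 x.1.2) - c0) := by ring
          rw [this]
          have := x.2.1
          exact (norm_sub_le _ _).trans (by linarith)
      refine this.congr fun x hx => ?_
      exact if_neg hx
    · refine hβc'.continuousOn.congr fun x hx => ?_
      simp only [Set.restrict_apply]
      split_ifs with h
      · rfl
      · obtain ⟨b1, b2⟩ := hβ2 _ _ x.2
        exact (hκ1 _ _ x.2.1 b1 b2 h).2.2 hx.symm
  · intro c v hcv
    obtain ⟨b1, b2⟩ := hβ2 _ _ hcv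
    have hb := hβ c v (hOm hcv)
    dsimp only
    split_ifs with h
    · obtain ⟨K, hK, h'⟩ := Set.mem_iUnion₂.1 h
      exact ⟨b1, hb.2.2.2 K hK h', hb.2.1⟩
    · obtain ⟨a1, a2, a3⟩ := hκ1 c _ hcv.1 b1 b2 h
      refine ⟨a1, a2, fun h0 => ?_⟩
      have := hb.2.1 h0
      rw [this] at a3 ⊢
      exact a3 h0.symm

/-- Local transport. -/
theorem exists_transport : ∃ B : Set ℂ, B.Finite ∧ 0 ∈ B ∧ ∀ c0 ∉ B,
    ∃ ε2 > 0, ∃ Φ : ℂ → (Fin 3 → ℂ) → (Fin 3 → ℂ),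
      ContinuousOn (fun x : ℂ × (Fin 3 → ℂ) => Φ x.1 x.2) (D.Om c0 ε2) ∧
      ∀ c v, (c, v) ∈ D.Om c0 ε2 → D.P (Φ c v) ≠ 0 ∧ D.φ (Φ c v) = c ∧ (D.φ v = c → Φ c v = v) := by
  classical
  have hfin := BaseT_finite D.fp D.fq D.p D.q D.hfp D.hfq D.hirr D.hnd
  choose Kf hKf using fun x : hfin.toFinset => Chart.exists_of (D := D) (hfin.mem_toFinset.1 x.2)
  let l : List (Chart D) := (Finset.univ : Finset hfin.toFinset).toList.map Kf
  have hlp : l.Pairwise fun K K' => K.vb ≠ K'.vb := by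
    rw [List.pairwise_map]
    refine (Finset.nodup_toList _).imp ?_
    intro a b hab h
    rw [hKf, hKf] at h
    exact hab (Subtype.ext h)
  choose Bf hBf hBg using fun x : hfin.toFinset => (Kf x).good
  refine ⟨{0} ∪ {c : ℂ | ∃ v, D.P v ≠ 0 ∧ D.φ v = c ∧ ∀ k, eval v (D.E k) = 0} ∪ ⋃ x, Bf x,
    ((Set.finite_singleton 0).union D.critFinite).union (Set.finite_iUnion hBf), Or.inl (Or.inl rfl), ?_⟩
  intro c0 hc0
  have hc00 : c0 ≠ 0 := fun h => hc0 (Or.inl (Or.inl h))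
  have hcrit : c0 ∉ {c : ℂ | ∃ v, D.P v ≠ 0 ∧ D.φ v = c ∧ ∀ k, eval v (D.E k) = 0} :=
    fun h => hc0 (Or.inl (Or.inr h))
  have hBn : ∀ x, c0 ∉ Bf x := fun x h => hc0 (Or.inr (Set.mem_iUnion.2 ⟨x, h⟩))
  have e1 : ∀ᶠ r : ℝ in 𝓝[>] 0, ∀ x, ∀ᶠ ε : ℝ in 𝓝[>] 0, (Kf x).Good c0 r ε :=
    eventually_all.2 fun x => hBg x c0 (hBn x)
  have e2 : ∀ᶠ r : ℝ in 𝓝[>] 0, ∀ x y, x ≠ y → Disjoint ((Kf x).Wn r r) ((Kf y).Wn r r) :=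
    eventually_all.2 fun x => eventually_all.2 fun y => by
      by_cases h : x = y
      · simp [h]
      · have := Chart.disj (Kf x) (Kf y) (by rw [hKf, hKf]; exact fun h' => h (Subtype.ext h'))
        exact this.mono fun r hr _ => hr
  obtain ⟨r, hr1, hr2, hr⟩ := (e1.and (e2.and self_mem_nhdsWithin)).exists
  have hr : 0 < r := hr
  have e3 : ∀ᶠ ε : ℝ in 𝓝[>] 0, ε < min r ‖c0‖ :=
    nhdsWithin_le_nhds (Iio_mem_nhds (lt_min hr (norm_pos_iff.2 hc00)))
  obtain ⟨ε, h1, h2, hε⟩ := ((eventually_all.2 hr1).and (e3.and self_mem_nhdsWithin)).exists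
  have hε : 0 < ε := hε
  have hεr : ε ≤ r := (h2.trans_le (min_le_left _ _)).le
  have e4 : ∀ᶠ c in 𝓝 c0, c ∉ {c : ℂ | ∃ v, D.P v ≠ 0 ∧ D.φ v = c ∧ ∀ k, eval v (D.E k) = 0} :=
    D.critFinite.isClosed.isOpen_compl.mem_nhds hcrit
  obtain ⟨η, hη, hη'⟩ := Metric.eventually_nhds_iff_ball.1 e4
  refine D.transport_aux (r := r) (ε := ε) (ε1 := min η ε / 2) l ?_ hr hε (h2.trans_le (min_le_right _ _)).le ?_ ?_
    (half_pos (lt_min hη hε)) ?_ ?_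
  · intro K hK
    obtain ⟨x, -, rfl⟩ := List.mem_map.1 hK
    exact h1 x
  · rw [List.pairwise_map] at hlp ⊢
    refine (Finset.nodup_toList _).imp ?_
    intro a b hab
    refine (hr2 a b hab).mono ?_ ?_
    · exact fun v hv => ⟨hv.1, hv.2.1.trans_le hεr, hv.2.2⟩
    · exact fun v hv => ⟨hv.1, hv.2.1.trans_le hεr, hv.2.2⟩
  · intro v hv hP hQ
    obtain ⟨w, hw, a, ha, rfl⟩ := BaseT_exists D.hfp D.hfq hv hP hQ
    refine ⟨Kf ⟨w, hfin.mem_toFinset.2 hw⟩, List.mem_map.2 ⟨_, by simp, rfl⟩, ?_⟩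
    rw [Chart.Wn_smul _ ha]
    set K := Kf ⟨w, hfin.mem_toFinset.2 hw⟩ with hK
    have hvb : K.vb = w := hKf _
    have hco : K.co w = ![1, 0, 0] := by
      have := K.co_mk 1 0 0
      rwa [one_smul, zero_smul, zero_smul, add_zero, add_zero, hvb] at this
    refine ⟨?_, ?_, ?_⟩
    · rw [hco]; simp
    · rw [Chart.tc, hco]; simpa using hε
    · rw [Chart.zc, hco]; simpa using hr
  · have := min_le_right η ε
    linarith
  · intro v hP hφ
    have h3 := hη' (D.φ v) (by
      rw [mem_ball_iff_norm]
      have := min_le_left η ε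
      linarith)
    by_contra! hk
    exact h3 ⟨v, hP, rfl, hk⟩

end Dat
end Oka

namespace Oka
open Filter Topology unitInterval

section HLP
variable {Y : Type} [TopologicalSpace Y] 

/-- local transport along `φ` away from `B` -/
def Trans (φ : Y → ℂ) (B : Set ℂ) : Prop := ∀ c0 ∉ B, ∃ ε > 0, ∃ Φ : ℂ → Y → Y,
  ContinuousOn (fun x : ℂ × Y => Φ x.1 x.2) {x | ‖x.1 - c0‖ < ε ∧ ‖φ x.2 - c0‖ < ε} ∧
  ∀ c y, ‖c - c0‖ < ε → ‖φ y - c0‖ < ε → φ (Φ c y) = c ∧ (φ y = c → Φ c y = y)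

variable {φ : Y → ℂ} {B : Set ℂ}

theorem trans_list (hφ : Continuous φ) (ρ : ℝ) (l : List (ℂ × ℝ)) 
    (hl : ∀ x ∈ l, 0 < x.2 ∧ ρ ≤ x.2 / 2 ∧ ∃ Φ : ℂ → Y → Y,
      ContinuousOn (fun z : ℂ × Y => Φ z.1 z.2) {z | ‖z.1 - x.1‖ < x.2 ∧ ‖φ z.2 - x.1‖ < x.2} ∧
      ∀ c y, ‖c - x.1‖ < x.2 → ‖φ y - x.1‖ < x.2 → φ (Φ c y) = c ∧ (φ y = c → Φ c y = y)) :
    ∃ θ : ℂ → ℝ, ∃ Φ : ℂ → Y → Y, Continuous θ ∧ (∀ x, 0 ≤ θ x ∧ θ x ≤ 1) ∧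
      (∀ x ∈ l, ∀ c, ‖c - x.1‖ < x.2 / 4 → θ c = 1) ∧
      ContinuousOn (fun z : ℂ × Y => Φ z.1 z.2) {z | ‖z.1 - φ z.2‖ < ρ} ∧
      ∀ c y, ‖c - φ y‖ < ρ → φ (Φ c y) = φ y + θ (φ y) * (c - φ y) ∧ (φ y = c → Φ c y = y) := by
  classical
  induction l with
  | nil => 
    exact ⟨fun _ => 0, fun c y => y, continuous_const, by simp, by simp, continuous_snd.continuousOn, by simp⟩
  | cons x l ih =>
    obtain ⟨θ, Φ, hθc, hθ, hθ1, hΦc, hΦ⟩ := ih fun x hx => hl x (List.mem_cons_of_mem _ hx)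
    obtain ⟨hx2, hρ, Ψ, hΨc, hΨ⟩ := hl x List.mem_cons_self
    let χ : ℂ → ℝ := fun c => max 0 (min 1 (2 - 4 * ‖c - x.1‖ / x.2))
    have hχc : Continuous χ := by simp only [χ]; fun_prop
    have hχ0 : ∀ c, 0 ≤ χ c := fun c => le_max_left _ _
    have hχ1 : ∀ c, χ c ≤ 1 := fun c => max_le zero_le_one (min_le_left _ _)
    have hχe : ∀ c, ‖c - x.1‖ < x.2 / 4 → χ c = 1 := fun c hc => by
      have : 4 * ‖c - x.1‖ / x.2 ≤ 1 := by rw [div_le_one hx2]; linarith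
      simp only [χ]
      rw [min_eq_left (by linarith), max_eq_right zero_le_one]
    have hχz : ∀ c, x.2 / 2 ≤ ‖c - x.1‖ → χ c = 0 := fun c hc => by
      have : 2 ≤ 4 * ‖c - x.1‖ / x.2 := by rw [le_div_iff₀ hx2]; linarith
      exact max_eq_left ((min_le_right _ _).trans (by linarith))
    let θ' : ℂ → ℝ := fun c => θ c + χ c * (1 - θ c)
    have hθ'c : Continuous θ' := hθc.add (hχc.mul (continuous_const.sub hθc))
    have hθ' : ∀ c, 0 ≤ θ' c ∧ θ' c ≤ 1 := fun c => by
      have h1 := hθ c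
      have h2 := hχ0 c
      have h3 := hχ1 c
      simp only [θ']
      constructor
      · have := mul_nonneg h2 (sub_nonneg.2 h1.2); linarith [h1.1]
      · nlinarith [h1.2]
    let cc : ℂ → Y → ℂ := fun c y => φ y + θ' (φ y) * (c - φ y)
    have hccc : Continuous fun z : ℂ × Y => cc z.1 z.2 := by
      simp only [cc]
      fun_prop
    have hnear : ∀ c y, ‖c - φ y‖ < ρ → ‖φ y - x.1‖ < x.2 / 2 → ∀ s : ℝ, 0 ≤ s → s ≤ 1 → 
        ‖φ y + s * (c - φ y) - x.1‖ < x.2 := by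
      intro c y h1 h2 s hs0 hs1
      have e : φ y + s * (c - φ y) - x.1 = (φ y - x.1) + s * (c - φ y) := by ring
      rw [e]
      have h3 : ‖(s : ℂ) * (c - φ y)‖ ≤ ‖c - φ y‖ := by
        rw [norm_mul, Complex.norm_real, Real.norm_of_nonneg hs0]
        exact mul_le_of_le_one_left (norm_nonneg _) hs1
      exact (norm_add_le _ _).trans_lt (by linarith)
    refine ⟨θ', fun c y => if ‖φ y - x.1‖ < x.2 / 2 then Ψ (cc c y) (Φ c y) else Φ c y, hθ'c, hθ', ?_, ?_, ?_⟩
    · intro z hz c hc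
      rcases List.mem_cons.1 hz with rfl | hz
      · simp only [θ', hχe c hc]; ring
      · simp only [θ', hθ1 z hz c hc]; ring
    · rw [continuousOn_iff_continuous_restrict]
      set Ω := {z : ℂ × Y | ‖z.1 - φ z.2‖ < ρ} with hΩ
      have hΦ' : Continuous fun z : Ω => Φ z.1.1 z.1.2 := continuousOn_iff_continuous_restrict.1 hΦc
      have hfst : Continuous fun z : Ω => z.1.1 := continuous_fst.comp continuous_subtype_val
      have hsnd : Continuous fun z : Ω => φ z.1.2 := hφ.comp (continuous_snd.comp continuous_subtype_val)
      let A : Set Ω := {z | ‖φ z.1.2 - x.1‖ < x.2 / 2}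
      have hA : IsOpen A := isOpen_lt (hsnd.sub continuous_const).norm continuous_const
      have hA2 : ContinuousOn (fun z : Ω => Ψ (cc z.1.1 z.1.2) (Φ z.1.1 z.1.2)) 
          {z | ‖φ z.1.2 - x.1‖ ≤ x.2 / 2 ∧ ‖φ z.1.2 - x.1‖ ≤ x.2 / 2} := by
        refine hΨc.comp (f := fun z : Ω => (cc z.1.1 z.1.2, Φ z.1.1 z.1.2)) ?_ ?_
        · exact ((hccc.comp continuous_subtype_val).prodMk hΦ').continuousOn
        · have hn2 : ∀ c y, ‖c - φ y‖ < ρ → ‖φ y - x.1‖ ≤ x.2 / 2 → ∀ s : ℝ, 0 ≤ s → s ≤ 1 → 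
              ‖φ y + s * (c - φ y) - x.1‖ < x.2 := by
            intro c y h1 h2 s hs0 hs1
            have e : φ y + s * (c - φ y) - x.1 = (φ y - x.1) + s * (c - φ y) := by ring
            rw [e]
            have h3 : ‖(s : ℂ) * (c - φ y)‖ ≤ ‖c - φ y‖ := by
              rw [norm_mul, Complex.norm_real, Real.norm_of_nonneg hs0]
              exact mul_le_of_le_one_left (norm_nonneg _) hs1
            exact (norm_add_le _ _).trans_lt (by linarith)
          intro z hz
          refine ⟨hn2 _ _ z.2 hz.1 _ (hθ' _).1 (hθ' _).2, ?_⟩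
          show ‖φ (Φ z.1.1 z.1.2) - x.1‖ < x.2
          rw [(hΦ _ _ z.2).1]
          exact hn2 _ _ z.2 hz.1 _ (hθ _).1 (hθ _).2
      have hU : {z : Ω | ‖φ z.1.2 - x.1‖ ≤ x.2 / 2 ∧ ‖φ z.1.2 - x.1‖ ≤ x.2 / 2} ∪ 
          {z : Ω | x.2 / 2 ≤ ‖φ z.1.2 - x.1‖} = Set.univ := by
        ext z
        simp [le_total]
      rw [← continuousOn_univ, ← hU]
      have key : ∀ z : Ω, x.2 / 2 = ‖φ z.1.2 - x.1‖ → Ψ (cc z.1.1 z.1.2) (Φ z.1.1 z.1.2) = Φ z.1.1 z.1.2 := by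
        intro z hz
        have hz0 : χ (φ z.1.2) = 0 := hχz _ hz.le
        have e : φ (Φ z.1.1 z.1.2) = cc z.1.1 z.1.2 := by
          rw [(hΦ _ _ z.2).1]
          simp [cc, θ', hz0]
        have h1 : ‖cc z.1.1 z.1.2 - x.1‖ < x.2 := by
          have h3 : ‖((θ' (φ z.1.2) : ℝ) : ℂ) * (z.1.1 - φ z.1.2)‖ ≤ ‖z.1.1 - φ z.1.2‖ := by
            rw [norm_mul, Complex.norm_real, Real.norm_of_nonneg (hθ' _).1]
            exact mul_le_of_le_one_left (norm_nonneg _) (hθ' _).2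
          have e : cc z.1.1 z.1.2 - x.1 = (φ z.1.2 - x.1) + θ' (φ z.1.2) * (z.1.1 - φ z.1.2) := by
            simp only [cc]; ring
          rw [e]
          have := z.2
          have h4 : ‖z.1.1 - φ z.1.2‖ < ρ := z.2
          exact (norm_add_le _ _).trans_lt (by linarith)
        exact (hΨ _ _ h1 (e ▸ h1)).2 e
      refine ContinuousOn.union_of_isClosed ?_ ?_ ?_ ?_
      · refine hA2.congr fun z hz => ?_
        simp only [Set.restrict_apply]
        split_ifs with h
        · rfl
        · exact (key z (le_antisymm (not_lt.1 h) hz.1)).symm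
      · refine hΦ'.continuousOn.congr fun z hz => ?_
        simp only [Set.restrict_apply]
        exact if_neg (not_lt.2 hz)
      · simp only [and_self]
        exact isClosed_le (hsnd.sub continuous_const).norm continuous_const
      · exact isClosed_le continuous_const (hsnd.sub continuous_const).norm 
    · intro c y hc
      obtain ⟨a1, a2⟩ := hΦ c y hc
      dsimp only
      split_ifs with h
      · have h1 : ‖cc c y - x.1‖ < x.2 := hnear c y hc h _ (hθ' _).1 (hθ' _).2
        have h2 : ‖φ (Φ c y) - x.1‖ < x.2 := by
          rw [a1]; exact hnear c y hc h _ (hθ _).1 (hθ _).2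
        obtain ⟨b1, b2⟩ := hΨ _ _ h1 h2
        refine ⟨b1, fun h0 => ?_⟩
        rw [b2, a2 h0]
        rw [a2 h0]
        simp [cc, h0]
      · refine ⟨?_, a2⟩
        rw [a1]
        simp [θ', hχz _ (not_lt.1 h)]

/-- transport on a compact set -/
theorem Trans.compact (hT : Trans φ B) (hφ : Continuous φ) {C : Set ℂ} (hC : IsCompact C) (hCB : Disjoint C B) :
    ∃ ρ > 0, ∃ Φ : ℂ → Y → Y, ContinuousOn (fun z : ℂ × Y => Φ z.1 z.2) {z | ‖z.1 - φ z.2‖ < ρ} ∧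
      ∀ c y, ‖c - φ y‖ < ρ → (φ y ∈ C → φ (Φ c y) = c) ∧ (φ y = c → Φ c y = y) := by
  classical
  choose! e he Ψ hΨc hΨ using hT
  obtain ⟨s, hsC, hs⟩ := hC.elim_nhds_subcover (fun c => Metric.ball c (e c / 4)) 
    fun c hc => Metric.ball_mem_nhds _ (by have := he c (hCB.notMem_of_mem_left hc); linarith)
  obtain ⟨ρ, hρ, hρs⟩ : ∃ ρ > 0, ∀ c ∈ s, ρ ≤ e c / 2 := by
    have : ∀ᶠ ρ : ℝ in 𝓝[>] 0, ∀ c ∈ s, ρ ≤ e c / 2 := by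
      rw [Finset.eventually_all]
      intro c hc
      have h0 := he c (hCB.notMem_of_mem_left (hsC c hc))
      exact nhdsWithin_le_nhds (Iic_mem_nhds (by linarith))
    obtain ⟨ρ, h1, h2⟩ := (this.and self_mem_nhdsWithin).exists
    exact ⟨ρ, h2, h1⟩
  obtain ⟨θ, Φ, hθc, hθ, hθ1, hΦc, hΦ⟩ := trans_list hφ ρ (s.toList.map fun c => (c, e c)) (by
    intro x hx
    obtain ⟨c, hc, rfl⟩ := List.mem_map.1 hx
    have hc' := Finset.mem_toList.1 hc
    have hcB := hCB.notMem_of_mem_left (hsC c hc')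
    exact ⟨he c hcB, hρs c hc', Ψ c hcB, hΨc c hcB, hΨ c hcB⟩)
  refine ⟨ρ, hρ, Φ, hΦc, fun c y hc => ⟨fun hy => ?_, (hΦ c y hc).2⟩⟩
  rw [(hΦ c y hc).1]
  obtain ⟨c1, hc1, hb⟩ := Set.mem_iUnion₂.1 (hs hy)
  rw [hθ1 (c1, e c1) (List.mem_map.2 ⟨c1, Finset.mem_toList.2 hc1, rfl⟩) _ (mem_ball_iff_norm.1 hb)]
  simp

/-- Homotopy lifting. -/
theorem Trans.hlp (hT : Trans φ B) (hφ : Continuous φ) {C : Set ℂ} (hC : IsCompact C) (hCB : Disjoint C B)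
    {K : Type} [TopologicalSpace K] [CompactSpace K] (f : C(K, Y)) (h : C(K × I, ℂ))
    (h0 : ∀ k, h (k, 0) = φ (f k)) (hh : ∀ k, (∀ t, h (k, t) = φ (f k)) ∨ ∀ t, h (k, t) ∈ C) :
    ∃ H : C(K × I, Y), (∀ k t, φ (H (k, t)) = h (k, t)) ∧ (∀ k, H (k, 0) = f k) ∧
      ∀ k, (∀ t, h (k, t) = φ (f k)) → ∀ t, H (k, t) = f k := by
  obtain ⟨ρ, hρ, Φ, hΦc, hΦ⟩ := hT.compact hφ hC hCB
  -- uniform continuity in time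
  obtain ⟨δ, hδ, hδ'⟩ : ∃ δ > 0, ∀ k, ∀ t t' : I, |(t : ℝ) - t'| < δ → ‖h (k, t) - h (k, t')‖ < ρ := by
    have hcur : Continuous fun t : I => (⟨fun k => h (k, t), by fun_prop⟩ : C(K, ℂ)) :=
      ContinuousMap.continuous_of_continuous_uncurry _ (by
        show Continuous fun x : I × K => h (x.2, x.1)
        fun_prop)
    have huc := CompactSpace.uniformContinuous_of_continuous hcur
    obtain ⟨δ, hδ, hd⟩ := Metric.uniformContinuous_iff.1 huc ρ hρ
    refine ⟨δ, hδ, fun k t t' htt => ?_⟩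
    have := hd (a := t) (b := t') htt
    rw [← dist_eq_norm]
    exact (ContinuousMap.dist_apply_le_dist k).trans_lt this
  obtain ⟨N, hN⟩ := exists_nat_gt (1 / δ)
  have hN0 : 0 < (N : ℝ) := lt_trans (by positivity) hN
  let mn : ℕ → I → I := fun n t => ⟨min t (n / N), le_min t.2.1 (by positivity), (min_le_left _ _).trans t.2.2⟩
  have hmn : ∀ n, Continuous (mn n) := fun n => 
    Continuous.subtype_mk (by fun_prop) _
  have key : ∀ n : ℕ, ∃ H : C(K × I, Y), (∀ k t, φ (H (k, t)) = h (k, mn n t)) ∧ (∀ k, H (k, 0) = f k) ∧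
      ∀ k, (∀ t, h (k, t) = φ (f k)) → ∀ t, H (k, t) = f k := by
    intro n
    induction n with
    | zero => 
      refine ⟨f.comp ⟨Prod.fst, continuous_fst⟩, fun k t => ?_, fun k => rfl, fun k _ t => rfl⟩
      have : mn 0 t = 0 := by
        apply Subtype.ext
        simp [mn, t.2.1]
      rw [this, h0]; rfl
    | succ n ih =>
      obtain ⟨H, h1, h2, h3⟩ := ih
      have hst : ∀ k t, ‖h (k, mn (n + 1) t) - φ (H (k, t))‖ < ρ := by
        intro k t
        rw [h1]
        apply hδ'
        have hd : (1 : ℝ) / N < δ := by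
          rw [div_lt_iff₀ hN0]
          rw [div_lt_iff₀ hδ] at hN
          linarith
        refine lt_of_le_of_lt ?_ hd
        simp only [mn]
        have hs : ((n + 1 : ℕ) : ℝ) / N = n / N + 1 / N := by push_cast; ring
        rw [hs]
        have h1N : (0 : ℝ) < 1 / N := by positivity
        generalize (n : ℝ) / N = a at *
        generalize (1 : ℝ) / N = b at *
        rw [abs_of_nonneg]
        · rcases le_total (t : ℝ) a with h | h
          · rw [min_eq_left h, min_eq_left (by linarith)]; linarith
          · rw [min_eq_right h]
            have := min_le_right (t : ℝ) (a + b)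
            linarith
        · have := min_le_min_left (t : ℝ) (show a ≤ a + b by linarith)
          linarith
      have hc : Continuous fun x : K × I => Φ (h (x.1, mn (n + 1) x.2)) (H x) := by
        refine hΦc.comp_continuous (f := fun x : K × I => (h (x.1, mn (n + 1) x.2), H x)) ?_ ?_
        · exact (h.continuous.comp (continuous_fst.prodMk ((hmn _).comp continuous_snd))).prodMk H.continuous
        · intro x; exact hst x.1 x.2
      refine ⟨⟨_, hc⟩, fun k t => ?_, fun k => ?_, fun k hk t => ?_⟩
      · show φ (Φ (h (k, mn (n + 1) t)) (H (k, t))) = _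
        rcases hh k with hk | hk
        · have : φ (H (k, t)) = h (k, mn (n + 1) t) := by rw [h1, hk, hk]
          rw [(hΦ _ _ (hst k t)).2 this, this]
        · exact (hΦ _ _ (hst k t)).1 (by rw [h1]; exact hk _)
      · show Φ (h (k, mn (n + 1) 0)) (H (k, 0)) = f k
        have e : mn (n + 1) 0 = 0 := by
          apply Subtype.ext
          simp only [mn]
          exact min_eq_left (by positivity)
        have e0 : φ (H (k, 0)) = h (k, mn (n + 1) 0) := by rw [e, h0, h2]
        rw [(hΦ _ _ (hst k 0)).2 e0, h2]
      · show Φ (h (k, mn (n + 1) t)) (H (k, t)) = f k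
        have e0 : φ (H (k, t)) = h (k, mn (n + 1) t) := by rw [hk, h3 k hk]
        rw [(hΦ _ _ (hst k t)).2 e0, h3 k hk]
  obtain ⟨H, h1, h2, h3⟩ := key N
  refine ⟨H, fun k t => ?_, h2, h3⟩
  rw [h1]
  congr 2
  apply Subtype.ext
  simp only [mn]
  rw [div_self hN0.ne']
  exact min_eq_left t.2.2

end HLP
end Oka

namespace Oka
open Filter Topology unitInterval CategoryTheory

section paths
variable {X Z : Type} [TopologicalSpace X] [TopologicalSpace Z]

/-- the class of a path as a morphism of the fundamental groupoid -/
def cl {x y : X} (γ : Path x y) : FundamentalGroupoid.mk x ⟶ FundamentalGroupoid.mk y :=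
  Path.Homotopic.Quotient.mk γ

theorem cl_eq {x y : X} {γ γ' : Path x y} : cl γ = cl γ' ↔ γ.Homotopic γ' := Path.Homotopic.Quotient.eq
theorem cl_trans {x y z : X} (γ : Path x y) (γ' : Path y z) : cl (γ.trans γ') = cl γ ≫ cl γ' := rfl
theorem cl_refl (x : X) : cl (Path.refl x) = 𝟙 _ := rfl
theorem cl_symm {x y : X} (γ : Path x y) : cl γ.symm = inv (cl γ) := by
  rw [← Groupoid.inv_eq_inv]; rfl
theorem exists_cl {x y : X} (f : FundamentalGroupoid.mk x ⟶ FundamentalGroupoid.mk y) : ∃ γ : Path x y, cl γ = f :=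
  Path.Homotopic.Quotient.mk_surjective f
theorem cl_congr {x y x' y' : X} (γ : Path x y) (γ' : Path x' y') (hx : x' = x) (hy : y' = y) 
    (h : ∀ t, γ t = γ' t) : 
    cl γ' = eqToHom (by rw [hx]) ≫ cl γ ≫ eqToHom (by rw [hy]) := by
  subst hx hy
  have : γ = γ' := by ext t; exact h t
  subst this
  simp

end paths

/-- Abstract van Kampen data. -/
structure VK (p : ℕ) [NeZero p] (ι : Type) (W U : Type) [TopologicalSpace W] [TopologicalSpace U] where
  P : W → U
  cov : IsCoveringMap P
  surj : Function.Surjective P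
  rot : ZMod p → W → W
  rot_cont : ∀ a, Continuous (rot a)
  rot_zero : ∀ y, rot 0 y = y
  rot_add : ∀ a b y, rot (a + b) y = rot a (rot b y)
  rot_free : ∀ a y, rot a y = y → a = 0
  P_eq : ∀ y y', P y = P y' ↔ ∃ a, y' = rot a y
  W0 : Set W
  isOpen_W0 : IsOpen W0
  W0_rot : ∀ a, ∀ y ∈ W0, rot a y ∈ W0
  W0_conn : ∀ u ∈ W0, ∀ v ∈ W0, ∃ γ : Path u v, ∀ t, γ t ∈ W0
  W0_sc : ∀ u v, ∀ γ γ' : Path u v, (∀ t, γ t ∈ W0) → (∀ t, γ' t ∈ W0) → γ.Homotopic γ'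
  y0 : W
  hy0 : y0 ∈ W0
  N : ι → ZMod p → Set W
  Np : ι → ZMod p → Set W
  Nm : ι → ZMod p → Set W
  isOpen_N : ∀ i k, IsOpen (N i k)
  isOpen_Np : ∀ i k, IsOpen (Np i k)
  isOpen_Nm : ∀ i k, IsOpen (Nm i k)
  N_rot : ∀ a i k, ∀ y ∈ N i k, rot a y ∈ N i (k + a)
  Np_rot : ∀ a i k, ∀ y ∈ Np i k, rot a y ∈ Np i (k + a)
  Nm_rot : ∀ a i k, ∀ y ∈ Nm i k, rot a y ∈ Nm i (k + a)
  cover : ∀ y, y ∈ W0 ∨ ∃ i k, y ∈ N i k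
  disj : ∀ i k i' k' y, y ∈ N i k → y ∈ N i' k' → i = i' ∧ k = k'
  N_W0 : ∀ i k y, y ∈ N i k → y ∈ W0 → y ∈ Np i k ∨ y ∈ Nm i k
  Np_sub : ∀ i k y, y ∈ Np i k → y ∈ W0 ∧ y ∈ N i k
  Nm_sub : ∀ i k y, y ∈ Nm i k → y ∈ W0 ∧ y ∈ N i k
  Npm : ∀ i k y, y ∈ Np i k → y ∉ Nm i k
  Np_ne : ∀ i k, (Np i k).Nonempty
  Nm_ne : ∀ i k, (Nm i k).Nonempty
  N_conn : ∀ i k, ∀ u ∈ N i k, ∀ v ∈ N i k, ∃ γ : Path u v, ∀ t, γ t ∈ N i k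
  hol_p : ∀ i k u v, ∀ δ : Path u v, u ∈ Np i k → v ∈ Np i k → (∀ t, δ t ∈ N i k) → 
    ∃ δ' : Path u v, (∀ t, δ' t ∈ W0) ∧ δ.Homotopic δ'
  hol_m : ∀ i k u v, ∀ δ : Path u v, u ∈ Nm i k → v ∈ Nm i k → (∀ t, δ t ∈ N i k) → 
    ∃ δ' : Path u v, (∀ t, δ' t ∈ W0) ∧ δ.Homotopic δ'

namespace VK
variable {p : ℕ} [NeZero p] {ι : Type} {W U : Type} [TopologicalSpace W] [TopologicalSpace U] (S : VK p ι W U)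

theorem P_rot (a y) : S.P (S.rot a y) = S.P y := ((S.P_eq _ _).2 ⟨a, rfl⟩).symm

/-- connecting paths -/
theorem exists_cp (y : W) : ∃ γ : Path S.y0 y, (y ∈ S.W0 → ∀ t, γ t ∈ S.W0) ∧
    (y ∉ S.W0 → ∃ i k, ∃ u ∈ S.Np i k, ∃ a : Path S.y0 u, ∃ b : Path u y, γ = a.trans b ∧ (∀ t, a t ∈ S.W0) ∧ 
      ∀ t, b t ∈ S.N i k) := by
  by_cases hy : y ∈ S.W0
  · obtain ⟨γ, hγ⟩ := S.W0_conn _ S.hy0 y hy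
    exact ⟨γ, fun _ => hγ, fun h => absurd hy h⟩
  · obtain ⟨i, k, hik⟩ := (S.cover y).resolve_left hy
    obtain ⟨u, hu⟩ := S.Np_ne i k
    obtain ⟨a, ha⟩ := S.W0_conn _ S.hy0 u (S.Np_sub i k u hu).1
    obtain ⟨b, hb⟩ := S.N_conn i k u (S.Np_sub i k u hu).2 y hik
    exact ⟨a.trans b, fun h => absurd h hy, fun _ => ⟨i, k, u, hu, a, b, rfl, ha, hb⟩⟩

def cp (y : W) : Path S.y0 y := (S.exists_cp y).choose
theorem cp_W0 {y : W} (hy : y ∈ S.W0) (t) : S.cp y t ∈ S.W0 := (S.exists_cp y).choose_spec.1 hy t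

abbrev x0 : U := S.P S.y0

/-- image of a path -/
def im {u v : W} (γ : Path u v) : Path (S.P u) (S.P v) := γ.map S.cov.continuous

theorem im_hom {u v : W} {γ γ' : Path u v} (h : γ.Homotopic γ') : cl (S.im γ) = cl (S.im γ') :=
  cl_eq.2 (h.map ⟨S.P, S.cov.continuous⟩)

theorem im_trans {u v w : W} (γ : Path u v) (γ' : Path v w) : cl (S.im (γ.trans γ')) = cl (S.im γ) ≫ cl (S.im γ') := by
  rw [← cl_trans]
  congr 1
  exact Path.map_trans _ _ _

theorem im_symm {u v : W} (γ : Path u v) : cl (S.im γ.symm) = inv (cl (S.im γ)) := by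
  rw [← cl_symm]
  congr 1

def A (y : W) : FundamentalGroupoid.mk S.x0 ⟶ FundamentalGroupoid.mk (S.P y) := cl (S.im (S.cp y))

theorem A_eq {y : W} (γ : Path S.y0 y) (h : ∀ t, γ t ∈ S.W0) : S.A y = cl (S.im γ) :=
  S.im_hom (S.W0_sc _ _ _ _ (S.cp_W0 (by simpa using h 1)) h)

/-- the holonomy of a path -/
def hl {u v : W} (δ : Path u v) : FundamentalGroup U S.x0 := S.A u ≫ cl (S.im δ) ≫ inv (S.A v)

theorem hl_trans {u v w : W} (δ : Path u v) (δ' : Path v w) : S.hl (δ.trans δ') = S.hl δ' * S.hl δ := by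
  show _ = S.hl δ ≫ S.hl δ'
  simp [hl, im_trans]

theorem hl_hom {u v : W} {γ γ' : Path u v} (h : γ.Homotopic γ') : S.hl γ = S.hl γ' := by
  rw [hl, hl, S.im_hom h]

theorem hl_W0 {u v : W} (δ : Path u v) (h : ∀ t, δ t ∈ S.W0) : S.hl δ = 1 := by
  have hu : u ∈ S.W0 := by simpa using h 0
  have : S.A v = S.A u ≫ cl (S.im δ) := by
    rw [S.A_eq ((S.cp u).trans δ), im_trans]
    · rfl
    intro t
    rw [Path.trans_apply]
    split_ifs
    · exact S.cp_W0 hu _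
    · exact h _
  rw [hl, ← Category.assoc, ← this]
  exact IsIso.hom_inv_id _

theorem hl_symm {u v : W} (δ : Path u v) : S.hl δ.symm = (S.hl δ)⁻¹ := by
  rw [eq_inv_iff_mul_eq_one]
  show S.hl δ ≫ S.hl δ.symm = 𝟙 _
  simp [hl, im_symm]

/-- the loop attached to a rotation -/
def Tl (a : ZMod p) : FundamentalGroup U S.x0 :=
  S.A (S.rot a S.y0) ≫ eqToHom (by rw [S.P_rot])

def rp (a : ZMod p) {u v : W} (γ : Path u v) : Path (S.rot a u) (S.rot a v) := γ.map (S.rot_cont a)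

theorem im_rp (a : ZMod p) {u v : W} (γ : Path u v) : cl (S.im (S.rp a γ)) = 
    eqToHom (by rw [S.P_rot]) ≫ cl (S.im γ) ≫ eqToHom (by rw [S.P_rot]) := 
  cl_congr _ _ (S.P_rot _ _) (S.P_rot _ _) fun t => (S.P_rot _ _).symm

theorem A_rot (a : ZMod p) {u : W} (hu : u ∈ S.W0) : S.A (S.rot a u) = S.Tl a ≫ S.A u ≫ eqToHom (by rw [S.P_rot]) := by
  rw [S.A_eq ((S.cp (S.rot a S.y0)).trans (S.rp a (S.cp u))), im_trans, im_rp]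
  · simp [Tl, A]
  · intro t
    rw [Path.trans_apply]
    split_ifs
    · exact S.cp_W0 (S.W0_rot _ _ S.hy0) _
    · exact S.W0_rot _ _ (S.cp_W0 hu _)

theorem A_y0 : S.A S.y0 = 𝟙 _ := by
  rw [S.A_eq (Path.refl _) (fun t => S.hy0)]
  exact cl_refl _

theorem Tl_add (a b : ZMod p) : S.Tl (a + b) = S.Tl b * S.Tl a := by
  show S.Tl (a + b) = S.Tl a ≫ S.Tl b
  have h := S.A_rot a (S.W0_rot b _ S.hy0)
  have e : S.A (S.rot (a + b) S.y0) = S.A (S.rot a (S.rot b S.y0)) ≫ eqToHom (by rw [S.rot_add]) := by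
    have : ∀ y y', y' = y → ∀ h, S.A y' = S.A y ≫ eqToHom h := by
      rintro y _ rfl h
      simp
    exact this _ _ (S.rot_add _ _ _) _
  rw [Tl, e, h]
  simp [Tl]

theorem Tl_zero : S.Tl 0 = 1 := by
  have := S.Tl_add 0 0
  rw [add_zero] at this
  exact mul_eq_left.1 this.symm

theorem hl_rp (a : ZMod p) {u v : W} (γ : Path u v) (hu : u ∈ S.W0) (hv : v ∈ S.W0) : 
    S.hl (S.rp a γ) = (S.Tl a)⁻¹ * S.hl γ * S.Tl a := by
  rw [mul_assoc, eq_inv_mul_iff_mul_eq]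
  show S.hl (S.rp a γ) ≫ S.Tl a = S.Tl a ≫ S.hl γ
  have h1 := S.A_rot a hv
  have h2 : S.hl (S.rp a γ) ≫ S.A (S.rot a v) = S.A (S.rot a u) ≫ cl (S.im (S.rp a γ)) := by
    simp [hl]
  rw [h1, S.A_rot a hu, im_rp] at h2
  have h3 : (S.hl (S.rp a γ) ≫ S.Tl a) ≫ S.A v = (S.Tl a ≫ S.hl γ) ≫ S.A v := by
    have := congrArg (fun f => f ≫ eqToHom (by rw [S.P_rot] : FundamentalGroupoid.mk (S.P (S.rot a v)) = FundamentalGroupoid.mk (S.P v))) h2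
    simp at this
    have e : S.hl γ ≫ S.A v = S.A u ≫ cl (S.im γ) := by simp [hl]
    rw [Category.assoc, Category.assoc, e]
    exact this
  exact (cancel_mono _).1 h3

end VK
end Oka

namespace Oka
open Filter Topology unitInterval CategoryTheory
namespace VK
variable {p : ℕ} [NeZero p] {ι : Type} {W U : Type} [TopologicalSpace W] [TopologicalSpace U] (S : VK p ι W U)

theorem exists_del (i : ι) : ∃ (u v : W) (δ : Path u v), u ∈ S.Np i 0 ∧ v ∈ S.Nm i 0 ∧ ∀ t, δ t ∈ S.N i 0 := by
  obtain ⟨u, hu⟩ := S.Np_ne i 0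
  obtain ⟨v, hv⟩ := S.Nm_ne i 0
  obtain ⟨δ, h⟩ := S.N_conn i 0 u (S.Np_sub i 0 u hu).2 v (S.Nm_sub i 0 v hv).2
  exact ⟨u, v, δ, hu, hv, h⟩

def du (i : ι) : W := (S.exists_del i).choose
def dv (i : ι) : W := (S.exists_del i).choose_spec.choose
def del (i : ι) : Path (S.du i) (S.dv i) := (S.exists_del i).choose_spec.choose_spec.choose
theorem du_mem (i : ι) : S.du i ∈ S.Np i 0 := (S.exists_del i).choose_spec.choose_spec.choose_spec.1
theorem dv_mem (i : ι) : S.dv i ∈ S.Nm i 0 := (S.exists_del i).choose_spec.choose_spec.choose_spec.2.1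
theorem del_mem (i : ι) (t) : S.del i t ∈ S.N i 0 := (S.exists_del i).choose_spec.choose_spec.choose_spec.2.2 t

/-- the meridian-type generators -/
def F (i : ι) : FundamentalGroup U S.x0 := S.hl (S.del i)

theorem hl_Np {i k u v} (δ : Path u v) (hu : u ∈ S.Np i k) (hv : v ∈ S.Np i k) (h : ∀ t, δ t ∈ S.N i k) : 
    S.hl δ = 1 := by
  obtain ⟨δ', h', hh⟩ := S.hol_p i k u v δ hu hv h
  rw [S.hl_hom hh, S.hl_W0 _ h']

theorem hl_Nm {i k u v} (δ : Path u v) (hu : u ∈ S.Nm i k) (hv : v ∈ S.Nm i k) (h : ∀ t, δ t ∈ S.N i k) : 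
    S.hl δ = 1 := by
  obtain ⟨δ', h', hh⟩ := S.hol_m i k u v δ hu hv h
  rw [S.hl_hom hh, S.hl_W0 _ h']

theorem _root_.Oka.trans_mem {u v w : W} {s : Set W} {γ : Path u v} {γ' : Path v w} (h : ∀ t, γ t ∈ s) (h' : ∀ t, γ' t ∈ s) (t) :
    γ.trans γ' t ∈ s := by
  rw [Path.trans_apply]
  split_ifs
  · exact h _
  · exact h' _

theorem _root_.Oka.symm_mem {u v : W} {s : Set W} {γ : Path u v} (h : ∀ t, γ t ∈ s) (t) :
    γ.symm t ∈ s := h _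

theorem hl_pm {i k u v} (δ : Path u v) (hu : u ∈ S.Np i k) (hv : v ∈ S.Nm i k) (h : ∀ t, δ t ∈ S.N i k) : 
    S.hl δ = (S.Tl k)⁻¹ * S.F i * S.Tl k := by
  have h1 : S.rot k (S.du i) ∈ S.Np i k := by simpa using S.Np_rot k i 0 _ (S.du_mem i)
  have h2 : S.rot k (S.dv i) ∈ S.Nm i k := by simpa using S.Nm_rot k i 0 _ (S.dv_mem i)
  have h3 : ∀ t, S.rp k (S.del i) t ∈ S.N i k := fun t => by
    have := S.N_rot k i 0 _ (S.del_mem i t)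
    rw [zero_add] at this
    exact this
  obtain ⟨τ, hτ⟩ := S.N_conn i k u (S.Np_sub _ _ _ hu).2 _ (S.Np_sub _ _ _ h1).2
  obtain ⟨τ', hτ'⟩ := S.N_conn i k _ (S.Nm_sub _ _ _ h2).2 v (S.Nm_sub _ _ _ hv).2
  have h4 := S.hl_Np (δ.trans ((τ.trans (S.rp k (S.del i))).trans τ').symm) hu hu 
    (trans_mem h (symm_mem (trans_mem (trans_mem hτ h3) hτ')))
  rw [hl_trans, hl_symm, hl_trans, hl_trans, S.hl_Np τ hu h1 hτ, S.hl_Nm τ' h2 hv hτ', inv_mul_eq_one] at h4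
  rw [← h4, one_mul, mul_one, F, S.hl_rp]
  · exact (S.Np_sub _ _ _ (S.du_mem i)).1
  · exact (S.Nm_sub _ _ _ (S.dv_mem i)).1

theorem exists_n {H : Subgroup (FundamentalGroup U S.x0)} (hT : ∀ a, S.Tl a ∈ H) (hF : ∀ i, S.F i ∈ H) {i k y} 
    (hy : y ∈ S.N i k) : ∃ u ∈ S.Np i k, ∃ n : Path u y, (∀ t, n t ∈ S.N i k) ∧ S.hl n ∈ H := by
  by_cases h0 : y ∈ S.W0
  · rcases S.N_W0 i k y hy h0 with h | h
    · refine ⟨y, h, Path.refl y, fun _ => hy, ?_⟩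
      rw [S.hl_W0]
      · exact H.one_mem
      · exact fun _ => h0
    · obtain ⟨u, hu⟩ := S.Np_ne i k
      obtain ⟨δ, hδ⟩ := S.N_conn i k u (S.Np_sub _ _ _ hu).2 y hy
      refine ⟨u, hu, δ, hδ, ?_⟩
      rw [S.hl_pm δ hu h hδ]
      exact H.mul_mem (H.mul_mem (H.inv_mem (hT _)) (hF _)) (hT _)
  · obtain ⟨i', k', u, hu, a, b, hab, ha, hb⟩ := (S.exists_cp y).choose_spec.2 h0
    obtain ⟨rfl, rfl⟩ := S.disj i k i' k' y hy (by simpa using hb 1)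
    refine ⟨u, hu, b, hb, ?_⟩
    have : S.A y = S.A u ≫ cl (S.im b) := by
      rw [S.A_eq a ha, A, cp, hab]
      exact S.im_trans a b
    have h1 : S.hl b = 1 := by
      rw [hl, ← Category.assoc, ← this]
      exact IsIso.hom_inv_id _
    rw [h1]
    exact H.one_mem

theorem hl_N {H : Subgroup (FundamentalGroup U S.x0)} (hT : ∀ a, S.Tl a ∈ H) (hF : ∀ i, S.F i ∈ H) {i k u v} 
    (δ : Path u v) (h : ∀ t, δ t ∈ S.N i k) : S.hl δ ∈ H := by
  obtain ⟨u', hu', n, hn, hnH⟩ := S.exists_n hT hF (by simpa using h 0)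
  obtain ⟨v', hv', m, hm, hmH⟩ := S.exists_n hT hF (by simpa using h 1)
  have := S.hl_Np ((n.trans δ).trans m.symm) hu' hv' (trans_mem (trans_mem hn h) (symm_mem hm))
  rw [hl_trans, hl_trans, hl_symm, inv_mul_eq_one, ← mul_inv_eq_iff_eq_mul] at this
  rw [← this]
  exact H.mul_mem hmH (H.inv_mem hnH)

theorem hl_mem {H : Subgroup (FundamentalGroup U S.x0)} (hT : ∀ a, S.Tl a ∈ H) (hF : ∀ i, S.F i ∈ H) {u v} 
    (δ : Path u v) : S.hl δ ∈ H := by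
  have hloc : IsLocallyConstant (fun t : I => S.hl (δ.subpath 0 t) ∈ H) := by
    rw [IsLocallyConstant.iff_eventually_eq]
    intro t
    have : ∃ O : Set W, IsOpen O ∧ δ t ∈ O ∧ ∀ x y, ∀ γ : Path x y, (∀ s, γ s ∈ O) → S.hl γ ∈ H := by
      rcases S.cover (δ t) with h | ⟨i, k, h⟩
      · refine ⟨S.W0, S.isOpen_W0, h, fun x y γ hγ => ?_⟩
        rw [S.hl_W0 _ hγ]; exact H.one_mem
      · exact ⟨S.N i k, S.isOpen_N i k, h, fun x y γ hγ => S.hl_N hT hF _ hγ⟩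
    obtain ⟨O, hO, htO, hOH⟩ := this
    obtain ⟨s, hs, hs'⟩ := Metric.mem_nhds_iff.1 ((hO.preimage δ.continuous).mem_nhds htO)
    filter_upwards [Metric.ball_mem_nhds t hs] with t' ht'
    have h1 : S.hl (δ.subpath t t') ∈ H := by
      apply hOH
      intro r
      have : δ.subpath t t' r ∈ Set.range (δ.subpath t t') := ⟨r, rfl⟩
      rw [Path.range_subpath] at this
      obtain ⟨r', hr', e⟩ := this
      rw [← e]
      apply hs'
      have h3 : (r' : ℝ) ∈ Set.uIcc (t : ℝ) t' := by
        rw [Set.mem_uIcc] at hr' ⊢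
        exact hr'
      have h4 := Set.abs_sub_left_of_mem_uIcc h3
      rw [Metric.mem_ball, Subtype.dist_eq, Real.dist_eq] at ht' ⊢
      exact lt_of_le_of_lt h4 ht'
    have h2 : S.hl (δ.subpath 0 t') = S.hl (δ.subpath t t') * S.hl (δ.subpath 0 t) := by
      rw [← hl_trans]
      exact (S.hl_hom ⟨Path.Homotopy.subpathTransSubpath δ 0 t t'⟩).symm
    rw [h2]
    exact propext (H.mul_mem_cancel_left h1)
  have := hloc.apply_eq_of_preconnectedSpace 1 0
  simp only [Path.subpath_self] at this
  have h1 : S.hl (δ.subpath 0 1) ∈ H := by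
    rw [this]
    have h2 : S.hl (Path.refl (δ 0)) = 1 := by
      have h3 : cl (S.im (Path.refl (δ 0))) = 𝟙 _ := cl_refl _
      rw [hl, h3, Category.id_comp]
      exact IsIso.hom_inv_id _
    rw [h2]
    exact H.one_mem
  rw [Path.subpath_zero_one] at h1
  have : ∀ {u' v'} (hu : u' = u) (hv : v' = v), S.hl (δ.cast hu hv) = S.hl δ := by
    rintro _ _ rfl rfl
    rfl
  rwa [this] at h1

theorem gen {H : Subgroup (FundamentalGroup U S.x0)} (hT : ∀ a, S.Tl a ∈ H) (hF : ∀ i, S.F i ∈ H) : H = ⊤ := by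
  rw [eq_top_iff]
  intro g _
  obtain ⟨γ, rfl⟩ := exists_cl g
  have hs : γ.toContinuousMap 0 = S.P S.y0 := γ.source
  set L := S.cov.liftPath γ.toContinuousMap S.y0 hs with hL
  have hl0 : L 0 = S.y0 := S.cov.liftPath_zero _ _ hs
  have hl1 : ∀ t, S.P (L t) = γ t := fun t => congrFun (S.cov.liftPath_lifts _ _ hs) t
  obtain ⟨a, ha⟩ := (S.P_eq S.y0 (L 1)).1 (by rw [hl1, γ.target])
  let δ : Path S.y0 (S.rot a S.y0) := ⟨L, hl0, ha⟩
  have e : cl γ = S.hl δ ≫ S.Tl a := by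
    have := cl_congr (S.im δ) γ rfl ((S.P_rot a S.y0).symm) hl1
    rw [this, hl, S.A_y0, Tl]
    simp
  show cl γ ∈ H
  rw [e]
  exact H.mul_mem (hT a) (S.hl_mem hT hF δ)

end VK
end Oka

namespace Oka
open Filter Topology unitInterval CategoryTheory

/-- A locally constant cocycle which is split by a discontinuous cochain. -/
structure Coc (Ix : Type) (U : Type) [TopologicalSpace U] (G : Type) [Group G] where
  bs : Ix → Set U
  isOpen_bs : ∀ i, IsOpen (bs i)
  at' : U → Ix
  mem_at : ∀ x, x ∈ bs (at' x)
  b : Ix → U → G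
  loc : ∀ i j x, x ∈ bs i → x ∈ bs j → ∀ᶠ x' in 𝓝 x, (b j x')⁻¹ * b i x' = (b j x)⁻¹ * b i x

namespace Coc
variable {Ix : Type} {U : Type} [TopologicalSpace U] {G : Type} [Group G] [TopologicalSpace G] [DiscreteTopology G] 
  (S : Coc Ix U G)

def core : FiberBundleCore Ix U G where
  baseSet := S.bs
  isOpen_baseSet := S.isOpen_bs
  indexAt := S.at'
  mem_baseSet_at := S.mem_at
  coordChange i j x g := (S.b j x)⁻¹ * S.b i x * g
  coordChange_self i x _ v := by simp
  continuousOn_coordChange i j := by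
    rintro ⟨x, g⟩ ⟨⟨hx, hx'⟩, -⟩
    apply ContinuousAt.continuousWithinAt
    have : (fun p : U × G => (S.b j p.1)⁻¹ * S.b i p.1 * p.2) =ᶠ[𝓝 (x, g)] fun p => (S.b j x)⁻¹ * S.b i x * p.2 := by
      filter_upwards [continuous_fst.continuousAt.eventually (S.loc i j x hx hx')] with p hp
      rw [hp]
    rw [continuousAt_congr this]
    exact (continuous_of_discreteTopology (f := fun h : G => (S.b j x)⁻¹ * S.b i x * h)).continuousAt.comp
      continuous_snd.continuousAt
  coordChange_comp i j k x _ v := by group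

abbrev E := S.core.TotalSpace
def pr : S.E → U := S.core.proj

theorem cov : IsCoveringMap S.pr :=
  IsFiberBundle.isCoveringMap (F := G) fun x => ⟨S.core.localTriv (S.at' x), S.mem_at x⟩

def em (x : U) (g : G) : S.E := ⟨x, (S.b (S.at' x) x)⁻¹ * g⟩
def sn (e : S.E) : G := e.2
def co (e : S.E) : G := S.b (S.at' (S.pr e)) (S.pr e) * S.sn e

theorem pr_mk (x g) : S.pr (S.em x g) = x := rfl
theorem co_mk (x g) : S.co (S.em x g) = g := by
  show S.b (S.at' x) x * ((S.b (S.at' x) x)⁻¹ * g) = g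
  group
theorem mk_co (e) : S.em (S.pr e) (S.co e) = e := by
  obtain ⟨x, g⟩ := e
  have : (S.b (S.at' x) x)⁻¹ * (S.b (S.at' x) x * (show G from g)) = g := inv_mul_cancel_left _ _
  exact congrArg (fun h : G => (⟨x, h⟩ : S.E)) this

theorem triv_mk (i x g) : S.core.localTriv i (S.em x g) = (x, (S.b i x)⁻¹ * g) := by
  rw [FiberBundleCore.localTriv_apply]
  show (x, (S.b i x)⁻¹ * S.b (S.at' x) x * ((S.b (S.at' x) x)⁻¹ * g)) = _
  congr 1
  group

variable {K : Type} [TopologicalSpace K]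

theorem continuousAt_mk_iff (γ : K → U) (hγ : Continuous γ) (c : K → G) (s : K) (i : Ix) (hi : γ s ∈ S.bs i) : 
    ContinuousAt (fun s => S.em (γ s) (c s)) s ↔ 
      ∀ᶠ s' in 𝓝 s, (S.b i (γ s'))⁻¹ * c s' = (S.b i (γ s))⁻¹ * c s := by
  rw [(S.core.localTriv i).toOpenPartialHomeomorph.continuousAt_iff_continuousAt_comp_left]
  · have : ((S.core.localTriv i).toOpenPartialHomeomorph ∘ fun s => S.em (γ s) (c s)) = fun s => (γ s, (S.b i (γ s))⁻¹ * c s) := by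
      funext s
      exact S.triv_mk i (γ s) (c s)
    rw [this, (show ContinuousAt (fun s => (γ s, (S.b i (γ s))⁻¹ * c s)) s ↔ ContinuousAt (fun s => (S.b i (γ s))⁻¹ * c s) s from
      ⟨fun h => h.snd, fun h => hγ.continuousAt.prodMk h⟩)]
    rw [ContinuousAt, nhds_discrete G, tendsto_pure]
  · exact hγ.continuousAt.preimage_mem_nhds ((S.isOpen_bs i).mem_nhds hi)

/-- transport -/
def T {x y : U} (f : FundamentalGroupoid.mk x ⟶ FundamentalGroupoid.mk y) : G :=
  S.co (S.cov.monodromy f ⟨S.em x 1, rfl⟩).1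

theorem mono_path {x y : U} (γ : Path x y) (c : I → G) (h : Continuous fun s => S.em (γ s) (c s)) : 
    (S.cov.monodromy (cl γ) ⟨S.em x (c 0), rfl⟩).1 = S.em y (c 1) := by
  show S.cov.liftPath γ.toContinuousMap (S.em x (c 0)) _ 1 = _
  have := S.cov.eq_liftPath_iff' (γ := γ.toContinuousMap) (e := S.em x (c 0)) (γ_0 := γ.source) 
    (Γ := ⟨fun s => S.em (γ s) (c s), h⟩)
  rw [← this.2 ⟨funext fun s => rfl, by simp⟩]
  simp

theorem mono_T {x y : U} (f : FundamentalGroupoid.mk x ⟶ FundamentalGroupoid.mk y) (g : G) : 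
    (S.cov.monodromy f ⟨S.em x g, rfl⟩).1 = S.em y (S.T f * g) := by
  obtain ⟨γ, rfl⟩ := exists_cl f
  set L := S.cov.liftPath γ.toContinuousMap (S.em x 1) γ.source with hL
  have hl1 : ∀ t, S.pr (L t) = γ t := fun t => congrFun (S.cov.liftPath_lifts _ _ _) t
  have hmk : ∀ s, S.em (γ s) (S.co (L s)) = L s := fun s => by rw [← hl1, S.mk_co]
  have h0 : S.co (L 0) = 1 := by
    have : L 0 = S.em x 1 := S.cov.liftPath_zero _ _ _
    rw [this, S.co_mk]
  have hc : Continuous fun s => S.em (γ s) (S.co (L s) * g) := by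
    rw [continuous_iff_continuousAt]
    intro s
    rw [S.continuousAt_mk_iff γ γ.continuous _ s _ (S.mem_at (γ s))]
    have h1 : ContinuousAt (fun s => S.em (γ s) (S.co (L s))) s := by
      simp_rw [hmk]
      exact L.continuous.continuousAt
    rw [S.continuousAt_mk_iff γ γ.continuous _ s _ (S.mem_at (γ s))] at h1
    filter_upwards [h1] with s' hs'
    rw [← mul_assoc, hs', mul_assoc]
  have := S.mono_path γ _ hc
  simp only [h0, one_mul] at this
  exact this

theorem T_path {x y : U} (γ : Path x y) (c : I → G) (h : ∀ s, ∃ i, γ s ∈ S.bs i ∧ 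
    ∀ᶠ s' in 𝓝 s, (S.b i (γ s'))⁻¹ * c s' = (S.b i (γ s))⁻¹ * c s) : S.T (cl γ) = c 1 * (c 0)⁻¹ := by
  have h1 := S.mono_T (cl γ) (c 0)
  rw [S.mono_path γ c] at h1
  · have := congrArg S.co h1
    rw [S.co_mk, S.co_mk] at this
    rw [this]; group
  · rw [continuous_iff_continuousAt]
    intro s
    obtain ⟨i, hi, h⟩ := h s
    rwa [S.continuousAt_mk_iff γ γ.continuous _ s i hi]

theorem T_comp {x y z : U} (f : FundamentalGroupoid.mk x ⟶ FundamentalGroupoid.mk y) 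
    (g : FundamentalGroupoid.mk y ⟶ FundamentalGroupoid.mk z) : S.T (f ≫ g) = S.T g * S.T f := by
  have h : (S.cov.monodromy (f ≫ g) ⟨S.em x 1, rfl⟩).1 = S.em z (S.T g * S.T f) := by
    show (S.cov.monodromy (Path.Homotopic.Quotient.trans f g) ⟨S.em x 1, rfl⟩).1 = _
    rw [S.cov.monodromy_trans_apply]
    have : S.cov.monodromy f ⟨S.em x 1, rfl⟩ = ⟨S.em y (S.T f), rfl⟩ := by
      apply Subtype.ext
      have := S.mono_T f 1
      rwa [mul_one] at this
    rw [this, S.mono_T]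
  rw [T, h, S.co_mk]

theorem T_eqToHom {x y : U} (h : x = y) (h' : FundamentalGroupoid.mk x = FundamentalGroupoid.mk y) : S.T (eqToHom h') = 1 := by
  subst h
  have := S.T_comp (𝟙 (FundamentalGroupoid.mk x)) (𝟙 _)
  rw [Category.comp_id] at this
  exact mul_eq_left.1 this.symm

theorem T_inv {x y : U} (f : FundamentalGroupoid.mk x ⟶ FundamentalGroupoid.mk y) : S.T (inv f) = (S.T f)⁻¹ := by
  rw [eq_inv_iff_mul_eq_one, ← T_comp, IsIso.hom_inv_id]
  exact S.T_eqToHom rfl rfl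

end Coc
end Oka

namespace Oka
open Filter Topology unitInterval CategoryTheory
namespace VK
variable {p : ℕ} [NeZero p] {ι : Type} {W U : Type} [TopologicalSpace W] [TopologicalSpace U] (S : VK p ι W U)
variable {G : Type} [Group G] (t : ZMod p → G) (f : ι → G)

def reg : Option (ι × ZMod p) → Set W
  | none => S.W0
  | some (i, k) => S.N i k

theorem isOpen_reg (τ) : IsOpen (S.reg τ) := by
  rcases τ with _ | ⟨i, k⟩
  · exact S.isOpen_W0
  · exact S.isOpen_N i k

theorem rot_neg (d y) : S.rot (-d) (S.rot d y) = y := by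
  rw [← S.rot_add, neg_add_cancel, S.rot_zero]

theorem rot_inj (a b y) (h : S.rot a y = S.rot b y) : a = b := by
  have := S.rot_free (-b + a) y (by rw [S.rot_add, h, S.rot_neg])
  rw [neg_add_eq_zero] at this
  exact this.symm

def J0 (y : W) : ZMod p := ((S.P_eq _ y).1 (Function.surjInv_eq S.surj (S.P y))).choose
theorem J0_spec (y : W) : y = S.rot (S.J0 y) (Function.surjInv S.surj (S.P y)) :=
  ((S.P_eq _ y).1 (Function.surjInv_eq S.surj (S.P y))).choose_spec
theorem J0_rot (a y) : S.J0 (S.rot a y) = a + S.J0 y := by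
  apply S.rot_inj _ _ (Function.surjInv S.surj (S.P y))
  rw [S.rot_add, ← S.J0_spec]
  conv_rhs => rw [S.J0_spec (S.rot a y), S.P_rot]

def J (y : W) : ZMod p := S.J0 y - S.J0 S.y0
theorem J_rot (a y) : S.J (S.rot a y) = a + S.J y := by
  rw [J, J, J0_rot]; ring
theorem J_y0 : S.J S.y0 = 0 := sub_self _

open Classical in
def kap (τ : Option (ι × ZMod p)) (y : W) : G := 
  match τ with
  | none => 1
  | some (i, k) => if y ∈ S.Np i k then ((t k)⁻¹ * f i * t k)⁻¹ else 1

theorem kap_p {i k y} (h : y ∈ S.Np i k) : S.kap t f (some (i, k)) y = ((t k)⁻¹ * f i * t k)⁻¹ := if_pos h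
theorem kap_m {i k y} (h : y ∉ S.Np i k) : S.kap t f (some (i, k)) y = 1 := if_neg h

theorem exists_Q (ht : ∀ a b, t (a + b) = t a * t b) (τ τ' : Option (ι × ZMod p)) (d : ZMod p) (y : W) (h : y ∈ S.reg τ) (h' : S.rot d y ∈ S.reg τ') : 
    ∃ Q : Set W, IsOpen Q ∧ y ∈ Q ∧ ∃ g : G, ∀ y1 ∈ Q, y1 ∈ S.reg τ → S.rot d y1 ∈ S.reg τ' → 
      (S.kap t f τ' (S.rot d y1))⁻¹ * (t d)⁻¹ * S.kap t f τ y1 = g := by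
  rcases τ with _ | ⟨i, k⟩ <;> rcases τ' with _ | ⟨i', k'⟩
  · exact ⟨Set.univ, isOpen_univ, trivial, 1 * (t d)⁻¹ * 1, fun y1 _ _ _ => by simp [kap]⟩
  · rcases S.N_W0 i' k' _ h' (S.W0_rot d y h) with hp | hm
    · refine ⟨S.rot d ⁻¹' S.Np i' k', (S.isOpen_Np i' k').preimage (S.rot_cont d), hp, (S.kap t f (some (i', k')) (S.rot d y))⁻¹ * (t d)⁻¹ * S.kap t f none y, fun y1 h1 _ _ => ?_⟩
      rw [S.kap_p t f h1, S.kap_p t f hp]; rfl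
    · refine ⟨S.rot d ⁻¹' S.Nm i' k', (S.isOpen_Nm i' k').preimage (S.rot_cont d), hm, (S.kap t f (some (i', k')) (S.rot d y))⁻¹ * (t d)⁻¹ * S.kap t f none y, fun y1 h1 _ _ => ?_⟩
      rw [S.kap_m t f (fun hp => S.Npm _ _ _ hp h1), S.kap_m t f (fun hp => S.Npm _ _ _ hp hm)]; rfl
  · have h0 : y ∈ S.W0 := by simpa [S.rot_neg] using S.W0_rot (-d) _ h'
    rcases S.N_W0 i k _ h h0 with hp | hm
    · refine ⟨S.Np i k, S.isOpen_Np i k, hp, (S.kap t f none (S.rot d y))⁻¹ * (t d)⁻¹ * S.kap t f (some (i, k)) y, fun y1 h1 _ _ => ?_⟩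
      rw [S.kap_p t f h1, S.kap_p t f hp]; rfl
    · refine ⟨S.Nm i k, S.isOpen_Nm i k, hm, (S.kap t f none (S.rot d y))⁻¹ * (t d)⁻¹ * S.kap t f (some (i, k)) y, fun y1 h1 _ _ => ?_⟩
      rw [S.kap_m t f (fun hp => S.Npm _ _ _ hp h1), S.kap_m t f (fun hp => S.Npm _ _ _ hp hm)]; rfl
  · refine ⟨Set.univ, isOpen_univ, trivial, (t d)⁻¹, fun y1 _ h1 h1' => ?_⟩
    obtain ⟨rfl, rfl⟩ := S.disj i' k' i (k + d) _ h1' (S.N_rot d i k y1 h1)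
    by_cases hp : y1 ∈ S.Np i' k
    · rw [S.kap_p t f hp, S.kap_p t f (S.Np_rot d _ _ _ hp), ht]
      group
    · have hp' : S.rot d y1 ∉ S.Np i' (k + d) := by
        intro h2
        have := S.Np_rot (-d) _ _ _ h2
        rw [S.rot_neg, add_neg_cancel_right] at this
        exact hp this
      rw [S.kap_m t f hp, S.kap_m t f hp']
      group

def Ixx : Type := {x : Set W × Option (ι × ZMod p) // IsOpen x.1 ∧ Set.InjOn S.P x.1 ∧ x.1 ⊆ S.reg x.2}

theorem exists_Ixx (τ) (y : W) (h : y ∈ S.reg τ) : ∃ i : S.Ixx, y ∈ i.1.1 ∧ i.1.2 = τ := by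
  obtain ⟨V, hV, hy, hi⟩ := S.cov.isLocalHomeomorph.isLocallyInjective y
  exact ⟨⟨(V ∩ S.reg τ, τ), hV.inter (S.isOpen_reg τ), hi.mono Set.inter_subset_left, Set.inter_subset_right⟩, ⟨hy, h⟩, rfl⟩

theorem exists_at (x : U) : ∃ i : S.Ixx, x ∈ S.P '' i.1.1 := by
  obtain ⟨y, rfl⟩ := S.surj x
  have : ∃ τ, y ∈ S.reg τ := by
    rcases S.cover y with h | ⟨i, k, h⟩
    · exact ⟨none, h⟩
    · exact ⟨some (i, k), h⟩
  obtain ⟨τ, h⟩ := this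
  obtain ⟨i, hi, -⟩ := S.exists_Ixx τ y h
  exact ⟨i, y, hi, rfl⟩

open Classical in
def sec (V : Set W) (x : U) : W := if h : ∃ y ∈ V, S.P y = x then h.choose else S.y0

theorem sec_eq {V : Set W} (hV : Set.InjOn S.P V) {y : W} (hy : y ∈ V) : S.sec V (S.P y) = y := by
  have h : ∃ y' ∈ V, S.P y' = S.P y := ⟨y, hy, rfl⟩
  rw [sec, dif_pos h]
  exact hV h.choose_spec.1 hy h.choose_spec.2

def bet (τ : Option (ι × ZMod p)) (y : W) : G := t (S.J y) * S.kap t f τ y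

theorem bet_rot (ht : ∀ a b, t (a + b) = t a * t b) (τ τ' d y) : (S.bet t f τ' (S.rot d y))⁻¹ * S.bet t f τ y = 
    (S.kap t f τ' (S.rot d y))⁻¹ * (t d)⁻¹ * S.kap t f τ y := by
  rw [bet, bet, J_rot, add_comm d, ht]
  group

def coc (ht : ∀ a b, t (a + b) = t a * t b) : Coc S.Ixx U G where
  bs i := S.P '' i.1.1
  isOpen_bs i := S.cov.isLocalHomeomorph.isOpenMap _ i.2.1
  at' x := (S.exists_at x).choose
  mem_at x := (S.exists_at x).choose_spec
  b i x := S.bet t f i.1.2 (S.sec i.1.1 x)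
  loc := by
    rintro i j x ⟨y, hy, rfl⟩ ⟨y', hy', e⟩
    obtain ⟨d, rfl⟩ := (S.P_eq y y').1 e.symm
    obtain ⟨Q, hQ, hyQ, g, hg⟩ := S.exists_Q t f ht i.1.2 j.1.2 d y (i.2.2.2 hy) (j.2.2.2 hy')
    have hO : IsOpen (i.1.1 ∩ S.rot d ⁻¹' j.1.1 ∩ Q) := (i.2.1.inter (j.2.1.preimage (S.rot_cont d))).inter hQ
    have key : ∀ y1 ∈ i.1.1 ∩ S.rot d ⁻¹' j.1.1 ∩ Q, 
        (S.bet t f j.1.2 (S.sec j.1.1 (S.P y1)))⁻¹ * S.bet t f i.1.2 (S.sec i.1.1 (S.P y1)) = g := by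
      rintro y1 ⟨⟨h1, h2⟩, h3⟩
      have e : S.sec j.1.1 (S.P y1) = S.rot d y1 := by
        rw [← S.P_rot d y1, S.sec_eq j.2.2.1 h2]
      rw [e, S.sec_eq i.2.2.1 h1, S.bet_rot t f ht]
      exact hg y1 h3 (i.2.2.2 h1) (j.2.2.2 h2)
    filter_upwards [(S.cov.isLocalHomeomorph.isOpenMap _ hO).mem_nhds ⟨y, ⟨⟨hy, hy'⟩, hyQ⟩, rfl⟩]
    rintro _ ⟨y1, h1, rfl⟩
    rw [key y1 h1, key y ⟨⟨hy, hy'⟩, hyQ⟩]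

section
variable [TopologicalSpace G] [DiscreteTopology G]

theorem T_im (ht : ∀ a b, t (a + b) = t a * t b) (τ) {u v : W} (δ : Path u v) (h : ∀ s, δ s ∈ S.reg τ) : 
    (S.coc t f ht).T (cl (S.im δ)) = S.bet t f τ v * (S.bet t f τ u)⁻¹ := by
  rw [(S.coc t f ht).T_path (S.im δ) (fun s => S.bet t f τ (δ s))]
  · simp
  · intro s
    obtain ⟨i, hi, rfl⟩ := S.exists_Ixx τ (δ s) (h s)
    refine ⟨i, ⟨δ s, hi, rfl⟩, ?_⟩
    have key : ∀ s', δ s' ∈ i.1.1 → (S.coc t f ht).b i (S.im δ s') = S.bet t f i.1.2 (δ s') := by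
      intro s' hs'
      show S.bet t f i.1.2 (S.sec i.1.1 (S.P (δ s'))) = _
      rw [S.sec_eq i.2.2.1 hs']
    filter_upwards [(i.2.1.preimage δ.continuous).mem_nhds hi] with s' hs'
    rw [key s' hs', key s hi]
    simp

theorem t_zero (ht : ∀ a b, t (a + b) = t a * t b) : t 0 = 1 := by
  have := ht 0 0
  rw [add_zero] at this
  exact mul_eq_left.1 this.symm

theorem T_A (ht : ∀ a b, t (a + b) = t a * t b) {y : W} (hy : y ∈ S.W0) : (S.coc t f ht).T (S.A y) = t (S.J y) := by
  rw [A, S.T_im t f ht none _ (S.cp_W0 hy)]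
  simp [bet, kap, J_y0, t_zero t ht]

theorem T_Tl (ht : ∀ a b, t (a + b) = t a * t b) (a : ZMod p) : (S.coc t f ht).T (S.Tl a) = t a := by
  rw [Tl, Coc.T_comp, S.T_A t f ht (S.W0_rot _ _ S.hy0), Coc.T_eqToHom _ (S.P_rot _ _), one_mul, J_rot, J_y0, add_zero]

theorem T_F (ht : ∀ a b, t (a + b) = t a * t b) (i : ι) : (S.coc t f ht).T (S.F i) = f i := by
  have hv : S.dv i ∉ S.Np i 0 := fun h => S.Npm _ _ _ h (S.dv_mem i)
  rw [F, hl, Coc.T_comp, Coc.T_comp, Coc.T_inv, S.T_A t f ht (S.Np_sub _ _ _ (S.du_mem i)).1, 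
    S.T_A t f ht (S.Nm_sub _ _ _ (S.dv_mem i)).1, S.T_im t f ht (some (i, 0)) _ (S.del_mem i), bet, bet, 
    S.kap_p t f (S.du_mem i), S.kap_m t f hv, t_zero t ht]
  group

end

/-- The conclusion of the van Kampen argument. -/
theorem main : Nonempty (FundamentalGroup U S.x0 ≃* Monoid.Coprod (FreeGroup ι) (Multiplicative (ZMod p))) := by
  letI : TopologicalSpace (Monoid.Coprod (FreeGroup ι) (Multiplicative (ZMod p))) := ⊥
  haveI : DiscreteTopology (Monoid.Coprod (FreeGroup ι) (Multiplicative (ZMod p))) := ⟨rfl⟩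
  let t : ZMod p → Monoid.Coprod (FreeGroup ι) (Multiplicative (ZMod p)) := fun a => Monoid.Coprod.inr (Multiplicative.ofAdd a)
  let f : ι → Monoid.Coprod (FreeGroup ι) (Multiplicative (ZMod p)) := fun i => Monoid.Coprod.inl (FreeGroup.of i)
  have ht : ∀ a b, t (a + b) = t a * t b := fun a b => by
    show Monoid.Coprod.inr (Multiplicative.ofAdd (a + b)) = _
    rw [ofAdd_add, map_mul]
  let M : FundamentalGroup U S.x0 →* Monoid.Coprod (FreeGroup ι) (Multiplicative (ZMod p)) := 
    { toFun := fun g => (S.coc t f ht).T g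
      map_one' := (S.coc t f ht).T_eqToHom rfl rfl
      map_mul' := fun g h => (S.coc t f ht).T_comp h g }
  let L : Monoid.Coprod (FreeGroup ι) (Multiplicative (ZMod p)) →* FundamentalGroup U S.x0 :=
    Monoid.Coprod.lift (FreeGroup.lift S.F) 
      { toFun := fun a => S.Tl a.toAdd
        map_one' := S.Tl_zero
        map_mul' := fun a b => by rw [toAdd_mul, add_comm, S.Tl_add] }
  have hML : M.comp L = MonoidHom.id _ := by
    apply Monoid.Coprod.hom_ext
    · apply FreeGroup.ext_hom
      intro i
      show M (L (Monoid.Coprod.inl (FreeGroup.of i))) = _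
      rw [Monoid.Coprod.lift_apply_inl, FreeGroup.lift_apply_of]
      exact S.T_F t f ht i
    · refine MonoidHom.ext fun a => ?_
      show M (L (Monoid.Coprod.inr a)) = _
      rw [Monoid.Coprod.lift_apply_inr]
      exact S.T_Tl t f ht _
  have hinj : Function.Injective L := fun a b h => by
    have := congrArg M h
    have e : ∀ a, M (L a) = a := fun a => DFunLike.congr_fun hML a
    rwa [e, e] at this
  have hsurj : L.range = ⊤ := by
    apply S.gen
    · intro a
      exact ⟨Monoid.Coprod.inr (Multiplicative.ofAdd a), by rw [Monoid.Coprod.lift_apply_inr]; rfl⟩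
    · intro i
      exact ⟨Monoid.Coprod.inl (FreeGroup.of i), by rw [Monoid.Coprod.lift_apply_inl, FreeGroup.lift_apply_of]⟩
  exact ⟨(MulEquiv.ofBijective L ⟨hinj, MonoidHom.range_eq_top.1 hsurj⟩).symm⟩

end VK
end Oka

namespace Oka
open Filter Topology unitInterval CategoryTheory

theorem square {Z : Type} [TopologicalSpace Z] (H : C(I × I, Z)) {u v : Z} (δ : Path u v) (h : ∀ s, H (s, 0) = δ s) 
    (S : Set Z) (h0 : ∀ t, H (0, t) ∈ S) (h1 : ∀ t, H (1, t) ∈ S) (ht : ∀ s, H (s, 1) ∈ S) : 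
    ∃ δ' : Path u v, (∀ t, δ' t ∈ S) ∧ δ.Homotopic δ' := by
  let pj : ℝ → I := Set.projIcc 0 1 zero_le_one
  have hpj : ∀ t : I, pj t = t := fun t => Set.projIcc_val zero_le_one t
  have hpj0 : pj 0 = 0 := hpj 0
  have hpj1 : pj 1 = 1 := hpj 1
  have cpj : Continuous pj := continuous_projIcc
  let G : ℝ × ℝ → Z := fun x => H (pj x.1, pj x.2)
  have hG : Continuous G := by fun_prop
  let a : Path ((0:ℝ), (0:ℝ)) ((0:ℝ), (1:ℝ)) := ⟨⟨fun t => (0, (t:ℝ)), by fun_prop⟩, by simp, by simp⟩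
  let c : Path ((0:ℝ), (1:ℝ)) ((1:ℝ), (1:ℝ)) := ⟨⟨fun t => ((t:ℝ), 1), by fun_prop⟩, by simp, by simp⟩
  let b : Path ((1:ℝ), (0:ℝ)) ((1:ℝ), (1:ℝ)) := ⟨⟨fun t => (1, (t:ℝ)), by fun_prop⟩, by simp, by simp⟩
  let d : Path ((0:ℝ), (0:ℝ)) ((1:ℝ), (0:ℝ)) := ⟨⟨fun t => ((t:ℝ), 0), by fun_prop⟩, by simp, by simp⟩
  have e : d.Homotopic ((a.trans c).trans b.symm) := SimplyConnectedSpace.paths_homotopic _ _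
  have e2 := e.map ⟨G, hG⟩
  have hu : u = G (0, 0) := by simp [G, hpj0, h]
  have hv : v = G (1, 0) := by simp [G, hpj0, hpj1, h]
  subst hu hv
  refine ⟨((a.trans c).trans b.symm).map hG, ?_, ?_⟩
  · intro t
    have : ((a.trans c).trans b.symm) t ∈ G ⁻¹' S := by
      refine trans_mem (trans_mem ?_ ?_) (symm_mem ?_) t
      · intro t; simpa [a, G, hpj, hpj0] using h0 t
      · intro t; simpa [c, G, hpj, hpj1] using ht t
      · intro t; simpa [b, G, hpj, hpj1] using h1 t
    exact this
  · have : δ = d.map hG := by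
      ext t
      simp [d, G, hpj, hpj0, h]
    rw [this]
    exact e2

/-- p-th root data -/
abbrev zt (p : ℕ) [NeZero p] (a : ZMod p) : ℂ := ZMod.stdAddChar a

theorem zt_pow (p : ℕ) [NeZero p] (a : ZMod p) : zt p a ^ p = 1 := by
  rw [zt, ← AddChar.map_nsmul_eq_pow]
  simp

theorem zt_ne (p : ℕ) [NeZero p] (a : ZMod p) : zt p a ≠ 0 := by
  intro h
  have := zt_pow p a
  rw [h, zero_pow (NeZero.ne p)] at this
  exact zero_ne_one this

theorem zt_add (p : ℕ) [NeZero p] (a b : ZMod p) : zt p (a + b) = zt p a * zt p b := AddChar.map_add_eq_mul _ _ _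

theorem exists_zt (p : ℕ) [NeZero p] (z : ℂ) (hz : z ^ p = 1) : ∃ a, zt p a = z := by
  have h1 := Complex.isPrimitiveRoot_exp p (NeZero.ne p)
  obtain ⟨i, -, hi⟩ := h1.eq_pow_of_pow_eq_one hz
  refine ⟨i • 1, ?_⟩
  rw [zt, AddChar.map_nsmul_eq_pow, ← hi]
  congr 1
  have := ZMod.stdAddChar_coe (N := p) 1
  simpa using this

theorem zt_inj (p : ℕ) [NeZero p] (a b : ZMod p) (h : zt p a = zt p b) : a = b := ZMod.injective_stdAddChar h

/-- Fibration data. -/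
structure Fib (p : ℕ) [NeZero p] (Y X : Type) [TopologicalSpace Y] [TopologicalSpace X] where
  ψ : Y → ℂ
  ψ_cont : Continuous ψ
  rot : ZMod p → Y → Y
  rot_cont : ∀ a, Continuous (rot a)
  rot_zero : ∀ y, rot 0 y = y
  rot_add : ∀ a b y, rot (a + b) y = rot a (rot b y)
  rot_free : ∀ a y, rot a y = y → a = 0
  ψ_rot : ∀ a y, ψ (rot a y) = zt p a * ψ y
  B : Set ℂ
  B_fin : B.Finite
  B0 : 0 ∈ B
  trans : Trans (fun y => ψ y ^ p) B
  conn : ∀ s, s ^ p ∉ B → IsConnected (ψ ⁻¹' {s})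
  P : Y → X
  cov : IsCoveringMap P
  surj : Function.Surjective P
  P_eq : ∀ y y', P y = P y' ↔ ∃ a, y' = rot a y
  lpc : LocallyPathConnectedSpace Y
  sc : SimplyConnectedSpace Y

namespace Fib
variable {p : ℕ} [NeZero p] {Y X : Type} [TopologicalSpace Y] [TopologicalSpace X] (F : Fib p Y X)

def φ (y : Y) : ℂ := F.ψ y ^ p

theorem φ_cont : Continuous F.φ := F.ψ_cont.pow p

theorem φ_rot (a y) : F.φ (F.rot a y) = F.φ y := by
  rw [φ, F.ψ_rot, mul_pow, zt_pow, one_mul]; rfl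

def scale (m : ℂ) (hm : m ≠ 0) : Fib p Y X where
  __ := F
  ψ y := m * F.ψ y
  ψ_cont := F.ψ_cont.const_smul m
  ψ_rot a y := by rw [F.ψ_rot]; ring
  B := (fun z => m ^ p * z) '' F.B
  B_fin := F.B_fin.image _
  B0 := ⟨0, F.B0, by simp⟩
  trans := by
    intro c0 hc0
    have hmp : m ^ p ≠ 0 := pow_ne_zero _ hm
    have h0 : c0 / m ^ p ∉ F.B := fun h => hc0 ⟨_, h, by field_simp⟩
    obtain ⟨ε, hε, Φ, hΦ, h⟩ := F.trans _ h0
    have hn : 0 < ‖m ^ p‖ := norm_pos_iff.2 hmp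
    have e1 : ∀ c, ‖c - c0‖ < ‖m ^ p‖ * ε → ‖c / m ^ p - c0 / m ^ p‖ < ε := by
      intro c hc
      rw [← sub_div, norm_div, div_lt_iff₀ hn]
      linarith
    have e2 : ∀ y, ‖(m * F.ψ y) ^ p - c0‖ < ‖m ^ p‖ * ε → ‖F.ψ y ^ p - c0 / m ^ p‖ < ε := by
      intro y hy
      have := e1 _ hy
      rw [mul_pow] at this
      rwa [mul_div_cancel_left₀ _ hmp] at this
    refine ⟨‖m ^ p‖ * ε, by positivity, fun c y => Φ (c / m ^ p) y, ?_, ?_⟩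
    · refine hΦ.comp (f := fun x : ℂ × Y => (x.1 / m ^ p, x.2)) (by fun_prop) ?_
      rintro ⟨c, y⟩ ⟨h1, h2⟩
      exact ⟨e1 _ h1, e2 _ h2⟩
    · intro c y h1 h2
      obtain ⟨h3, h4⟩ := h _ y (e1 _ h1) (e2 _ h2)
      constructor
      · simp only at h3 ⊢
        rw [mul_pow, h3]
        field_simp
      · intro h5
        apply h4
        simp only at h5 ⊢
        rw [← h5, mul_pow]
        field_simp
  conn s hs := by
    have : (fun y => m * F.ψ y) ⁻¹' {s} = F.ψ ⁻¹' {s / m} := by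
      ext y
      simp only [Set.mem_preimage, Set.mem_singleton_iff]
      rw [eq_div_iff hm, mul_comm]
    rw [this]
    apply F.conn
    intro h
    refine hs ⟨_, h, ?_⟩
    simp only
    rw [div_pow]
    field_simp

theorem hlp {T : Set ℂ} (hT : IsClosed T) (hTB : Disjoint T F.B) {K : Type} [TopologicalSpace K] [CompactSpace K] 
    (f : C(K, Y)) (h : C(K × I, ℂ)) (h0 : ∀ k, h (k, 0) = F.φ (f k)) 
    (hh : ∀ k, (∀ t, h (k, t) = F.φ (f k)) ∨ ∀ t, h (k, t) ∈ T) : 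
    ∃ H : C(K × I, Y), (∀ k t, F.φ (H (k, t)) = h (k, t)) ∧ (∀ k, H (k, 0) = f k) ∧ 
      ∀ k, (∀ t, h (k, t) = F.φ (f k)) → ∀ t, H (k, t) = f k := by
  have hC : IsCompact (Set.range h ∩ T) := (isCompact_range h.continuous).inter_right hT
  exact F.trans.hlp F.φ_cont hC (hTB.mono_left Set.inter_subset_right) f h h0 
    fun k => (hh k).imp id fun h' t => ⟨⟨_, rfl⟩, h' t⟩

end Fib
end Oka

namespace Oka
open Filter Topology unitInterval CategoryTheory

/-- points in general position for a fibration -/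
structure Gen {p : ℕ} [NeZero p] {Y X : Type} [TopologicalSpace Y] [TopologicalSpace X] (F : Fib p Y X) (ι : Type) where
  c : ι → ℂ
  e : ℝ
  he : 0 < e
  hB : ∀ i, ∀ d ∈ F.B, e < |d.im - (c i).im|
  hc : ∀ i j, i ≠ j → 2 * e < |(c j).im - (c i).im|

namespace Gen
variable {p : ℕ} [NeZero p] {Y X : Type} [TopologicalSpace Y] [TopologicalSpace X] {F : Fib p Y X} {ι : Type} [Finite ι] 
  (S : Gen F ι)

def T : Set ℂ := {z | ∃ i, |z.im - (S.c i).im| ≤ S.e}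
def To : Set ℂ := {z | ∃ i, |z.im - (S.c i).im| < S.e}
def slit : Set ℂ := {z | ∃ i, z.im = (S.c i).im ∧ (S.c i).re ≤ z.re}

theorem isClosed_T : IsClosed S.T := by
  rw [T, Set.setOf_exists]
  exact isClosed_iUnion_of_finite fun i => isClosed_le (by fun_prop) continuous_const

theorem T_B : Disjoint S.T F.B := by
  rw [Set.disjoint_left]
  rintro z ⟨i, hi⟩ hz
  exact absurd (S.hB i z hz) (not_lt.2 hi)

theorem isOpen_To : IsOpen S.To := by
  rw [To, Set.setOf_exists]
  exact isOpen_iUnion fun i => isOpen_lt (by fun_prop) continuous_const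

theorem isClosed_slit : IsClosed S.slit := by
  rw [slit, Set.setOf_exists]
  exact isClosed_iUnion_of_finite fun i => (isClosed_eq Complex.continuous_im continuous_const).inter (isClosed_le continuous_const Complex.continuous_re)

theorem c_im_inj {i j} (h : (S.c i).im = (S.c j).im) : i = j := by
  by_contra hij
  have := S.hc i j hij
  rw [h] at this
  have := S.he
  simp at *
  linarith

theorem push {K : Type} [TopologicalSpace K] [CompactSpace K] [T2Space K] (f : C(K, Y)) (L : Set K) (hL : IsClosed L) 
    (hf : ∀ k ∈ L, F.φ (f k) ∉ S.slit) : 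
    ∃ g : C(K, Y), (∀ k, F.φ (g k) ∉ S.slit) ∧ ∀ k ∈ L, g k = f k := by
  have hcf : Continuous fun k => F.φ (f k) := F.φ_cont.comp f.continuous
  have hsT : S.slit ⊆ S.To := by
    rintro z ⟨i, h1, -⟩
    exact ⟨i, by rw [h1, sub_self, abs_zero]; exact S.he⟩
  obtain ⟨l, l0, l1, l2⟩ := exists_continuous_zero_one_of_isClosed 
    (s := L ∪ (fun k => F.φ (f k)) ⁻¹' S.Toᶜ) (t := (fun k => F.φ (f k)) ⁻¹' S.slit)
    (hL.union (S.isOpen_To.isClosed_compl.preimage hcf)) (S.isClosed_slit.preimage hcf)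
    (by
      rw [Set.disjoint_left]
      rintro k (hk | hk) hk'
      · exact hf k hk hk'
      · exact hk (hsT hk'))
  obtain ⟨R, hR⟩ := (isCompact_range hcf).isBounded.exists_norm_le
  obtain ⟨M', hM'⟩ := (Set.finite_range fun i => ‖S.c i‖).bddAbove
  set M := R + M' + 1 with hM
  let h : C(K × I, ℂ) := ⟨fun x => F.φ (f x.1) - ((x.2 : ℝ) * M * l x.1 : ℝ), by
    refine (hcf.comp continuous_fst).sub (Complex.continuous_ofReal.comp ?_)
    have := l.continuous
    fun_prop⟩
  have him : ∀ k t, (h (k, t)).im = (F.φ (f k)).im := by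
    intro k t
    show (F.φ (f k) - ((t : ℝ) * M * l k : ℝ)).im = _
    rw [Complex.sub_im, Complex.ofReal_im, sub_zero]
  have hre : ∀ k t, (h (k, t)).re = (F.φ (f k)).re - t * M * l k := by
    intro k t
    show (F.φ (f k) - ((t : ℝ) * M * l k : ℝ)).re = _
    rw [Complex.sub_re, Complex.ofReal_re]
  have hst : ∀ k, l k = 0 → ∀ t, h (k, t) = F.φ (f k) := by
    intro k hk t
    show F.φ (f k) - ((t : ℝ) * M * l k : ℝ) = _
    simp [hk]
  obtain ⟨H, H1, H2, H3⟩ := F.hlp S.isClosed_T S.T_B f h (by intro k; show F.φ (f k) - (((0:I) : ℝ) * M * l k : ℝ) = _; simp) (by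
    intro k
    by_cases hk : F.φ (f k) ∈ S.To
    · right
      intro t
      obtain ⟨i, hi⟩ := hk
      exact ⟨i, by rw [him]; exact hi.le⟩
    · left
      exact hst k (l0 (Or.inr hk)))
  refine ⟨H.comp ⟨fun k => (k, 1), by fun_prop⟩, ?_, ?_⟩
  · intro k
    show F.φ (H (k, 1)) ∉ _
    rw [H1]
    rintro ⟨i, h1, h2⟩
    rw [him] at h1
    rw [hre] at h2
    by_cases hk : F.φ (f k) ∈ S.slit
    · have e1 : l k = 1 := l1 hk
      have e2 := hR _ ⟨k, rfl⟩
      have e3 := hM' ⟨i, rfl⟩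
      have e4 := (Complex.abs_re_le_norm (F.φ (f k))).trans e2
      have e5 := (Complex.abs_re_le_norm (S.c i)).trans e3
      rw [abs_le] at e4 e5
      rw [e1] at h2
      simp at h2
      linarith
    · apply hk
      refine ⟨i, h1, ?_⟩
      have e2 := hR _ ⟨k, rfl⟩
      have e3 := hM' ⟨i, rfl⟩
      have e4 := norm_nonneg (F.φ (f k))
      have e5 := norm_nonneg (S.c i)
      simp only at e3 e2
      have hl0 := (l2 k).1
      have : 0 ≤ M * l k := mul_nonneg (by linarith) hl0
      rw [show ((1 : I) : ℝ) = 1 from rfl, one_mul] at h2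
      linarith
  · intro k hk
    exact H3 k (hst k (l0 (Or.inl hk))) 1

end Gen
end Oka

namespace Oka
open Filter Topology unitInterval CategoryTheory
namespace Gen
variable {p : ℕ} [NeZero p] {Y X : Type} [TopologicalSpace Y] [TopologicalSpace X] {F : Fib p Y X} {ι : Type} [Finite ι] 
  (S : Gen F ι)

theorem T_slitPlane {z : ℂ} (hz : z ∈ S.T) : z ∈ Complex.slitPlane := by
  obtain ⟨i, hi⟩ := hz
  right
  intro h
  have := S.hB i 0 F.B0
  rw [h] at hi
  simp at hi this
  linarith

/-- principal root -/
def rho (p : ℕ) (z : ℂ) : ℂ := z ^ ((p : ℂ)⁻¹)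

theorem rho_pow (z : ℂ) : rho p z ^ p = z := Complex.cpow_nat_inv_pow z (NeZero.ne p)

theorem rho_cont {z : ℂ} (hz : z ∈ Complex.slitPlane) : ContinuousAt (rho p) z := continuousAt_cpow_const hz

theorem rho_ne {z : ℂ} (hz : z ∈ Complex.slitPlane) : rho p z ≠ 0 := by
  intro h
  have := rho_pow (p := p) z
  rw [h, zero_pow (NeZero.ne p)] at this
  exact Complex.slitPlane_ne_zero hz this.symm

def M (F : Fib p Y X) (R : Set ℂ) (k : ZMod p) : Set Y := {y | F.φ y ∈ R ∧ F.ψ y = zt p k * rho p (F.φ y)}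

variable {R : Set ℂ}

theorem exists_M (hR : R ⊆ S.T) {y} (hy : F.φ y ∈ R) : ∃ k, y ∈ M F R k := by
  have h0 := rho_ne (p := p) (S.T_slitPlane (hR hy))
  obtain ⟨k, hk⟩ := exists_zt p (F.ψ y / rho p (F.φ y)) (by
    rw [div_pow, rho_pow]
    exact div_self (Complex.slitPlane_ne_zero (S.T_slitPlane (hR hy))))
  exact ⟨k, hy, by rw [hk]; field_simp⟩

theorem M_unique (hR : R ⊆ S.T) {y k k'} (h : y ∈ M F R k) (h' : y ∈ M F R k') : k = k' := by
  have h0 := rho_ne (p := p) (S.T_slitPlane (hR h.1))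
  exact zt_inj p _ _ (mul_right_cancel₀ h0 (h.2.symm.trans h'.2))

theorem isOpen_M (hR : R ⊆ S.T) (hRo : IsOpen R) (k) : IsOpen (M F R k) := by
  rw [isOpen_iff_eventually]
  intro y hy
  have hφ : ContinuousAt (fun y => rho p (F.φ y)) y := 
    ContinuousAt.comp (f := F.φ) (rho_cont (S.T_slitPlane (hR hy.1))) F.φ_cont.continuousAt
  have h1 : ∀ᶠ y' in 𝓝 y, F.φ y' ∈ R := F.φ_cont.continuousAt (hRo.mem_nhds hy.1)
  have h2 : ∀ᶠ y' in 𝓝 y, ∀ k' : ZMod p, k' ≠ k → F.ψ y' ≠ zt p k' * rho p (F.φ y') := by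
    rw [Filter.eventually_all]
    intro k'
    by_cases hk : k' = k
    · simp [hk]
    · have hne : F.ψ y ≠ zt p k' * rho p (F.φ y) := fun h => hk (S.M_unique hR ⟨hy.1, h⟩ hy)
      filter_upwards [(F.ψ_cont.continuousAt.ne_iff_eventually_ne (continuousAt_const.mul hφ)).1 hne] with y' h _
      exact h
  filter_upwards [h1, h2] with y' h1 h2
  obtain ⟨k', hk'⟩ := S.exists_M hR h1
  by_cases hk : k' = k
  · exact hk ▸ hk'
  · exact absurd hk'.2 (h2 k' hk)

theorem stay (hR : R ⊆ S.T) (hRo : IsOpen R) {Z : Type} [TopologicalSpace Z] [PreconnectedSpace Z] {g : Z → Y} 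
    (hg : Continuous g) (h : ∀ z, F.φ (g z) ∈ R) {k z0} (hz0 : g z0 ∈ M F R k) (z : Z) : g z ∈ M F R k := by
  have : IsClopen (g ⁻¹' M F R k) := by
    refine ⟨⟨?_⟩, (S.isOpen_M hR hRo k).preimage hg⟩
    have e : (g ⁻¹' M F R k)ᶜ = ⋃ k' ∈ {k' : ZMod p | k' ≠ k}, g ⁻¹' M F R k' := by
      ext z
      simp only [Set.mem_compl_iff, Set.mem_preimage, Set.mem_iUnion, Set.mem_setOf_eq, exists_prop]
      constructor
      · intro hz
        obtain ⟨k', hk'⟩ := S.exists_M hR (h z)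
        exact ⟨k', fun e => hz (e ▸ hk'), hk'⟩
      · rintro ⟨k', hk, hk'⟩ hz
        exact hk (S.M_unique hR hk' hz)
    rw [e]
    exact isOpen_biUnion fun k' _ => (S.isOpen_M hR hRo k').preimage hg
  have := this.eq_univ ⟨z0, hz0⟩
  exact this.ge (Set.mem_univ z)

theorem T_notB {z} (hz : z ∈ S.T) : z ∉ F.B := Set.disjoint_left.1 S.T_B hz

theorem fibre_sub (hR : R ⊆ S.T) {z} (hz : z ∈ R) (k) : F.ψ ⁻¹' {zt p k * rho p z} ⊆ M F R k := by
  intro y hy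
  have hy : F.ψ y = zt p k * rho p z := hy
  have : F.φ y = z := by rw [Fib.φ, hy, mul_pow, zt_pow, rho_pow, one_mul]
  exact ⟨this ▸ hz, by rw [hy, this]⟩

theorem fibre_conn {z} (hz : z ∈ S.T) (k) : IsConnected (F.ψ ⁻¹' {zt p k * rho p z}) := 
  F.conn _ (by rw [mul_pow, zt_pow, rho_pow, one_mul]; exact S.T_notB hz)

theorem M_ne (hR : R ⊆ S.T) (hRn : R.Nonempty) (k) : (M F R k).Nonempty := by
  obtain ⟨z, hz⟩ := hRn
  exact (S.fibre_conn (hR hz) k).nonempty.mono (S.fibre_sub hR hz k)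

theorem move (hR : R ⊆ S.T) (hRc : Convex ℝ R) {K : Type} [TopologicalSpace K] [CompactSpace K] (f : C(K, Y)) 
    (hf : ∀ k, F.φ (f k) ∈ R) {z} (hz : z ∈ R) : ∃ H : C(K × I, Y), (∀ k, H (k, 0) = f k) ∧ 
      ∀ k t, F.φ (H (k, t)) = (1 - (t : ℝ)) • F.φ (f k) + (t : ℝ) • z := by
  have hcf : Continuous fun k => F.φ (f k) := F.φ_cont.comp f.continuous
  obtain ⟨H, h1, h2, -⟩ := F.hlp S.isClosed_T S.T_B f ⟨fun x => (1 - (x.2 : ℝ)) • F.φ (f x.1) + (x.2 : ℝ) • z, by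
    have : Continuous fun x : K × I => F.φ (f x.1) := hcf.comp continuous_fst
    fun_prop⟩ (by intro k; simp) (by
      intro k
      right
      intro t
      exact hR (hRc (hf k) hz (by have := t.2.2; linarith) t.2.1 (by ring)))
  exact ⟨H, h2, h1⟩

theorem M_joined (hR : R ⊆ S.T) (hRo : IsOpen R) (hRc : Convex ℝ R) (hRn : R.Nonempty) (k) : IsPathConnected (M F R k) := by
  have := F.lpc
  rw [← (S.isOpen_M hR hRo k).isConnected_iff_isPathConnected]
  refine ⟨S.M_ne hR hRn k, ?_⟩
  obtain ⟨z, hz⟩ := hRn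
  have key : ∀ u ∈ M F R k, ∃ C ⊆ M F R k, u ∈ C ∧ IsPreconnected C ∧ F.ψ ⁻¹' {zt p k * rho p z} ⊆ C := by
    intro u hu
    obtain ⟨H, h1, h2⟩ := S.move hR hRc (ContinuousMap.const Unit u) (fun _ => hu.1) hz
    have hH : ∀ t, H ((), t) ∈ M F R k := by
      refine S.stay hR hRo (g := fun t : I => H ((), t)) (by fun_prop) (fun t => ?_) (z0 := 0) ?_
      · rw [h2]
        exact hRc hu.1 hz (by have := t.2.2; linarith) t.2.1 (by ring)
      · simp only [h1]; exact hu
    refine ⟨Set.range (fun t => H ((), t)) ∪ F.ψ ⁻¹' {zt p k * rho p z}, ?_, ?_, ?_, Set.subset_union_right⟩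
    · rintro _ (⟨t, rfl⟩ | h)
      · exact hH t
      · exact S.fibre_sub hR hz k h
    · exact Or.inl ⟨0, h1 _⟩
    · refine IsPreconnected.union (H ((), 1)) ⟨1, rfl⟩ ?_ (isPreconnected_range (by fun_prop)) (S.fibre_conn (hR hz) k).isPreconnected
      have h3 := (hH 1).2
      have h4 : F.φ (H ((), 1)) = z := by rw [h2]; simp
      rw [h4] at h3
      exact h3
  refine isPreconnected_of_forall_pair fun u hu v hv => ?_
  obtain ⟨C, c1, c2, c3, c4⟩ := key u hu
  obtain ⟨C', c1', c2', c3', c4'⟩ := key v hv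
  obtain ⟨w, hw⟩ := (S.fibre_conn (hR hz) k).nonempty
  exact ⟨C ∪ C', Set.union_subset c1 c1', Or.inl c2, Or.inr c2', c3.union w (c4 hw) (c4' hw) c3'⟩

theorem M_rot (a k) {y} (h : y ∈ M F R k) : F.rot a y ∈ M F R (k + a) := by
  refine ⟨by rw [F.φ_rot]; exact h.1, ?_⟩
  rw [F.ψ_rot, F.φ_rot, h.2, zt_add]; ring

end Gen
end Oka

namespace Oka
open Filter Topology unitInterval CategoryTheory

def Fib.U {p : ℕ} [NeZero p] {Y X : Type} [TopologicalSpace Y] [TopologicalSpace X] (F : Fib p Y X) {ι : Type} 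
  (c : ι → ℂ) : Set X := {x | ∀ y, F.P y = x → ∀ i, F.φ y ≠ c i}

namespace Gen
variable {p : ℕ} [NeZero p] {Y X : Type} [TopologicalSpace Y] [TopologicalSpace X] {F : Fib p Y X} {ι : Type} [Finite ι] 
  (S : Gen F ι)

abbrev W : Set Y := F.P ⁻¹' F.U S.c

theorem mem_W {y} : y ∈ S.W ↔ ∀ i, F.φ y ≠ S.c i := by
  constructor
  · intro h
    exact h y rfl
  · intro h y' hy'
    obtain ⟨a, rfl⟩ := (F.P_eq _ _).1 hy'.symm
    rw [F.φ_rot]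
    exact h

def Rg (i : ι) : Set ℂ := {z | (S.c i).re < z.re ∧ |z.im - (S.c i).im| < S.e}
def Rp (i : ι) : Set ℂ := {z | (S.c i).re < z.re ∧ (S.c i).im < z.im ∧ z.im < (S.c i).im + S.e}
def Rm (i : ι) : Set ℂ := {z | (S.c i).re < z.re ∧ (S.c i).im - S.e < z.im ∧ z.im < (S.c i).im}

theorem Rp_sub (i) : S.Rp i ⊆ S.Rg i := by
  rintro z ⟨h1, h2, h3⟩
  have := S.he
  exact ⟨h1, by rw [abs_lt]; constructor <;> linarith⟩
theorem Rm_sub (i) : S.Rm i ⊆ S.Rg i := by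
  rintro z ⟨h1, h2, h3⟩
  have := S.he
  exact ⟨h1, by rw [abs_lt]; constructor <;> linarith⟩
theorem Rg_T (i) : S.Rg i ⊆ S.T := fun z hz => ⟨i, hz.2.le⟩
theorem Rp_T (i) : S.Rp i ⊆ S.T := (S.Rp_sub i).trans (S.Rg_T i)
theorem Rm_T (i) : S.Rm i ⊆ S.T := (S.Rm_sub i).trans (S.Rg_T i)

theorem Rg_eq (i) : S.Rg i = Complex.reLm ⁻¹' Set.Ioi (S.c i).re ∩ Complex.imLm ⁻¹' Set.Ioo ((S.c i).im - S.e) ((S.c i).im + S.e) := by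
  ext z
  simp only [Rg, Set.mem_setOf_eq, Set.mem_inter_iff, Set.mem_preimage, Set.mem_Ioi, Set.mem_Ioo, Complex.reLm_coe, Complex.imLm_coe, abs_lt]
  constructor <;> rintro ⟨h1, h2, h3⟩ <;> exact ⟨h1, by linarith, by linarith⟩

theorem Rg_open (i) : IsOpen (S.Rg i) := by
  rw [Rg_eq]
  exact (isOpen_Ioi.preimage Complex.continuous_re).inter (isOpen_Ioo.preimage Complex.continuous_im)
theorem Rp_open (i) : IsOpen (S.Rp i) := 
  (isOpen_Ioi.preimage Complex.continuous_re).inter (isOpen_Ioo.preimage Complex.continuous_im)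
theorem Rm_open (i) : IsOpen (S.Rm i) := 
  (isOpen_Ioi.preimage Complex.continuous_re).inter (isOpen_Ioo.preimage Complex.continuous_im)
theorem Rg_convex (i) : Convex ℝ (S.Rg i) := by
  rw [Rg_eq]
  exact ((convex_Ioi _).linear_preimage _).inter ((convex_Ioo _ _).linear_preimage _)
theorem Rp_convex (i) : Convex ℝ (S.Rp i) := 
  ((convex_Ioi (S.c i).re).linear_preimage Complex.reLm).inter ((convex_Ioo _ _).linear_preimage Complex.imLm)
theorem Rm_convex (i) : Convex ℝ (S.Rm i) := 
  ((convex_Ioi (S.c i).re).linear_preimage Complex.reLm).inter ((convex_Ioo _ _).linear_preimage Complex.imLm)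
theorem Rp_ne (i) : (S.Rp i).Nonempty := by
  have := S.he
  exact ⟨⟨(S.c i).re + 1, (S.c i).im + S.e / 2⟩, by simp, by simp; linarith, by simp; linarith⟩
theorem Rm_ne (i) : (S.Rm i).Nonempty := by
  have := S.he
  exact ⟨⟨(S.c i).re + 1, (S.c i).im - S.e / 2⟩, by simp, by simp; linarith, by simp; linarith⟩

theorem strip_unique {z : ℂ} {i j} (hi : |z.im - (S.c i).im| < S.e) (hj : |z.im - (S.c j).im| < S.e) : i = j := by
  by_contra h
  have h2 := S.hc i j h
  rw [abs_lt] at hi hj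
  rw [lt_abs] at h2
  rcases h2 with h2 | h2 <;> linarith

theorem Rg_slit {i} {z : ℂ} (hz : z ∈ S.Rg i) (hs : z ∈ S.slit) : z.im = (S.c i).im := by
  obtain ⟨j, hj, -⟩ := hs
  have := S.strip_unique hz.2 (j := j) (by rw [hj, sub_self, abs_zero]; exact S.he)
  rw [this, hj]

theorem Rp_slit {i} {z : ℂ} (hz : z ∈ S.Rp i) : z ∉ S.slit := fun h => 
  absurd (S.Rg_slit (S.Rp_sub i hz) h) hz.2.1.ne'
theorem Rm_slit {i} {z : ℂ} (hz : z ∈ S.Rm i) : z ∉ S.slit := fun h => 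
  absurd (S.Rg_slit (S.Rm_sub i hz) h) hz.2.2.ne

theorem Rg_ne_c {i} {z : ℂ} (hz : z ∈ S.Rg i) (j) : z ≠ S.c j := by
  rintro rfl
  have := S.strip_unique hz.2 (j := j) (by rw [sub_self, abs_zero]; exact S.he)
  subst this
  exact lt_irrefl _ hz.1

theorem slit_ne_c {z : ℂ} (hz : z ∉ S.slit) (j) : z ≠ S.c j := by
  rintro rfl
  exact hz ⟨j, rfl, le_rfl⟩

theorem hol {R R' : Set ℂ} (hR : R ⊆ S.T) (hRR : R' ⊆ R) (hRc : Convex ℝ R) (hRc' : Convex ℝ R') (hne : R'.Nonempty) 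
    (hs : ∀ z ∈ R', z ∉ S.slit) (hRW : ∀ z ∈ R, ∀ j, z ≠ S.c j)
    {u v : S.W} (δ : Path u v) (hδ : ∀ t, F.φ (δ t) ∈ R) (hu : F.φ u ∈ R') (hv : F.φ v ∈ R') : 
    ∃ δ' : Path u v, (∀ t, F.φ (δ' t) ∉ S.slit) ∧ δ.Homotopic δ' := by
  obtain ⟨z, hz⟩ := hne
  obtain ⟨H, h1, h2⟩ := S.move hR hRc ⟨fun t => (δ t : Y), by fun_prop⟩ hδ (hRR hz)
  simp only [ContinuousMap.coe_mk] at h1 h2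
  have hW : ∀ x, H x ∈ S.W := by
    rintro ⟨s, t⟩
    rw [mem_W]
    apply hRW
    rw [h2]
    exact hRc (hδ s) (hRR hz) (by have := t.2.2; linarith) t.2.1 (by ring)
  refine square (Z := S.W) ⟨fun x => ⟨H x, hW x⟩, by fun_prop⟩ δ ?_ {y | F.φ y ∉ S.slit} ?_ ?_ ?_
  · intro s
    exact Subtype.ext (h1 s)
  · intro t
    apply hs
    show F.φ (H (0, t)) ∈ R'
    rw [h2, δ.source]
    exact hRc' hu hz (by have := t.2.2; linarith) t.2.1 (by ring)
  · intro t
    apply hs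
    show F.φ (H (1, t)) ∈ R'
    rw [h2, δ.target]
    exact hRc' hv hz (by have := t.2.2; linarith) t.2.1 (by ring)
  · intro t
    apply hs
    show F.φ (H (t, 1)) ∈ R'
    rw [h2]
    simpa using hz

theorem W0_conn (u v : S.W) (hu : F.φ u ∉ S.slit) (hv : F.φ v ∉ S.slit) : 
    ∃ γ : Path u v, ∀ t, F.φ (γ t) ∉ S.slit := by
  have := F.sc
  obtain ⟨γ⟩ := PathConnectedSpace.joined (u : Y) (v : Y)
  obtain ⟨g, h1, h2⟩ := S.push γ.toContinuousMap {0, 1} (Set.toFinite _).isClosed (by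
    rintro k (rfl | rfl)
    · simpa using hu
    · simpa using hv)
  refine ⟨⟨⟨fun t => ⟨g t, S.mem_W.2 (S.slit_ne_c (h1 t))⟩, by fun_prop⟩, ?_, ?_⟩, h1⟩
  · apply Subtype.ext
    show g 0 = u
    rw [h2 0 (by simp)]
    simp
  · apply Subtype.ext
    show g 1 = v
    rw [h2 1 (by simp)]
    simp

theorem W0_sc (u v : S.W) (γ γ' : Path u v) (h : ∀ t, F.φ (γ t) ∉ S.slit) (h' : ∀ t, F.φ (γ' t) ∉ S.slit) : 
    γ.Homotopic γ' := by
  have := F.sc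
  obtain ⟨G⟩ := SimplyConnectedSpace.paths_homotopic (γ.map continuous_subtype_val) (γ'.map continuous_subtype_val)
  have G0 : ∀ t, G (0, t) = γ t := fun t => by simp
  have G1 : ∀ t, G (1, t) = γ' t := fun t => by simp
  have Gs : ∀ t, G (t, 0) = u := fun t => by simp
  have Gt : ∀ t, G (t, 1) = v := fun t => by simp
  let L : Set (I × I) := {x | x.1 = 0 ∨ x.1 = 1 ∨ x.2 = 0 ∨ x.2 = 1}
  have hL : IsClosed L := (isClosed_eq continuous_fst continuous_const).union 
    ((isClosed_eq continuous_fst continuous_const).union 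
    ((isClosed_eq continuous_snd continuous_const).union (isClosed_eq continuous_snd continuous_const)))
  have hu : F.φ u ∉ S.slit := by simpa using h 0
  have hv : F.φ v ∉ S.slit := by simpa using h 1
  obtain ⟨g, h1, h2⟩ := S.push G.toContinuousMap L hL (by
    rintro ⟨s, t⟩ hx
    show F.φ (G (s, t)) ∉ _
    rcases hx with hx | hx | hx | hx <;> simp only at hx <;> subst hx
    · rw [G0]; exact h t
    · rw [G1]; exact h' t
    · rw [Gs]; exact hu
    · rw [Gt]; exact hv)
  have h2' : ∀ s t, (s, t) ∈ L → g (s, t) = G (s, t) := fun s t hst => h2 _ hst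
  let g' : C(I × I, S.W) := ⟨fun x => ⟨g x, S.mem_W.2 (S.slit_ne_c (h1 x))⟩, by fun_prop⟩
  have e0 : ∀ t, g' (0, t) = γ t := by
    intro t
    apply Subtype.ext
    show g (0, t) = γ t
    rw [h2' _ _ (Or.inl rfl), G0]
  have e1 : ∀ t, g' (1, t) = γ' t := by
    intro t
    apply Subtype.ext
    show g (1, t) = γ' t
    rw [h2' _ _ (Or.inr (Or.inl rfl)), G1]
  have e2 : ∀ t, g' (t, 0) = γ 0 := by
    intro t
    apply Subtype.ext
    show g (t, 0) = γ 0
    rw [h2' _ _ (Or.inr (Or.inr (Or.inl rfl))), Gs, γ.source]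
  have e3 : ∀ t, g' (t, 1) = γ 1 := by
    intro t
    apply Subtype.ext
    show g (t, 1) = γ 1
    rw [h2' _ _ (Or.inr (Or.inr (Or.inr rfl))), Gt, γ.target]
  have e4 : ∀ t, ∀ x ∈ ({0, 1} : Set I), g' (t, x) = γ x := by
    intro t x hx
    rcases (show x = 0 ∨ x = 1 from hx) with hh | hh
    · rw [hh]; exact e2 t
    · rw [hh]; exact e3 t
  exact ⟨⟨⟨g', e0, e1⟩, e4⟩⟩

theorem MW (i k) {y : Y} (hy : y ∈ M F (S.Rg i) k) : y ∈ S.W := S.mem_W.2 (S.Rg_ne_c hy.1)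

theorem M_mono {R R' : Set ℂ} (h : R ⊆ R') {k y} (hy : y ∈ M F R k) : y ∈ M F R' k := ⟨h hy.1, hy.2⟩

theorem rotW (a) (y : S.W) : F.rot a y ∈ S.W := by rw [mem_W, F.φ_rot]; exact S.mem_W.1 y.2

def rot (a : ZMod p) (y : S.W) : S.W := ⟨F.rot a y, S.rotW a y⟩

theorem rot_cont (a) : Continuous (S.rot a) := ((F.rot_cont a).comp continuous_subtype_val).subtype_mk _

def vk (y0 : S.W) (hy0 : F.φ y0 ∉ S.slit) : VK p ι S.W (F.U S.c) where
  P := (F.U S.c).restrictPreimage F.P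
  cov := F.cov.restrictPreimage _
  surj := by
    rintro ⟨x, hx⟩
    obtain ⟨y, rfl⟩ := F.surj x
    exact ⟨⟨y, hx⟩, rfl⟩
  rot := S.rot
  rot_cont := S.rot_cont
  rot_zero y := Subtype.ext (F.rot_zero _)
  rot_add a b y := Subtype.ext (F.rot_add _ _ _)
  rot_free a y h := F.rot_free a y (congrArg Subtype.val h)
  P_eq y y' := by
    rw [Subtype.ext_iff]
    refine (F.P_eq y y').trans (exists_congr fun a => ?_)
    rw [Subtype.ext_iff]
    rfl
  W0 := {y | F.φ y ∉ S.slit}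
  isOpen_W0 := S.isClosed_slit.isOpen_compl.preimage (F.φ_cont.comp continuous_subtype_val)
  W0_rot a y hy := by
    show F.φ (F.rot a y) ∉ _
    rw [F.φ_rot]; exact hy
  W0_conn u hu v hv := S.W0_conn u v hu hv
  W0_sc := S.W0_sc
  y0 := y0
  hy0 := hy0
  N i k := {y | (y : Y) ∈ M F (S.Rg i) k}
  Np i k := {y | (y : Y) ∈ M F (S.Rp i) k}
  Nm i k := {y | (y : Y) ∈ M F (S.Rm i) k}
  isOpen_N i k := (S.isOpen_M (S.Rg_T i) (S.Rg_open i) k).preimage continuous_subtype_val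
  isOpen_Np i k := (S.isOpen_M (S.Rp_T i) (S.Rp_open i) k).preimage continuous_subtype_val
  isOpen_Nm i k := (S.isOpen_M (S.Rm_T i) (S.Rm_open i) k).preimage continuous_subtype_val
  N_rot a i k y hy := M_rot a k hy
  Np_rot a i k y hy := M_rot a k hy
  Nm_rot a i k y hy := M_rot a k hy
  cover y := by
    by_cases h : F.φ y ∈ S.slit
    · right
      obtain ⟨i, h1, h2⟩ := h
      have h3 : F.φ y ∈ S.Rg i := by
        refine ⟨lt_of_le_of_ne h2 fun h => ?_, by rw [h1, sub_self, abs_zero]; exact S.he⟩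
        exact S.mem_W.1 y.2 i (Complex.ext h.symm h1)
      obtain ⟨k, hk⟩ := S.exists_M (S.Rg_T i) h3
      exact ⟨i, k, hk⟩
    · exact Or.inl h
  disj i k i' k' y h h' := by
    have := S.strip_unique h.1.2 h'.1.2
    subst this
    exact ⟨rfl, S.M_unique (S.Rg_T i) h h'⟩
  N_W0 i k y h h0 := by
    have h1 : (F.φ y).im ≠ (S.c i).im := fun e => h0 ⟨i, e, h.1.1.le⟩
    have h2 := h.1.2
    rw [abs_lt] at h2
    rcases lt_or_gt_of_ne h1 with h1 | h1
    · exact Or.inr ⟨⟨h.1.1, by linarith, h1⟩, h.2⟩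
    · exact Or.inl ⟨⟨h.1.1, h1, by linarith⟩, h.2⟩
  Np_sub i k y h := ⟨S.Rp_slit h.1, M_mono (S.Rp_sub i) h⟩
  Nm_sub i k y h := ⟨S.Rm_slit h.1, M_mono (S.Rm_sub i) h⟩
  Npm i k y h h' := lt_asymm h.1.2.1 h'.1.2.2
  Np_ne i k := by
    obtain ⟨y, hy⟩ := S.M_ne (S.Rp_T i) (S.Rp_ne i) k
    exact ⟨⟨y, S.MW i k (M_mono (S.Rp_sub i) hy)⟩, hy⟩
  Nm_ne i k := by
    obtain ⟨y, hy⟩ := S.M_ne (S.Rm_T i) (S.Rm_ne i) k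
    exact ⟨⟨y, S.MW i k (M_mono (S.Rm_sub i) hy)⟩, hy⟩
  N_conn i k u hu v hv := by
    have := (S.M_joined (S.Rg_T i) (S.Rg_open i) (S.Rg_convex i) ((S.Rp_ne i).mono (S.Rp_sub i)) k).joinedIn _ hu _ hv
    obtain ⟨γ, hγ⟩ := this
    exact ⟨⟨⟨fun t => ⟨γ t, S.MW i k (hγ t)⟩, by fun_prop⟩, Subtype.ext γ.source, Subtype.ext γ.target⟩, hγ⟩
  hol_p i k u v δ hu hv hδ := S.hol (S.Rg_T i) (S.Rp_sub i) (S.Rg_convex i) (S.Rp_convex i) (S.Rp_ne i) 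
    (fun z hz => S.Rp_slit hz) (fun z hz => S.Rg_ne_c hz) δ (fun t => (hδ t).1) hu.1 hv.1
  hol_m i k u v δ hu hv hδ := S.hol (S.Rg_T i) (S.Rm_sub i) (S.Rg_convex i) (S.Rm_convex i) (S.Rm_ne i) 
    (fun z hz => S.Rm_slit hz) (fun z hz => S.Rg_ne_c hz) δ (fun t => (hδ t).1) hu.1 hv.1

end Gen
end Oka

namespace Oka
open Filter Topology unitInterval CategoryTheory

theorem Gen.main {p : ℕ} [NeZero p] {Y X : Type} [TopologicalSpace Y] [TopologicalSpace X] {F : Fib p Y X} {ι : Type} [Finite ι] 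
    (S : Gen F ι) (x : F.U S.c) : 
    Nonempty (FundamentalGroup (F.U S.c) x ≃* Monoid.Coprod (FreeGroup ι) (Multiplicative (ZMod p))) := by
  have := F.sc
  obtain ⟨y1⟩ := (inferInstance : Nonempty Y)
  obtain ⟨g, h1, -⟩ := S.push (ContinuousMap.const Unit y1) ∅ isClosed_empty (by simp)
  let K := S.vk ⟨g (), S.mem_W.2 (S.slit_ne_c (h1 ()))⟩ (h1 ())
  obtain ⟨y, rfl⟩ := K.surj x
  obtain ⟨γ, -⟩ := K.exists_cp y
  obtain ⟨e⟩ := K.main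
  exact ⟨(FundamentalGroup.fundamentalGroupMulEquivOfPath (K.im γ)).symm.trans e⟩

theorem exists_generic (D : Set ℂ) (hD : D.Finite) : ∃ l : ℂ, l ≠ 0 ∧ ∃ e : ℝ, 0 < e ∧ ∀ d ∈ D, ∀ d' ∈ D, d ≠ d' → 
    2 * e < |(l * d).im - (l * d').im| := by
  let Q : Set (ℂ × ℂ) := {x | x ∈ D ×ˢ D ∧ x.1 ≠ x.2}
  have hQ : Q.Finite := (hD.prod hD).subset fun x hx => hx.1
  have hbad : (⋃ x ∈ Q, {s : ℝ | s * (x.1 - x.2).im + (x.1 - x.2).re = 0}).Finite := by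
    refine hQ.biUnion fun x hx => Set.Subsingleton.finite ?_
    intro s hs s' hs'
    have hs : s * (x.1 - x.2).im + (x.1 - x.2).re = 0 := hs
    have hs' : s' * (x.1 - x.2).im + (x.1 - x.2).re = 0 := hs'
    by_cases h : (x.1 - x.2).im = 0
    · rw [h, mul_zero, zero_add] at hs
      exact absurd (sub_eq_zero.1 (Complex.ext hs h)) hx.2
    · exact mul_right_cancel₀ h (by linarith)
  obtain ⟨s, hs⟩ := hbad.infinite_compl.nonempty
  have hs' : ∀ x ∈ Q, 0 < |(((s : ℂ) + Complex.I) * x.1).im - (((s : ℂ) + Complex.I) * x.2).im| := by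
    intro x hx
    rw [abs_pos]
    intro h
    apply hs
    simp only [Set.mem_iUnion]
    refine ⟨x, hx, ?_⟩
    simp at h ⊢
    linarith
  have : ∀ᶠ e : ℝ in 𝓝[>] 0, ∀ x ∈ Q, 2 * e < |(((s : ℂ) + Complex.I) * x.1).im - (((s : ℂ) + Complex.I) * x.2).im| := by
    rw [Filter.eventually_all_finite hQ]
    intro x hx
    have hc : ContinuousAt (fun e : ℝ => 2 * e) 0 := by fun_prop
    exact (hc.eventually_lt continuousAt_const (by simpa using hs' x hx)).filter_mono nhdsWithin_le_nhds
  obtain ⟨e, he, he0⟩ := (this.and self_mem_nhdsWithin).exists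
  refine ⟨(s : ℂ) + Complex.I, ?_, e, he0, fun d hd d' hd' hdd => he (d, d') ⟨⟨hd, hd'⟩, hdd⟩⟩
  intro h
  have := congrArg Complex.im h
  simp at this

theorem Fib.main {p : ℕ} [NeZero p] {Y X : Type} [TopologicalSpace Y] [TopologicalSpace X] (F : Fib p Y X) {ι : Type} [Finite ι] 
    (c : ι → ℂ) (hc : Function.Injective c) (hcB : ∀ i, c i ∉ F.B) (x : F.U c) : 
    Nonempty (FundamentalGroup (F.U c) x ≃* Monoid.Coprod (FreeGroup ι) (Multiplicative (ZMod p))) := by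
  obtain ⟨l, hl, e, he, hle⟩ := exists_generic (F.B ∪ Set.range c) (F.B_fin.union (Set.finite_range c))
  obtain ⟨m, rfl⟩ := IsAlgClosed.exists_pow_nat_eq l (Nat.pos_of_ne_zero (NeZero.ne p))
  have hm : m ≠ 0 := by
    rintro rfl
    exact hl (zero_pow (NeZero.ne p))
  let S : Gen (F.scale m hm) ι := 
    { c := fun i => m ^ p * c i
      e := e
      he := he
      hB := by
        rintro i _ ⟨d, hd, rfl⟩
        have := hle d (Or.inl hd) (c i) (Or.inr ⟨i, rfl⟩) fun h => hcB i (h ▸ hd)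
        simp only
        linarith
      hc := by
        intro i j hij
        exact hle _ (Or.inr ⟨j, rfl⟩) _ (Or.inr ⟨i, rfl⟩) fun h => hij (hc h).symm }
  have hU : F.U c = (F.scale m hm).U S.c := by
    ext x
    refine forall_congr' fun y => forall_congr' fun hy => forall_congr' fun i => ?_
    rw [Ne, Ne, not_iff_not]
    show _ ↔ (m * F.ψ y) ^ p = m ^ p * c i
    rw [mul_pow, mul_right_inj' (pow_ne_zero _ hm)]
    rfl
  revert x
  rw [hU]
  exact S.main

end Oka

namespace Oka
open Filter Topology unitInterval CategoryTheory
namespace Dat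
variable (D : Dat)

abbrev Y : Type := {v : Fin 3 → ℂ // D.P v = 1}

theorem φ_Y (y : D.Y) : D.φ y = D.Q y ^ D.p := by rw [φ, y.2, one_pow, div_one]

theorem exists_bezout : ∃ m n : ℤ, (D.p : ℤ) * m + D.q * n = 1 := by
  have := D.hpq
  rw [← Nat.isCoprime_iff_coprime] at this
  obtain ⟨m, n, h⟩ := this
  exact ⟨m, n, by rw [← h]; ring⟩

theorem transY : ∃ B : Set ℂ, B.Finite ∧ 0 ∈ B ∧ Trans (fun y : D.Y => D.Q y ^ D.p) B := by
  obtain ⟨B, hB, hB0, h⟩ := D.exists_transport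
  refine ⟨B, hB, hB0, ?_⟩
  intro c0 hc0
  obtain ⟨ε2, hε2, Φ, hΦc, hΦ⟩ := h c0 hc0
  have hc00 : c0 ≠ 0 := fun h => hc0 (h ▸ hB0)
  have hn : 0 < ‖c0‖ := norm_pos_iff.2 hc00
  obtain ⟨m, n, hmn⟩ := D.exists_bezout
  have hp0 : D.p ≠ 0 := by have := D.hp; omega
  set ε := min ε2 (‖c0‖ / 3) with hε
  have hεε : ε ≤ ε2 := min_le_left _ _
  have hεc : ε ≤ ‖c0‖ / 3 := min_le_right _ _
  have big : ∀ c, ‖c - c0‖ < ε → 2 / 3 * ‖c0‖ < ‖c‖ := by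
    intro c hc
    have : ‖c0‖ ≤ ‖c0 - c‖ + ‖c‖ := by simpa using norm_add_le (c0 - c) c
    rw [norm_sub_rev] at this
    linarith
  have ne : ∀ c, ‖c - c0‖ < ε → c ≠ 0 := by
    intro c hc h
    have := big c hc
    rw [h, norm_zero] at this
    linarith
  have slit : ∀ c c', ‖c - c0‖ < ε → ‖c' - c0‖ < ε → c / c' ∈ Complex.slitPlane := by
    intro c c' hc hc'
    have h1 := big c' hc'
    have h2 : ‖c - c'‖ < 2 / 3 * ‖c0‖ := by
      have : ‖c - c'‖ ≤ ‖c - c0‖ + ‖c' - c0‖ := by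
        rw [norm_sub_rev c' c0]
        simpa using norm_add_le (c - c0) (c0 - c')
      linarith
    have h3 : ‖c / c' - 1‖ < 1 := by
      rw [div_sub_one (ne c' hc'), norm_div, div_lt_one (by linarith)]
      linarith
    left
    have h4 := (abs_lt.1 ((Complex.abs_re_le_norm _).trans_lt h3)).1
    simp at h4
    linarith
  let r : ℂ → D.Y → ℂ := fun c y => (c / D.Q y ^ D.p) ^ ((D.p : ℂ)⁻¹)
  let lam : ℂ → D.Y → ℂ := fun c y => D.P (Φ c y) ^ (-m) * (D.Q y * r c y / D.Q (Φ c y)) ^ n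
  let w : ℂ → D.Y → Fin 3 → ℂ := fun c y => lam c y • Φ c y
  have hOm : ∀ c (y : D.Y), ‖c - c0‖ < ε → ‖D.Q y ^ D.p - c0‖ < ε → (c, (y : Fin 3 → ℂ)) ∈ D.Om c0 ε2 := by
    intro c y h1 h2
    refine ⟨h1.trans_le hεε, by rw [y.2]; exact one_ne_zero, ?_⟩
    rw [φ_Y]
    exact h2.trans_le hεε
  have hQne : ∀ c (y : D.Y), ‖c - c0‖ < ε → ‖D.Q y ^ D.p - c0‖ < ε → D.Q (Φ c y) ≠ 0 := by
    intro c y h1 h2 h0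
    obtain ⟨h3, h4, -⟩ := hΦ c y (hOm c y h1 h2)
    rw [φ, h0, zero_pow hp0, zero_div] at h4
    exact ne c h1 h4.symm
  have hlam : ∀ c (y : D.Y), ‖c - c0‖ < ε → ‖D.Q y ^ D.p - c0‖ < ε → lam c y ^ D.p * D.P (Φ c y) = 1 := by
    intro c y h1 h2
    obtain ⟨h3, h4, -⟩ := hΦ c y (hOm c y h1 h2)
    have h5 := (D.φ_eq_iff h3 c).1 h4
    have h6 : (D.Q y * r c y / D.Q (Φ c y)) ^ D.p = (D.P (Φ c y) ^ D.q)⁻¹ := by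
      rw [div_pow, mul_pow, h5, Complex.cpow_nat_inv_pow _ hp0, mul_div_cancel₀ _ (ne _ h2)]
      rw [← div_div, div_self (ne c h1), one_div]
    have h7 : lam c y ^ D.p = (D.P (Φ c y)) ^ (-(D.p * m) : ℤ) * ((D.Q y * r c y / D.Q (Φ c y)) ^ D.p) ^ n := by
      simp only [lam]
      rw [mul_pow, ← zpow_natCast, ← zpow_mul, ← zpow_natCast, ← zpow_natCast, ← zpow_mul, ← zpow_mul]
      congr 2 <;> ring
    rw [h7, h6, ← zpow_natCast, ← zpow_neg, ← zpow_mul, ← zpow_add₀ h3]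
    rw [show (-(D.p * m) + -(D.q : ℤ) * n : ℤ) = -1 by linarith]
    rw [zpow_neg_one, inv_mul_cancel₀ h3]
  have hw : ∀ c (y : D.Y), ‖c - c0‖ < ε → ‖D.Q y ^ D.p - c0‖ < ε → D.P (w c y) = 1 := by
    intro c y h1 h2
    rw [P_smul]
    exact hlam c y h1 h2
  classical
  refine ⟨ε, by positivity, fun c y => if h : D.P (w c y) = 1 then ⟨w c y, h⟩ else y, ?_, ?_⟩
  · refine (Topology.IsInducing.subtypeVal (t := {v | D.P v = 1})).continuousOn_iff.2 ?_
    have hwc : ContinuousOn (fun x : ℂ × D.Y => w x.1 x.2) {x | ‖x.1 - c0‖ < ε ∧ ‖D.Q x.2 ^ D.p - c0‖ < ε} := by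
      have c1 : ContinuousOn (fun x : ℂ × D.Y => Φ x.1 x.2) {x | ‖x.1 - c0‖ < ε ∧ ‖D.Q x.2 ^ D.p - c0‖ < ε} := 
        hΦc.comp (f := fun x : ℂ × D.Y => (x.1, (x.2 : Fin 3 → ℂ))) (by fun_prop) fun x hx => hOm _ _ hx.1 hx.2
      have cQ : Continuous fun x : ℂ × D.Y => D.Q x.2 := D.continuous_Q.comp (continuous_subtype_val.comp continuous_snd)
      have c2 : ContinuousOn (fun x : ℂ × D.Y => r x.1 x.2) {x | ‖x.1 - c0‖ < ε ∧ ‖D.Q x.2 ^ D.p - c0‖ < ε} := by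
        refine ContinuousOn.cpow_const (continuous_fst.continuousOn.div (cQ.pow _).continuousOn fun x hx => ne _ hx.2) ?_
        intro x hx
        exact slit _ _ hx.1 hx.2
      have c3 := D.continuous_P.comp_continuousOn c1
      have c4 := D.continuous_Q.comp_continuousOn c1
      suffices hl : ContinuousOn (fun x : ℂ × D.Y => lam x.1 x.2) {x | ‖x.1 - c0‖ < ε ∧ ‖D.Q x.2 ^ D.p - c0‖ < ε} from hl.smul c1
      refine ContinuousOn.mul ?_ ?_
      · exact c3.zpow₀ _ fun x hx => Or.inl (hΦ _ _ (hOm _ _ hx.1 hx.2)).1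
      · refine ContinuousOn.zpow₀ ((cQ.continuousOn.mul c2).div c4 fun x hx => hQne _ _ hx.1 hx.2) _ fun x hx => Or.inl ?_
        refine div_ne_zero (mul_ne_zero (fun h => ?_) ?_) (hQne _ _ hx.1 hx.2)
        · apply ne _ hx.2
          simp only at h
          rw [h, zero_pow hp0]
        · intro h
          have := Complex.cpow_nat_inv_pow (x.1 / D.Q x.2 ^ D.p) hp0
          simp only [r] at h
          rw [h, zero_pow hp0] at this
          exact div_ne_zero (ne _ hx.1) (ne _ hx.2) this.symm
    refine hwc.congr fun x hx => ?_
    simp only [Function.comp]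
    rw [dif_pos (hw x.1 x.2 hx.1 hx.2)]
  · intro c y h1 h2
    simp only at h2 ⊢
    rw [dif_pos (hw c y h1 h2)]
    obtain ⟨h3, h4, h5⟩ := hΦ c y (hOm c y h1 h2)
    have hl0 : lam c y ≠ 0 := by
      intro h
      have := hlam c y h1 h2
      rw [h, zero_pow hp0, zero_mul] at this
      exact zero_ne_one this
    constructor
    · show D.Q (w c y) ^ D.p = c
      have := D.φ_smul hl0 (Φ c y)
      have h9 := hw c y h1 h2
      rw [h4] at this
      show D.Q (lam c y • Φ c y) ^ D.p = c
      refine Eq.trans ?_ this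
      rw [φ, show D.P (lam c y • Φ c y) = 1 from h9, one_pow, div_one]
    · intro h6
      have h7 := h5 (by rw [φ_Y]; exact h6)
      apply Subtype.ext
      show w c y = y
      have h8 : D.Q y ≠ 0 := by
        have := hQne c y h1 h2
        rwa [h7] at this
      have : lam c y = 1 := by
        simp only [lam, r]
        rw [h7, y.2, h6, div_self (ne c h1), Complex.one_cpow, mul_one, div_self h8]
        simp
      simp only [w]
      rw [this, one_smul, h7]

end Dat
end Oka

namespace Oka
open Filter Topology unitInterval CategoryTheory

theorem mem_V_mk {f : MvPolynomial (Fin 3) ℂ} {n : ℕ} (hf : f.IsHomogeneous n) {v : Fin 3 → ℂ} (hv : v ≠ 0) : 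
    Projectivization.mk ℂ v hv ∈ V f ↔ eval v f = 0 := by
  obtain ⟨a, ha⟩ := Projectivization.exists_smul_eq_mk_rep ℂ v hv
  show eval (Projectivization.mk ℂ v hv).rep f = 0 ↔ _
  rw [← ha, Units.smul_def, eval_smul_hom hf]
  simp

namespace Dat
variable (D : Dat)

instance : NeZero D.p := ⟨by have := D.hp; omega⟩

theorem P_zero : D.P 0 = 0 := by
  have := D.P_smul 0 0
  rwa [zero_smul, zero_pow (NeZero.ne _), zero_mul] at this

theorem ne_zero_of {v : Fin 3 → ℂ} (h : D.P v ≠ 0) : v ≠ 0 := by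
  rintro rfl
  exact h D.P_zero

theorem y_ne (y : D.Y) : (y : Fin 3 → ℂ) ≠ 0 := D.ne_zero_of (by rw [y.2]; exact one_ne_zero)

abbrev X : Type := ↥(V D.fp)ᶜ

def pj (y : D.Y) : D.X := ⟨Projectivization.mk ℂ y (D.y_ne y), by
  rw [Set.mem_compl_iff, mem_V_mk D.hfp]; exact fun h => one_ne_zero (y.2.symm.trans h)⟩

theorem mk_cont : Continuous fun v : {v : Fin 3 → ℂ // v ≠ 0} => (Projectivization.mk ℂ v.1 v.2 : P2) := 
  continuous_quotient_mk'

theorem pj_cont : Continuous D.pj := 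
  (mk_cont.comp (f := fun y : D.Y => (⟨y, D.y_ne y⟩ : {v : Fin 3 → ℂ // v ≠ 0})) (by fun_prop)).subtype_mk _

/-- normalization -/
theorem exists_norm {v : Fin 3 → ℂ} (h : D.P v ≠ 0) : ∃ l : ℂ, l ≠ 0 ∧ D.P (l • v) = 1 := by
  obtain ⟨l, hl⟩ := IsAlgClosed.exists_pow_nat_eq (D.P v)⁻¹ (Nat.pos_of_ne_zero (NeZero.ne D.p))
  refine ⟨l, ?_, by rw [P_smul, hl, inv_mul_cancel₀ h]⟩
  rintro rfl
  rw [zero_pow (NeZero.ne _)] at hl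
  exact h (inv_eq_zero.1 hl.symm)

theorem exists_rep (x : D.X) : ∃ v : Fin 3 → ℂ, ∃ hv : v ≠ 0, D.P v ≠ 0 ∧ Projectivization.mk ℂ v hv = x.1 := by
  refine ⟨x.1.rep, x.1.rep_nonzero, ?_, x.1.mk_rep⟩
  have := x.2
  rw [← x.1.mk_rep, Set.mem_compl_iff, mem_V_mk D.hfp] at this
  exact this

theorem pj_eq {v : Fin 3 → ℂ} (hv : v ≠ 0) {l : ℂ} (hl : l ≠ 0) (h : D.P (l • v) = 1) : 
    (D.pj ⟨l • v, h⟩).1 = Projectivization.mk ℂ v hv := by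
  show Projectivization.mk ℂ (l • v) _ = _
  rw [Projectivization.mk_eq_mk_iff']
  exact ⟨l, rfl⟩

theorem pj_surj : Function.Surjective D.pj := by
  intro x
  obtain ⟨v, hv, h, hx⟩ := D.exists_rep x
  obtain ⟨l, hl, h1⟩ := D.exists_norm h
  exact ⟨⟨l • v, h1⟩, Subtype.ext ((D.pj_eq hv hl h1).trans hx)⟩

theorem isOpen_ne : IsOpen {v : Fin 3 → ℂ | D.P v ≠ 0} := isOpen_ne_fun D.continuous_P continuous_const

/-- local continuous normalization -/
theorem local_norm {v0 : Fin 3 → ℂ} {l0 : ℂ} (h : D.P (l0 • v0) = 1) : ∃ l : (Fin 3 → ℂ) → ℂ, ContinuousAt l v0 ∧ 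
    l v0 = l0 ∧ ∀ v, D.P v ≠ 0 → D.P (l v • v) = 1 := by
  rw [P_smul] at h
  have h0 : D.P v0 ≠ 0 := right_ne_zero_of_mul (h ▸ one_ne_zero)
  refine ⟨fun v => l0 * (D.P v0 / D.P v) ^ ((D.p : ℂ)⁻¹), ?_, ?_, ?_⟩
  · refine continuousAt_const.mul (ContinuousAt.cpow (continuousAt_const.div D.continuous_P.continuousAt h0) continuousAt_const ?_)
    rw [div_self h0]
    exact Complex.one_mem_slitPlane
  · simp only
    rw [div_self h0, Complex.one_cpow, mul_one]
  · intro v hv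
    rw [P_smul, mul_pow, Complex.cpow_nat_inv_pow _ (NeZero.ne _), mul_div_assoc', h, div_mul_cancel₀ _ hv]

theorem pj_open : IsOpenMap D.pj := by
  intro O hO
  obtain ⟨O', hO', rfl⟩ := isOpen_induced_iff.1 hO
  have key : IsOpen {v : Fin 3 → ℂ | ∃ l : ℂ, D.P (l • v) = 1 ∧ l • v ∈ O'} := by
    rw [isOpen_iff_eventually]
    rintro v0 ⟨l0, h1, h2⟩
    obtain ⟨l, hl, hl0, hlP⟩ := D.local_norm h1
    have h0 : D.P v0 ≠ 0 := by
      rw [P_smul] at h1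
      exact right_ne_zero_of_mul (h1 ▸ one_ne_zero)
    have h3 : ContinuousAt (fun v => l v • v) v0 := hl.smul continuousAt_id
    have h4 : ∀ᶠ v in 𝓝 v0, l v • v ∈ O' := h3 (hO'.mem_nhds (by simp only [hl0]; exact h2))
    filter_upwards [h4, D.isOpen_ne.mem_nhds h0] with v h4 h5
    exact ⟨l v, hlP v h5, h4⟩
  let O2 : Set P2 := {x | ∃ y : D.Y, (y : Fin 3 → ℂ) ∈ O' ∧ (D.pj y).1 = x}
  have hO2 : IsOpen O2 := by
    have : IsOpen ((fun v : {v : Fin 3 → ℂ // v ≠ 0} => (Projectivization.mk ℂ v.1 v.2 : P2)) ⁻¹' O2) := by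
      have e : ((fun v : {v : Fin 3 → ℂ // v ≠ 0} => (Projectivization.mk ℂ v.1 v.2 : P2)) ⁻¹' O2) = 
          Subtype.val ⁻¹' {v : Fin 3 → ℂ | ∃ l : ℂ, D.P (l • v) = 1 ∧ l • v ∈ O'} := by
        ext ⟨v, hv⟩
        constructor
        · rintro ⟨y, hy, hyx⟩
          have hyx : Projectivization.mk ℂ (y : Fin 3 → ℂ) _ = Projectivization.mk ℂ v hv := hyx
          rw [Projectivization.mk_eq_mk_iff'] at hyx
          obtain ⟨l, hl⟩ := hyx
          exact ⟨l, by rw [hl]; exact y.2, by rw [hl]; exact hy⟩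
        · rintro ⟨l, h1, h2⟩
          have hl : l ≠ 0 := by
            rintro rfl
            rw [zero_smul, P_zero] at h1
            exact zero_ne_one h1
          exact ⟨⟨l • v, h1⟩, h2, D.pj_eq hv hl h1⟩
      rw [e]
      exact key.preimage continuous_subtype_val
    exact this
  have : D.pj '' (Subtype.val ⁻¹' O') = Subtype.val ⁻¹' O2 := by
    ext x
    constructor
    · rintro ⟨y, hy, rfl⟩
      exact ⟨y, hy, rfl⟩
    · rintro ⟨y, hy, hyx⟩
      exact ⟨y, hy, Subtype.ext hyx⟩
  rw [this]
  exact hO2.preimage continuous_subtype_val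

def rt (a : ZMod D.p) (y : D.Y) : D.Y := ⟨zt D.p ((D.q : ZMod D.p)⁻¹ * a) • y, by rw [P_smul, zt_pow, y.2, one_mul]⟩

theorem q_inv : (D.q : ZMod D.p) * (D.q : ZMod D.p)⁻¹ = 1 := ZMod.coe_mul_inv_eq_one _ D.hpq.symm

theorem zt_q (a : ZMod D.p) : zt D.p ((D.q : ZMod D.p)⁻¹ * a) ^ D.q = zt D.p a := by
  rw [zt, ← AddChar.map_nsmul_eq_pow, nsmul_eq_mul, ← mul_assoc, q_inv, one_mul]

theorem rt_cont (a) : Continuous (D.rt a) := by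
  have h : Continuous fun y : D.Y => zt D.p ((D.q : ZMod D.p)⁻¹ * a) • (y : Fin 3 → ℂ) := by fun_prop
  exact h.subtype_mk _

theorem rt_zero (y) : D.rt 0 y = y := by
  apply Subtype.ext
  show zt D.p _ • y.1 = y.1
  rw [mul_zero, zt, AddChar.map_zero_eq_one, one_smul]

theorem rt_add (a b y) : D.rt (a + b) y = D.rt a (D.rt b y) := by
  apply Subtype.ext
  show zt D.p _ • y.1 = zt D.p _ • zt D.p _ • y.1
  rw [mul_add, zt_add, smul_smul]

theorem Q_rt (a y) : D.Q (D.rt a y) = zt D.p a * D.Q y := by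
  show D.Q (zt D.p _ • y.1) = _
  rw [Q_smul, zt_q]

theorem rt_free (a y) (h : D.rt a y = y) : a = 0 := by
  have h1 : zt D.p ((D.q : ZMod D.p)⁻¹ * a) • y.1 = (1 : ℂ) • y.1 := by rw [one_smul]; exact congrArg Subtype.val h
  have h2 := smul_left_injective ℂ (D.y_ne y) h1
  have h3 := D.zt_q a
  rw [h2, one_pow] at h3
  apply zt_inj D.p
  rw [← h3, zt, AddChar.map_zero_eq_one]

theorem pj_rt (y y') : D.pj y = D.pj y' ↔ ∃ a, y' = D.rt a y := by
  rw [Subtype.ext_iff]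
  show Projectivization.mk ℂ y.1 _ = Projectivization.mk ℂ y'.1 _ ↔ _
  rw [eq_comm, Projectivization.mk_eq_mk_iff']
  constructor
  · rintro ⟨l, hl⟩
    obtain ⟨b, hb⟩ := exists_zt D.p l (by
      have := y'.2
      rw [← hl, P_smul, y.2, mul_one] at this
      exact this)
    refine ⟨D.q * b, Subtype.ext ?_⟩
    show _ = zt D.p _ • y.1
    rw [← mul_assoc, mul_comm _ (D.q : ZMod D.p), q_inv, one_mul, hb, hl]
  · rintro ⟨a, rfl⟩
    exact ⟨_, rfl⟩

instance : MulAction (Multiplicative (ZMod D.p)) D.Y where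
  smul a y := D.rt a.toAdd y
  one_smul y := D.rt_zero y
  mul_smul a b y := D.rt_add _ _ y

instance : ContinuousConstSMul (Multiplicative (ZMod D.p)) D.Y := ⟨fun a => D.rt_cont a.toAdd⟩

instance : IsCancelSMul (Multiplicative (ZMod D.p)) D.Y := 
  isCancelSMul_iff_eq_one_of_smul_eq.2 fun a y h => D.rt_free a.toAdd y h

theorem isClosed_Y : IsClosed {v : Fin 3 → ℂ | D.P v = 1} := isClosed_eq D.continuous_P continuous_const

instance : LocallyCompactSpace D.Y := D.isClosed_Y.locallyCompactSpace

theorem pj_qc : IsQuotientCoveringMap D.pj (Multiplicative (ZMod D.p)) := by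
  have hq : IsQuotientMap D.pj := D.pj_open.isQuotientMap D.pj_cont D.pj_surj
  refine (hq.isQuotientCoveringMap_of_properlyDiscontinuousSMul (G := Multiplicative (ZMod D.p)) ?_)
  intro y y'
  rw [eq_comm, pj_rt]
  constructor
  · rintro ⟨a, rfl⟩
    exact ⟨Multiplicative.ofAdd a, rfl⟩
  · rintro ⟨a, rfl⟩
    exact ⟨a.toAdd, rfl⟩

theorem pj_cov : IsCoveringMap D.pj := D.pj_qc.isCoveringMap

end Dat
end Oka

namespace Oka
open Filter Topology unitInterval CategoryTheory

namespace Dat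
variable (D : Dat)

theorem lpcY : LocallyPathConnectedSpace D.Y := by
  let S : Set (Fin 3 → ℂ) := {v | D.P v ∈ Complex.slitPlane}
  have hS : IsOpen S := Complex.isOpen_slitPlane.preimage D.continuous_P
  have := hS.locallyPathConnectedSpace
  have h1 : ∀ v : S, D.P ((D.P v) ^ (-(D.p : ℂ)⁻¹) • (v : Fin 3 → ℂ)) = 1 := by
    intro v
    rw [P_smul, Complex.cpow_neg, inv_pow, Complex.cpow_nat_inv_pow _ (NeZero.ne _), inv_mul_cancel₀]
    exact Complex.slitPlane_ne_zero v.2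
  let r : S → D.Y := fun v => ⟨_, h1 v⟩
  have hr : Continuous r := by
    refine Continuous.subtype_mk (f := fun v : S => (D.P v) ^ (-(D.p : ℂ)⁻¹) • (v : Fin 3 → ℂ)) ?_ _
    have h3 : Continuous fun v : S => (v : Fin 3 → ℂ) := continuous_subtype_val
    have h2 : Continuous fun v : S => D.P v := D.continuous_P.comp continuous_subtype_val
    exact (h2.cpow continuous_const fun v => v.2).smul h3
  let i : D.Y → S := fun y => ⟨y, by show D.P y ∈ Complex.slitPlane; rw [y.2]; exact Complex.one_mem_slitPlane⟩
  have hi : Continuous i := continuous_subtype_val.subtype_mk _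
  have hri : Function.LeftInverse r i := by
    intro y
    apply Subtype.ext
    show (D.P y) ^ (-(D.p : ℂ)⁻¹) • (y : Fin 3 → ℂ) = y
    rw [y.2, Complex.one_cpow, one_smul]
  exact (IsQuotientMap.of_inverse hi hr hri).locallyPathConnectedSpace

theorem exists_simple : ∃ v k, D.P v = 0 ∧ MvPolynomial.eval v (pderiv k D.fp) ≠ 0 := by
  obtain ⟨k, hk⟩ := D.exists_pderiv
  by_contra! h
  apply hk
  apply D.not_dvd_pderiv k
  have hpr : (Ideal.span {D.fp}).IsPrime := by
    rw [Ideal.span_singleton_prime D.hfp0]; exact D.hirr.prime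
  rw [← Ideal.mem_span_singleton, ← hpr.radical, ← vanishingIdeal_zeroLocus_eq_radical (K := ℂ), mem_vanishingIdeal_iff]
  intro x hx
  rw [zeroLocus_span] at hx
  exact h x k (hx D.fp rfl)

theorem root_path : ∃ y : D.Y, Joined y (D.rt (-(D.q : ZMod D.p)) y) := by
  obtain ⟨v, k, hv, hk⟩ := D.exists_simple
  set d := MvPolynomial.eval v (pderiv k D.fp) with hd
  let e : Fin 3 → ℂ := Pi.single k 1
  let g : ℂ → ℂ := fun t => D.P (v + t • e)
  have hg : HasDerivAt g d 0 := by
    have h1 := (hasStrictFDerivAt_eval D.fp v).hasFDerivAt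
    have h2 : HasDerivAt (fun t : ℂ => v + t • e) e 0 := by
      have := ((hasDerivAt_id (0 : ℂ)).smul_const e).const_add v
      simpa using this
    have h3 : v = v + (0 : ℂ) • e := by simp
    have h4 := HasFDerivAt.comp_hasDerivAt (0 : ℂ) (h3 ▸ h1) h2
    rw [← h3] at h4
    have h5 : (∑ k, MvPolynomial.eval v (pderiv k D.fp) • (ContinuousLinearMap.proj k : (Fin 3 → ℂ) →L[ℂ] ℂ)) e = d := by
      rw [hd]
      simp [e, Pi.single_apply]
    rw [h5] at h4
    exact h4
  have hg0 : g 0 = 0 := by show D.P _ = 0; rw [zero_smul, add_zero]; exact hv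
  have hgc : Continuous g := D.continuous_P.comp (by fun_prop)
  have ht : Tendsto (fun t => g t / (t * d)) (𝓝[≠] 0) (𝓝 1) := by
    have := hg.tendsto_slope
    have h2 := this.div_const d
    rw [div_self hk] at h2
    refine h2.congr' ?_
    filter_upwards [self_mem_nhdsWithin] with t ht
    rw [slope_def_field, hg0, sub_zero, sub_zero, div_div]
  have hev : ∀ᶠ t in 𝓝[≠] (0 : ℂ), g t / (t * d) ∈ Complex.slitPlane := 
    ht (Complex.isOpen_slitPlane.mem_nhds Complex.one_mem_slitPlane)
  rw [eventually_nhdsWithin_iff, Metric.eventually_nhds_iff] at hev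
  obtain ⟨ε', hε', hev⟩ := hev
  set ε := ε' / 2 with hε
  have hε0 : 0 < ε := by positivity
  have hεC : (ε : ℂ) ≠ 0 := by exact_mod_cast hε0.ne'
  let T : I → ℂ := fun s => ε * Complex.exp (2 * Real.pi * Complex.I * s)
  have hT0 : ∀ s, T s ≠ 0 := fun s => mul_ne_zero hεC (Complex.exp_ne_zero _)
  have hTc : Continuous T := by
    have : Continuous fun s : I => ((s : ℝ) : ℂ) := Complex.continuous_ofReal.comp continuous_subtype_val
    exact continuous_const.mul (Complex.continuous_exp.comp (continuous_const.mul this))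
  have hTn : ∀ s, ‖T s‖ = ε := by
    intro s
    have : (2 * Real.pi * Complex.I * s : ℂ) = ((2 * Real.pi * s : ℝ) : ℂ) * Complex.I := by push_cast; ring
    show ‖(ε : ℂ) * Complex.exp (2 * Real.pi * Complex.I * s)‖ = ε
    rw [norm_mul, this, Complex.norm_exp_ofReal_mul_I, mul_one, Complex.norm_real, Real.norm_of_nonneg hε0.le]
  have hslit : ∀ s, g (T s) / (T s * d) ∈ Complex.slitPlane := by
    intro s
    refine hev ?_ (hT0 s)
    rw [dist_zero_right, hTn, hε]
    linarith
  obtain ⟨m, hm⟩ := IsAlgClosed.exists_pow_nat_eq ((ε : ℂ) * d)⁻¹ (Nat.pos_of_ne_zero (NeZero.ne D.p))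
  let l : I → ℂ := fun s => m * Complex.exp (-(2 * Real.pi * Complex.I * s) / D.p) * (g (T s) / (T s * d)) ^ (-(D.p : ℂ)⁻¹)
  have hpC : (D.p : ℂ) ≠ 0 := by exact_mod_cast NeZero.ne D.p
  have hl : ∀ s, D.P (l s • (v + T s • e)) = 1 := by
    intro s
    have h0 := Complex.slitPlane_ne_zero (hslit s)
    rw [P_smul, mul_pow, mul_pow, hm, Complex.cpow_neg, inv_pow, Complex.cpow_nat_inv_pow _ (NeZero.ne _), 
      ← Complex.exp_nat_mul, mul_div_cancel₀ _ hpC]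
    change _ * g (T s) = 1
    have h1 : g (T s) ≠ 0 := fun h => h0 (by rw [h, zero_div])
    rw [Complex.exp_neg]
    have h2 : T s = ε * Complex.exp (2 * Real.pi * Complex.I * s) := rfl
    have h3 := Complex.exp_ne_zero (2 * Real.pi * Complex.I * s)
    rw [h2] at h1 ⊢
    field_simp
  have hlc : Continuous l := by
    have : Continuous fun s : I => ((s : ℝ) : ℂ) := Complex.continuous_ofReal.comp continuous_subtype_val
    refine (continuous_const.mul (Complex.continuous_exp.comp ?_)).mul (Continuous.cpow ?_ continuous_const hslit)
    · exact ((continuous_const.mul this).neg).div_const _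
    · exact (hgc.comp hTc).div (hTc.mul continuous_const) fun s => mul_ne_zero (hT0 s) hk
  let Γ : I → D.Y := fun s => ⟨_, hl s⟩
  have hΓ : Continuous Γ := (hlc.smul (continuous_const.add (hTc.smul continuous_const))).subtype_mk _
  refine ⟨Γ 0, ⟨⟨⟨Γ, hΓ⟩, rfl, ?_⟩⟩⟩
  have hT1 : T 1 = T 0 := by
    show (ε : ℂ) * Complex.exp (2 * Real.pi * Complex.I * ((1 : ℝ) : ℂ)) = (ε : ℂ) * Complex.exp (2 * Real.pi * Complex.I * ((0 : ℝ) : ℂ))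
    simp
  apply Subtype.ext
  show l 1 • (v + T 1 • e) = zt D.p _ • (l 0 • (v + T 0 • e))
  rw [hT1, smul_smul]
  congr 1
  rw [mul_neg, mul_comm (D.q : ZMod D.p)⁻¹, q_inv]
  have hz : zt D.p (-1) = Complex.exp (-(2 * Real.pi * Complex.I) / D.p) := by
    have := ZMod.stdAddChar_coe (N := D.p) (-1)
    push_cast at this
    rw [zt, this]
    congr 1
    ring
  rw [hz]
  show m * Complex.exp (-(2 * Real.pi * Complex.I * ((1 : ℝ) : ℂ)) / D.p) * (g (T 1) / (T 1 * d)) ^ (-(D.p : ℂ)⁻¹) = _ *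
    (m * Complex.exp (-(2 * Real.pi * Complex.I * ((0 : ℝ) : ℂ)) / D.p) * (g (T 0) / (T 0 * d)) ^ (-(D.p : ℂ)⁻¹))
  rw [hT1]
  simp
  ring

theorem joined_rt {y y' : D.Y} (h : Joined y y') (a) : Joined (D.rt a y) (D.rt a y') := by
  obtain ⟨γ⟩ := h
  exact ⟨γ.map (D.rt_cont a)⟩

theorem joined_line (y y' : D.Y) : ∃ a, Joined y (D.rt a y') := by
  let R : Polynomial ℂ := aeval (fun i => Polynomial.C (y.1 i) + Polynomial.X * Polynomial.C (y'.1 i - y.1 i)) D.fp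
  have hR : ∀ t, R.eval t = D.P (y.1 + t • (y'.1 - y.1)) := by
    intro t
    show Polynomial.eval t (aeval _ D.fp) = _
    rw [← Polynomial.coe_evalRingHom, aeval_def, Polynomial.algebraMap_eq, hom_eval₂]
    show _ = eval₂ (RingHom.id ℂ) _ D.fp
    congr 1
    · ext x; simp
    · ext i; simp
  have hR0 : R ≠ 0 := by
    intro h
    have := hR 0
    rw [h, zero_smul, add_zero, y.2, Polynomial.eval_zero] at this
    exact zero_ne_one this
  have hfin : {t : ℂ | D.P (y.1 + t • (y'.1 - y.1)) = 0}.Finite := by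
    refine (Polynomial.finite_setOf_isRoot hR0).subset ?_
    intro t ht
    exact (hR t).trans ht
  have hpc := hfin.countable.isPathConnected_compl_of_one_lt_rank (by rw [Complex.rank_real_complex]; norm_num)
  have h0 : (0 : ℂ) ∈ {t : ℂ | D.P (y.1 + t • (y'.1 - y.1)) = 0}ᶜ := by
    show ¬ D.P _ = 0
    rw [zero_smul, add_zero, y.2]; exact one_ne_zero
  have h1 : (1 : ℂ) ∈ {t : ℂ | D.P (y.1 + t • (y'.1 - y.1)) = 0}ᶜ := by
    show ¬ D.P _ = 0
    rw [one_smul, add_sub_cancel, y'.2]; exact one_ne_zero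
  obtain ⟨γ, hγ⟩ := hpc.joinedIn 0 h0 1 h1
  have hv : ∀ s, y.1 + γ s • (y'.1 - y.1) ≠ 0 := fun s => D.ne_zero_of (hγ s)
  let δ : C(I, D.X) := ⟨fun s => ⟨Projectivization.mk ℂ _ (hv s), by
    rw [Set.mem_compl_iff, mem_V_mk D.hfp]; exact hγ s⟩, by
      refine Continuous.subtype_mk ?_ _
      exact mk_cont.comp (f := fun s => (⟨_, hv s⟩ : {v : Fin 3 → ℂ // v ≠ 0})) (by fun_prop)⟩
  have hδ0 : δ 0 = D.pj y := by
    apply Subtype.ext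
    show Projectivization.mk ℂ _ _ = Projectivization.mk ℂ _ _
    congr 1
    rw [γ.source, zero_smul, add_zero]
  have hδ1 : δ 1 = D.pj y' := by
    apply Subtype.ext
    show Projectivization.mk ℂ _ _ = Projectivization.mk ℂ _ _
    congr 1
    rw [γ.target, one_smul, add_sub_cancel]
  let L := D.pj_cov.liftPath δ y hδ0
  have hL1 : D.pj (L 1) = D.pj y' := by
    rw [← hδ1]
    exact congrFun (D.pj_cov.liftPath_lifts δ y hδ0) 1
  obtain ⟨a, ha⟩ := (D.pj_rt _ _).1 hL1.symm
  exact ⟨a, ⟨⟨L, D.pj_cov.liftPath_zero δ y hδ0, ha⟩⟩⟩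

theorem pcY : PathConnectedSpace D.Y := by
  obtain ⟨y0, h0⟩ := D.root_path
  have h1 : ∀ n : ℕ, Joined y0 (D.rt (n * (-(D.q : ZMod D.p))) y0) := by
    intro n
    induction n with
    | zero => rw [Nat.cast_zero, zero_mul, rt_zero]
    | succ n ih => 
      have := D.joined_rt h0 (n * (-(D.q : ZMod D.p)))
      rw [← rt_add] at this
      refine ih.trans ?_
      convert this using 2
      push_cast
      ring
  have h2 : ∀ a, Joined y0 (D.rt a y0) := by
    intro a
    have := h1 (a * (-(D.q : ZMod D.p)⁻¹)).val
    rw [ZMod.natCast_val, ZMod.cast_id] at this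
    convert this using 2
    have := D.q_inv
    linear_combination -a * this
  have h3 : ∀ y, Joined y0 y := by
    intro y
    obtain ⟨a, ha⟩ := D.joined_line y y0
    exact (h2 a).trans ha.symm
  exact ⟨⟨y0⟩, fun y y' => (h3 y).symm.trans (h3 y')⟩

theorem scY (hπ : ∀ x : D.X, Nonempty (FundamentalGroup D.X x ≃* Multiplicative (ZMod D.p))) : 
    SimplyConnectedSpace D.Y := by
  have := D.pcY
  rw [simply_connected_iff_loops_nullhomotopic]
  refine ⟨D.pcY, ?_⟩
  intro y γ
  let e : D.pj ⁻¹' {D.pj y} := ⟨y, rfl⟩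
  obtain ⟨f⟩ := hπ (D.pj y)
  have hs := D.pj_qc.fundamentalGroupToMulOpposite_surjective e
  have hi : Function.Injective (D.pj_qc.fundamentalGroupToMulOpposite e) := by
    have h1 : Function.Surjective fun g : Multiplicative (ZMod D.p) => 
      (D.pj_qc.fundamentalGroupToMulOpposite e (f.symm g)).unop := 
      (MulOpposite.unop_surjective.comp hs).comp f.symm.surjective
    have h2 := Finite.injective_iff_surjective.2 h1
    intro a b hab
    apply f.injective
    apply h2
    simp [hab]
  have h1 : D.pj_qc.fundamentalGroupToMulOpposite e 
      ((Path.Homotopic.Quotient.mk γ).map ⟨D.pj, D.pj_cov.continuous⟩ : FundamentalGroup D.X (D.pj y)) = 1 := by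
    rw [IsQuotientCoveringMap.fundamentalGroupToMulOpposite_eq_one_iff]
    exact D.pj_cov.monodromy_map _
  rw [← map_one (D.pj_qc.fundamentalGroupToMulOpposite e)] at h1
  have h2 := hi h1
  rw [← Path.Homotopic.Quotient.eq]
  exact D.pj_cov.injective_path_homotopic_map y y h2

end Dat
end Oka

namespace Oka
open Filter Topology unitInterval CategoryTheory

theorem pi1_homeo {X Y : Type} [TopologicalSpace X] [TopologicalSpace Y] (e : X ≃ₜ Y) (x : X) : 
    Nonempty (FundamentalGroup X x ≃* FundamentalGroup Y (e x)) := 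
  ⟨((FundamentalGroupoidFunctor.equivOfHomotopyEquiv e.toHomotopyEquiv).fullyFaithfulFunctor.mulEquivEnd
    (FundamentalGroupoid.mk x))⟩

namespace Dat
variable (D : Dat)

theorem conn_fib (s : ℂ) (hs : s ≠ 0) (h : IsConnected {x : P2 | x ∉ V D.fp ∩ V D.fq ∧
        s ^ D.p * MvPolynomial.eval x.rep (D.fp ^ D.q) = 1 * MvPolynomial.eval x.rep (D.fq ^ D.p)}) : 
    IsConnected ((fun y : D.Y => D.Q y) ⁻¹' {s}) := by
  obtain ⟨m, n, hmn⟩ := D.exists_bezout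
  let l : (Fin 3 → ℂ) → ℂ := fun v => (D.P v)⁻¹ ^ m * (s / D.Q v) ^ n
  let G : (Fin 3 → ℂ) → (Fin 3 → ℂ) := fun v => l v • v
  have hGs : ∀ (t : ℂ) (v), t ≠ 0 → D.P v ≠ 0 → D.Q v ≠ 0 → G (t • v) = G v := by
    intro t v ht hP hQ
    show ((D.P (t • v))⁻¹ ^ m * (s / D.Q (t • v)) ^ n) • t • v = ((D.P v)⁻¹ ^ m * (s / D.Q v) ^ n) • v
    rw [smul_smul, P_smul, Q_smul]
    congr 1
    have e : t = (t ^ D.p) ^ m * (t ^ D.q) ^ n := by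
      rw [← zpow_natCast, ← zpow_natCast, ← zpow_mul, ← zpow_mul, ← zpow_add₀ ht, hmn, zpow_one]
    have h1 : (t ^ D.p) ^ m ≠ 0 := zpow_ne_zero _ (pow_ne_zero _ ht)
    have h2 : (t ^ D.q) ^ n ≠ 0 := zpow_ne_zero _ (pow_ne_zero _ ht)
    have e1 : ((t ^ D.p * D.P v)⁻¹) ^ m = ((t ^ D.p) ^ m)⁻¹ * (D.P v)⁻¹ ^ m := by
      rw [mul_inv, mul_zpow, inv_zpow]
    have e2 : (s / (t ^ D.q * D.Q v)) ^ n = ((t ^ D.q) ^ n)⁻¹ * (s / D.Q v) ^ n := by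
      rw [show s / (t ^ D.q * D.Q v) = (t ^ D.q)⁻¹ * (s / D.Q v) by field_simp, mul_zpow, inv_zpow]
    rw [e1, e2]
    nth_rw 3 [e]
    field_simp
  let O : Set P2 := {x | D.P x.rep ≠ 0 ∧ D.Q x.rep ≠ 0}
  have hmk : ∀ (v : Fin 3 → ℂ) (hv : v ≠ 0), ∃ t : ℂ, t ≠ 0 ∧ (Projectivization.mk ℂ v hv).rep = t • v := by
    intro v hv
    obtain ⟨a, ha⟩ := Projectivization.exists_smul_eq_mk_rep ℂ v hv
    exact ⟨a, a.ne_zero, ha.symm⟩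
  have hO : ∀ (v : Fin 3 → ℂ) (hv : v ≠ 0), Projectivization.mk ℂ v hv ∈ O ↔ D.P v ≠ 0 ∧ D.Q v ≠ 0 := by
    intro v hv
    obtain ⟨t, ht, h⟩ := hmk v hv
    show D.P _ ≠ 0 ∧ D.Q _ ≠ 0 ↔ _
    rw [h, P_smul, Q_smul]
    simp [ht]
  have hG : ∀ (v : Fin 3 → ℂ) (hv : v ≠ 0), Projectivization.mk ℂ v hv ∈ O → G (Projectivization.mk ℂ v hv).rep = G v := by
    intro v hv hvO
    rw [hO] at hvO
    obtain ⟨t, ht, h⟩ := hmk v hv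
    rw [h, hGs t v ht hvO.1 hvO.2]
  have hopen : IsOpen {v : Fin 3 → ℂ | D.P v ≠ 0 ∧ D.Q v ≠ 0} := 
    D.isOpen_ne.inter (isOpen_ne_fun D.continuous_Q continuous_const)
  have quo : ∀ S : Set P2, IsOpen ((fun v : {v : Fin 3 → ℂ // v ≠ 0} => (Projectivization.mk ℂ v.1 v.2 : P2)) ⁻¹' S) → 
    IsOpen S := fun S h => h
  have hOo : IsOpen O := by
    apply quo
    have : ((fun v : {v : Fin 3 → ℂ // v ≠ 0} => (Projectivization.mk ℂ v.1 v.2 : P2)) ⁻¹' O) = 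
      Subtype.val ⁻¹' {v : Fin 3 → ℂ | D.P v ≠ 0 ∧ D.Q v ≠ 0} := by
      ext v
      exact hO v.1 v.2
    rw [this]
    exact hopen.preimage continuous_subtype_val
  have hGc : ContinuousOn G {v : Fin 3 → ℂ | D.P v ≠ 0 ∧ D.Q v ≠ 0} := by
    have g1 : ContinuousOn (fun v => (D.P v)⁻¹ ^ m) {v : Fin 3 → ℂ | D.P v ≠ 0 ∧ D.Q v ≠ 0} := (D.continuous_P.continuousOn.inv₀ fun v hv => hv.1).zpow₀ m fun v hv => Or.inl (inv_ne_zero hv.1)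
    have g2 : ContinuousOn (fun v => (s / D.Q v) ^ n) {v : Fin 3 → ℂ | D.P v ≠ 0 ∧ D.Q v ≠ 0} := (continuousOn_const.div D.continuous_Q.continuousOn fun v hv => hv.2).zpow₀ n 
        fun v hv => Or.inl (div_ne_zero hs hv.2)
    exact (g1.mul g2).smul continuousOn_id
  have hgc : ContinuousOn (fun x : P2 => G x.rep) O := by
    rw [continuousOn_open_iff hOo]
    intro t ht
    apply quo
    have : ((fun v : {v : Fin 3 → ℂ // v ≠ 0} => (Projectivization.mk ℂ v.1 v.2 : P2)) ⁻¹' 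
      (O ∩ (fun x : P2 => G x.rep) ⁻¹' t)) = 
      Subtype.val ⁻¹' ({v : Fin 3 → ℂ | D.P v ≠ 0 ∧ D.Q v ≠ 0} ∩ G ⁻¹' t) := by
      ext v
      constructor
      · rintro ⟨h1, h2⟩
        have h2 : G (Projectivization.mk ℂ v.1 v.2).rep ∈ t := h2
        rw [hG v.1 v.2 h1] at h2
        exact ⟨(hO v.1 v.2).1 h1, h2⟩
      · rintro ⟨h1, h2⟩
        have h1 := (hO v.1 v.2).2 h1
        refine ⟨h1, ?_⟩
        show G (Projectivization.mk ℂ v.1 v.2).rep ∈ t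
        rw [hG v.1 v.2 h1]
        exact h2
    rw [this]
    exact (hGc.isOpen_inter_preimage hopen ht).preimage continuous_subtype_val
  have hSO : ∀ x : P2, (x ∉ V D.fp ∩ V D.fq ∧ 
      s ^ D.p * MvPolynomial.eval x.rep (D.fp ^ D.q) = 1 * MvPolynomial.eval x.rep (D.fq ^ D.p)) ↔ 
      x ∈ O ∧ s ^ D.p * D.P x.rep ^ D.q = D.Q x.rep ^ D.p := by
    intro x
    rw [map_pow, map_pow, one_mul]
    refine and_congr_left fun h => ?_
    change s ^ D.p * D.P x.rep ^ D.q = D.Q x.rep ^ D.p at h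
    have hq0 : D.q ≠ 0 := by have := D.hq; omega
    have : D.P x.rep = 0 ↔ D.Q x.rep = 0 := by
      constructor
      · intro h0
        rw [h0, zero_pow hq0, mul_zero] at h
        exact pow_eq_zero_iff (NeZero.ne D.p) |>.1 h.symm
      · intro h0
        rw [h0, zero_pow (NeZero.ne D.p), mul_eq_zero] at h
        exact pow_eq_zero_iff hq0 |>.1 (h.resolve_left (pow_ne_zero _ hs))
    show ¬ (D.P x.rep = 0 ∧ D.Q x.rep = 0) ↔ D.P x.rep ≠ 0 ∧ D.Q x.rep ≠ 0
    tauto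
  simp only [hSO] at h
  have him := h.image (fun x : P2 => G x.rep) (hgc.mono fun x hx => hx.1)
  have heq : Subtype.val '' ((fun y : D.Y => D.Q y) ⁻¹' {s}) = 
      (fun x : P2 => G x.rep) '' {x | x ∈ O ∧ s ^ D.p * D.P x.rep ^ D.q = D.Q x.rep ^ D.p} := by
    ext v
    constructor
    · rintro ⟨y, hy, rfl⟩
      have hy : D.Q y = s := hy
      have hyO : Projectivization.mk ℂ y.1 (D.y_ne y) ∈ O := 
        (hO _ _).2 ⟨by rw [y.2]; exact one_ne_zero, by rw [hy]; exact hs⟩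
      refine ⟨Projectivization.mk ℂ y.1 (D.y_ne y), ⟨hyO, ?_⟩, ?_⟩
      · obtain ⟨t, ht, h⟩ := hmk y.1 (D.y_ne y)
        rw [h, P_smul, Q_smul, hy, y.2]
        ring
      · simp only
        rw [hG _ _ hyO]
        show ((D.P y.1)⁻¹ ^ m * (s / D.Q y.1) ^ n) • y.1 = y.1
        rw [y.2, hy, div_self hs, inv_one, one_zpow, one_zpow, one_mul, one_smul]
    · rintro ⟨x, ⟨⟨hP, hQ⟩, hx⟩, rfl⟩
      set v := x.rep
      have e0 : (s / D.Q v) ^ D.p = (D.P v)⁻¹ ^ D.q := by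
        rw [div_pow, ← hx, inv_pow]
        have := pow_ne_zero D.p hs
        have := pow_ne_zero D.q hP
        field_simp
      have hP' := inv_ne_zero hP
      have hQ' := div_ne_zero hs hQ
      refine ⟨⟨G v, ?_⟩, ?_, rfl⟩
      · show D.P (l v • v) = 1
        rw [P_smul]
        show ((D.P v)⁻¹ ^ m * (s / D.Q v) ^ n) ^ D.p * D.P v = 1
        have : ((D.P v)⁻¹ ^ m * (s / D.Q v) ^ n) ^ D.p = (D.P v)⁻¹ ^ ((D.p : ℤ) * m + D.q * n) := by
          rw [mul_pow, zpow_add₀ hP', zpow_mul, zpow_mul (D.P v)⁻¹ (D.q : ℤ), zpow_natCast, zpow_natCast, ← e0]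
          congr 1
          · rw [← zpow_natCast, ← zpow_mul, mul_comm, zpow_mul, zpow_natCast]
          · rw [← zpow_natCast, ← zpow_mul, mul_comm, zpow_mul, zpow_natCast]
        rw [this, hmn, zpow_one, inv_mul_cancel₀ hP]
      · show D.Q (l v • v) = s
        rw [Q_smul]
        show ((D.P v)⁻¹ ^ m * (s / D.Q v) ^ n) ^ D.q * D.Q v = s
        have : ((D.P v)⁻¹ ^ m * (s / D.Q v) ^ n) ^ D.q = (s / D.Q v) ^ ((D.p : ℤ) * m + D.q * n) := by
          rw [mul_pow, zpow_add₀ hQ', zpow_mul, zpow_mul (s / D.Q v) (D.q : ℤ), zpow_natCast, zpow_natCast, e0]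
          congr 1
          · rw [← zpow_natCast, ← zpow_mul, mul_comm, zpow_mul, zpow_natCast]
          · rw [← zpow_natCast, ← zpow_mul, mul_comm, zpow_mul, zpow_natCast]
        rw [this, hmn, zpow_one, div_mul_cancel₀ _ hQ]
  rw [← heq] at him
  exact ⟨him.nonempty.of_image, IsInducing.subtypeVal.isPreconnected_image.1 him.isPreconnected⟩

end Dat

theorem Trans.mono {Y : Type} [TopologicalSpace Y] {φ : Y → ℂ} {B B' : Set ℂ} (h : Trans φ B) (hB : B ⊆ B') : 
    Trans φ B' := fun c hc => h c fun hc' => hc (hB hc')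

theorem pt_ne (c : ℂ) : ![1, c] ≠ 0 := fun h => one_ne_zero (congrFun h 0)

theorem pt_eq_iff {a b a' b' : ℂ} (h : ![a, b] ≠ 0) (h' : ![a', b'] ≠ 0) : 
    pt a b h = pt a' b' h' ↔ ∃ t : ℂ, t * a' = a ∧ t * b' = b := by
  rw [pt, pt, Projectivization.mk_eq_mk_iff']
  refine exists_congr fun t => ?_
  constructor
  · intro h
    exact ⟨congrFun h 0, congrFun h 1⟩
  · rintro ⟨h0, h1⟩
    ext i
    fin_cases i
    · exact h0
    · exact h1

theorem pt_inj : Function.Injective fun c => pt 1 c (pt_ne c) := by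
  intro c c' h
  rw [pt_eq_iff] at h
  obtain ⟨t, h1, h2⟩ := h
  rw [mul_one] at h1
  rw [h1, one_mul] at h2
  exact h2.symm

namespace Dat
variable (D : Dat)

theorem exists_fib 
    (hconn : ∃ A₀ : Set P1, A₀.Finite ∧ ∀ (a b : ℂ) (hab : ![a, b] ≠ 0),
      pt a b hab ∉ A₀ →
      IsConnected {x : P2 | x ∉ V D.fp ∩ V D.fq ∧
        b * MvPolynomial.eval x.rep (D.fp ^ D.q) = a * MvPolynomial.eval x.rep (D.fq ^ D.p)}) 
    (hπ : ∀ x : D.X, Nonempty (FundamentalGroup D.X x ≃* Multiplicative (ZMod D.p))) : 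
    ∃ F : Fib D.p D.Y D.X, F.P = D.pj ∧ F.ψ = fun y : D.Y => D.Q y := by
  obtain ⟨A₀, hA₀, hc⟩ := hconn
  obtain ⟨B, hB, hB0, hT⟩ := D.transY
  refine ⟨{ ψ := fun y : D.Y => D.Q y, ψ_cont := D.continuous_Q.comp continuous_subtype_val, rot := D.rt, 
            rot_cont := D.rt_cont, rot_zero := D.rt_zero, rot_add := D.rt_add, rot_free := D.rt_free, 
            ψ_rot := D.Q_rt, B := B ∪ (fun c => pt 1 c (pt_ne c)) ⁻¹' A₀, 
            B_fin := hB.union (hA₀.preimage pt_inj.injOn), B0 := Or.inl hB0, 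
            trans := hT.mono Set.subset_union_left, conn := ?_, P := D.pj, cov := D.pj_cov, surj := D.pj_surj, 
            P_eq := D.pj_rt, lpc := D.lpcY, sc := D.scY hπ }, rfl, rfl⟩
  intro s hs
  have hs0 : s ≠ 0 := by
    rintro rfl
    exact hs (Or.inl (by rw [zero_pow (NeZero.ne _)]; exact hB0))
  exact D.conn_fib s hs0 (hc 1 (s ^ D.p) (pt_ne _) fun h => hs (Or.inr h))

end Dat

theorem final (D : Dat) 
    (hconn : ∃ A₀ : Set P1, A₀.Finite ∧ ∀ (a b : ℂ) (hab : ![a, b] ≠ 0),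
      pt a b hab ∉ A₀ →
      IsConnected {x : P2 | x ∉ V D.fp ∩ V D.fq ∧
        b * MvPolynomial.eval x.rep (D.fp ^ D.q) = a * MvPolynomial.eval x.rep (D.fq ^ D.p)}) 
    (hπ : ∀ x : D.X, Nonempty (FundamentalGroup D.X x ≃* Multiplicative (ZMod D.p))) : 
    ∃ A : Set P1, A.Finite ∧
      ∀ (r : ℕ) (a b : Fin (r + 1) → ℂ) (hab : ∀ i, ![a i, b i] ≠ 0),
        (∀ i, pt (a i) (b i) (hab i) ∉ A) →
        Function.Injective (fun i => pt (a i) (b i) (hab i)) →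
        ∀ x : ↥((⋃ i, V (C (b i) * D.fp ^ D.q - C (a i) * D.fq ^ D.p)) ∪ V D.fp)ᶜ,
          Nonempty
            (FundamentalGroup (↥((⋃ i, V (C (b i) * D.fp ^ D.q - C (a i) * D.fq ^ D.p)) ∪ V D.fp)ᶜ) x ≃*
              Monoid.Coprod (FreeGroup (Fin (r + 1))) (Multiplicative (ZMod D.p))) := by
  obtain ⟨F, hFP, hFψ⟩ := D.exists_fib hconn hπ
  have h01 : ![(0 : ℂ), 1] ≠ 0 := fun h => one_ne_zero (congrFun h 1)
  refine ⟨(fun c => pt 1 c (pt_ne c)) '' F.B ∪ {pt 0 1 h01}, (F.B_fin.image _).union (Set.finite_singleton _), ?_⟩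
  intro r a b hab hA hinj x
  have ha : ∀ i, a i ≠ 0 := by
    intro i h0
    apply hA i
    right
    show _ = _
    rw [pt_eq_iff]
    exact ⟨b i, by rw [h0, mul_zero], mul_one _⟩
  let c : Fin (r + 1) → ℂ := fun i => b i / a i
  have hpt : ∀ i, pt (a i) (b i) (hab i) = pt 1 (c i) (pt_ne _) := by
    intro i
    rw [pt_eq_iff]
    exact ⟨a i, mul_one _, mul_div_cancel₀ _ (ha i)⟩
  have hc : Function.Injective c := by
    intro i j hij
    apply hinj
    simp only
    rw [hpt, hpt]
    simp only [hij]
  have hcB : ∀ i, c i ∉ F.B := fun i hi => hA i (Or.inl ⟨c i, hi, (hpt i).symm⟩)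
  have hmem : ∀ z : D.X, z ∈ F.U c ↔ z.1 ∉ ⋃ i, V (C (b i) * D.fp ^ D.q - C (a i) * D.fq ^ D.p) := by
    intro z
    have hP : D.P z.1.rep ≠ 0 := z.2
    have key : z ∈ F.U c ↔ ∀ i, D.φ z.1.rep ≠ c i := by
      obtain ⟨y, hy⟩ := D.pj_surj z
      have hφ : ∀ y, D.pj y = z → F.φ y = D.φ z.1.rep := by
        rintro y rfl
        obtain ⟨t, ht⟩ := Projectivization.exists_smul_eq_mk_rep ℂ y.1 (D.y_ne y)
        show F.ψ y ^ D.p = D.φ (Projectivization.mk ℂ y.1 (D.y_ne y)).rep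
        rw [← ht, Units.smul_def, D.φ_smul t.ne_zero, D.φ_Y, hFψ]
      constructor
      · intro h i
        rw [← hφ y hy]
        exact h y (by rw [hFP, hy]) i
      · intro h y' hy' i
        rw [hφ y' (by rw [← hFP, hy'])]
        exact h i
    rw [key, Set.mem_iUnion, not_exists]
    refine forall_congr' fun i => not_congr ?_
    rw [D.φ_eq_iff hP]
    show _ ↔ MvPolynomial.eval z.1.rep _ = 0
    rw [map_sub, map_mul, map_mul, map_pow, map_pow, eval_C, eval_C, sub_eq_zero]
    show _ = b i / a i * _ ↔ _
    have := ha i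
    constructor
    · intro h
      show b i * D.P z.1.rep ^ D.q = a i * D.Q z.1.rep ^ D.p
      rw [h]
      field_simp
    · intro h
      change b i * D.P z.1.rep ^ D.q = a i * D.Q z.1.rep ^ D.p at h
      rw [div_mul_eq_mul_div, h, mul_div_cancel_left₀ _ this]
  let e : ↥((⋃ i, V (C (b i) * D.fp ^ D.q - C (a i) * D.fq ^ D.p)) ∪ V D.fp)ᶜ ≃ₜ ↥(F.U c) := 
    { toFun := fun z => ⟨⟨z.1, fun h => z.2 (Or.inr h)⟩, (hmem _).2 fun h => z.2 (Or.inl h)⟩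
      invFun := fun u => ⟨u.1.1, fun h => h.elim ((hmem _).1 u.2) u.1.2⟩
      left_inv := fun z => rfl
      right_inv := fun u => rfl
      continuous_toFun := (continuous_subtype_val.subtype_mk _).subtype_mk _
      continuous_invFun := (continuous_subtype_val.comp continuous_subtype_val).subtype_mk _ }
  obtain ⟨f⟩ := pi1_homeo e x
  obtain ⟨g⟩ := F.main c hc hcB (e x)
  exact ⟨f.trans g⟩

end Oka

/-- Under the hypotheses of the generalized Oka theorem, if moreover `f_p`
is irreducible and `π₁(ℙ² \ V(f_p)) ≅ ℤ_p`, then the complement of the union of `r+1` distinct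
generic fibers of the pencil together with `V(f_p)` has fundamental group `𝔽_{r+1} * ℤ_p`. -/
theorem stmt_2 (p q : ℕ) (hp : 1 ≤ p) (hq : 1 ≤ q) (hpq : Nat.Coprime p q)
    (fp fq : MvPolynomial (Fin 3) ℂ)
    (hfp0 : fp ≠ 0) (hfp : fp.IsHomogeneous p)
    (hfq0 : fq ≠ 0) (hfq : fq.IsHomogeneous q)
    -- (i) neither `f_p` nor `f_q` is a `k`-th power of another polynomial for `k ≥ 2`
    (hpowp : ∀ k, 2 ≤ k → ∀ h : MvPolynomial (Fin 3) ℂ, fp ≠ h ^ k)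
    (hpowq : ∀ k, 2 ≤ k → ∀ h : MvPolynomial (Fin 3) ℂ, fq ≠ h ^ k)
    -- (ii) no nonconstant common factor
    (hcf : ∀ h : MvPolynomial (Fin 3) ℂ, h ∣ fp → h ∣ fq → h.totalDegree = 0)
    -- (iii) the generic fibers of the pencil `F = [f_p^q : f_q^p]` are connected
    (hconn : ∃ A₀ : Set P1, A₀.Finite ∧ ∀ (a b : ℂ) (hab : ![a, b] ≠ 0),
      pt a b hab ∉ A₀ →
      IsConnected {x : P2 | x ∉ V fp ∩ V fq ∧
        b * eval x.rep (fp ^ q) = a * eval x.rep (fq ^ p)})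
    -- (iv) the multiple fibers of `F` lie over a subset of `{[0:1], [1:0]}`
    (hmult : ∀ a b : ℂ, a ≠ 0 → b ≠ 0 → ∀ k, 2 ≤ k →
      ∀ h : MvPolynomial (Fin 3) ℂ, C b * fp ^ q - C a * fq ^ p ≠ h ^ k)
    -- `f_p` is irreducible
    (hirr : Irreducible fp)
    -- `π₁(ℙ² \ V(f_p)) ≅ ℤ_p`
    (hπp : ∀ x : ↥(V fp)ᶜ,
      Nonempty (FundamentalGroup (↥(V fp)ᶜ) x ≃* Multiplicative (ZMod p))) :
    ∃ A : Set P1, A.Finite ∧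
      ∀ (r : ℕ) (a b : Fin (r + 1) → ℂ) (hab : ∀ i, ![a i, b i] ≠ 0),
        (∀ i, pt (a i) (b i) (hab i) ∉ A) →
        Function.Injective (fun i => pt (a i) (b i) (hab i)) →
        ∀ x : ↥((⋃ i, V (C (b i) * fp ^ q - C (a i) * fq ^ p)) ∪ V fp)ᶜ,
          Nonempty
            (FundamentalGroup (↥((⋃ i, V (C (b i) * fp ^ q - C (a i) * fq ^ p)) ∪ V fp)ᶜ) x ≃*
              Monoid.Coprod (FreeGroup (Fin (r + 1))) (Multiplicative (ZMod p))) := by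
  have h := Oka.final
    { p := p, q := q, hp := hp, hq := hq, hpq := hpq, fp := fp, fq := fq, hfp := hfp, hfq := hfq,
      hfq0 := hfq0, hirr := hirr, hcf := hcf } hconn hπp
  exact h
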